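/- There exists an absolute constant C > 0 with the following property. Let a, b, c, d be squarefree positive integers with a ≠ b and c ≠ d, and let e, f be integers; in the case a·f = c·e, assume additionally that a·b·c·d is not a perfect square. Then every triple of positive integers (x, y, z) satisfying the simultaneous Pell equations a·x² − b·y² = e and c·x² − d·z² = f satisfies max(x, y, z) < exp(C·α²·(log α)³·γ·log γ), where α = max(a, b, c, d), β = max(|e|, |f|, 3) and γ = max(α·log α, log β). -/

import Mathlib

open Real

/-- The product formula in the form of Liouville's inequality: a nonzero element of a number field
whose conjugates become integral after multiplication by a root `Δ` of a natural number. -/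
lemma one_le_prod_embeddings {F : Type*} [Field F] [NumberField F] {v : F} (hv : v ≠ 0)
    {Δ : ℝ} (hΔ : 0 < Δ) {n : ℕ} (hn : n ≠ 0) {D : ℕ} (hD : Δ ^ n = D)
    (hint : ∀ φ : F →+* ℂ, IsIntegral ℤ ((Δ : ℂ) * φ v)) :
    1 ≤ ∏ φ : F →+* ℂ, (Δ * ‖φ v‖) := by
  classical
  set P : ℂ := ∏ φ : F →+* ℂ, ((Δ : ℂ) * φ v) with hP
  have hPint : IsIntegral ℤ P := IsIntegral.prod _ fun φ _ => hint φ
  have hnorm : ∏ φ : F →+* ℂ, φ v = ((Algebra.norm ℚ v : ℚ) : ℂ) := by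
    have h := Algebra.norm_eq_prod_embeddings ℚ ℂ v
    have h2 : (algebraMap ℚ ℂ) ((Algebra.norm ℚ) v) = ((Algebra.norm ℚ v : ℚ) : ℂ) := rfl
    rw [← h2, h]
    exact Fintype.prod_equiv (RingHom.equivRatAlgHom F ℂ) _ _ fun φ => rfl
  have hP2 : P = (Δ : ℂ) ^ Fintype.card (F →+* ℂ) * ((Algebra.norm ℚ v : ℚ) : ℂ) := by
    rw [hP, Finset.prod_mul_distrib, hnorm]; simp
  set d := Fintype.card (F →+* ℂ)
  have hDc : (Δ : ℂ) ^ n = D := by exact_mod_cast congrArg (fun r : ℝ => (r : ℂ)) hD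
  have hPn : P ^ n = (((D : ℚ) ^ d * (Algebra.norm ℚ v) ^ n : ℚ) : ℂ) := by
    rw [hP2, mul_pow, ← pow_mul, mul_comm d n, pow_mul, hDc]; push_cast; ring
  have hq : IsIntegral ℤ ((D : ℚ) ^ d * (Algebra.norm ℚ v) ^ n : ℚ) := by
    have h1 : IsIntegral ℤ (algebraMap ℚ ℂ ((D : ℚ) ^ d * (Algebra.norm ℚ v) ^ n)) := by
      have := hPint.pow n
      rw [hPn] at this; exact this
    exact (isIntegral_algebraMap_iff (algebraMap ℚ ℂ).injective).1 h1
  obtain ⟨z, hz⟩ := IsIntegrallyClosed.isIntegral_iff.1 hq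
  have hz' : P ^ n = (z : ℂ) := by
    rw [hPn, ← hz]; simp
  have hP0 : P ≠ 0 := by
    rw [hP, Finset.prod_ne_zero_iff]
    intro φ _
    exact mul_ne_zero (by exact_mod_cast hΔ.ne') (by simpa using hv)
  have hz0 : z ≠ 0 := by
    rintro rfl
    simp only [Int.cast_zero] at hz'
    exact hP0 (pow_eq_zero_iff hn |>.1 hz')
  have h1 : 1 ≤ ‖P‖ ^ n := by
    rw [← norm_pow, hz', Complex.norm_intCast]
    exact_mod_cast Int.one_le_abs hz0
  have h2 : 1 ≤ ‖P‖ := by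
    by_contra hlt
    exact absurd h1 (not_le.2 (pow_lt_one₀ (norm_nonneg _) (not_le.1 hlt) hn))
  calc 1 ≤ ‖P‖ := h2
    _ = _ := by
      rw [hP, norm_prod]
      refine Finset.prod_congr rfl fun φ _ => ?_
      rw [norm_mul, Complex.norm_real, Real.norm_of_nonneg hΔ.le]

/-- Liouville's inequality with a uniform bound for all conjugates. -/
lemma liouville_lower_bound {F : Type*} [Field F] [NumberField F] {v : F} (hv : v ≠ 0)
    {Δ : ℝ} (hΔ : 1 ≤ Δ) {n : ℕ} (hn : n ≠ 0) {D : ℕ} (hD : Δ ^ n = D)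
    (hint : ∀ φ : F →+* ℂ, IsIntegral ℤ ((Δ : ℂ) * φ v)) {H : ℝ} (hH : 1 ≤ H)
    (hle : ∀ φ : F →+* ℂ, ‖φ v‖ ≤ H) {d : ℕ} (hd : Module.finrank ℚ F ≤ d) (ψ : F →+* ℂ) :
    ((Δ * H) ^ d)⁻¹ ≤ ‖ψ v‖ := by
  classical
  have h := one_le_prod_embeddings hv (by linarith) hn hD hint
  rw [← Finset.mul_prod_erase _ _ (Finset.mem_univ ψ)] at h
  have h1 : 1 ≤ Δ * H := one_le_mul_of_one_le_of_one_le hΔ hH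
  have hcard : (Finset.univ.erase ψ).card + 1 ≤ d := by
    rw [Finset.card_erase_add_one (Finset.mem_univ ψ), Finset.card_univ,
      NumberField.Embeddings.card]
    exact hd
  have h2 : ∏ φ ∈ Finset.univ.erase ψ, (Δ * ‖φ v‖) ≤ (Δ * H) ^ (Finset.univ.erase ψ).card := by
    rw [← Finset.prod_const]
    refine Finset.prod_le_prod (fun φ _ => by positivity) fun φ _ => ?_
    exact mul_le_mul_of_nonneg_left (hle φ) (by linarith)
  have h3 : 1 ≤ ‖ψ v‖ * (Δ * H) ^ d := by
    calc 1 ≤ _ := h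
      _ ≤ (Δ * ‖ψ v‖) * (Δ * H) ^ (Finset.univ.erase ψ).card := by gcongr
      _ ≤ ((Δ * H) * ‖ψ v‖) * (Δ * H) ^ (Finset.univ.erase ψ).card := by
        gcongr
        nlinarith
      _ = ‖ψ v‖ * (Δ * H) ^ ((Finset.univ.erase ψ).card + 1) := by ring
      _ ≤ _ := by gcongr
  rw [inv_le_iff_one_le_mul₀ (by positivity)]
  exact h3

lemma trace_eq_zero_of_sq_mem {K F : Type*} [Field K] [Field F] [Algebra K F]
    [FiniteDimensional K F] [CharZero K] {y : F} {a : K} (hy : y ^ 2 = algebraMap K F a)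
    (hy' : y ∉ Set.range (algebraMap K F)) : Algebra.trace K F y = 0 := by
  have hmin : minpoly K y = Polynomial.X ^ 2 - Polynomial.C a := by
    have hint : IsIntegral K y := IsIntegral.of_finite K y
    have hdvd : minpoly K y ∣ Polynomial.X ^ 2 - Polynomial.C a := by
      apply minpoly.dvd; simp [hy]
    have hmonic : (Polynomial.X ^ 2 - Polynomial.C a : Polynomial K).Monic :=
      Polynomial.monic_X_pow_sub_C a two_ne_zero
    have hdeg : 2 ≤ (minpoly K y).natDegree := (minpoly.two_le_natDegree_iff hint).2 hy'
    refine (Polynomial.eq_of_monic_of_dvd_of_natDegree_le (minpoly.monic hint) hmonic hdvd ?_).symm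
    rw [Polynomial.natDegree_X_pow_sub_C]; exact hdeg
  rw [trace_eq_finrank_mul_minpoly_nextCoeff, hmin]
  have : (Polynomial.X ^ 2 - Polynomial.C a : Polynomial K).nextCoeff = 0 := by
    rw [Polynomial.nextCoeff_of_natDegree_pos (by simp), Polynomial.natDegree_X_pow_sub_C]
    simp [Polynomial.coeff_X_pow]
  rw [this]; simp

/-- Square roots from different classes modulo squares do not interact in a linear relation. -/
lemma sum_sqrt_class_eq_zero {K F ι : Type*} [Field K] [Field F] [Algebra K F]
    [FiniteDimensional K F] [CharZero K] {I : Finset ι} {θ : ι → F} {U : ι → K} {g : ι → K}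
    (hθ : ∀ i ∈ I, θ i ^ 2 = algebraMap K F (g i)) {i₀ : ι} (hi₀ : i₀ ∈ I) (h0 : θ i₀ ≠ 0)
    (hsum : ∑ i ∈ I, algebraMap K F (U i) * θ i = 0) (J : Finset ι)
    (hJ : ∀ i, i ∈ J ↔ i ∈ I ∧ θ i * θ i₀ ∈ Set.range (algebraMap K F)) :
    ∑ i ∈ J, algebraMap K F (U i) * θ i = 0 := by
  classical
  have hJI : J ⊆ I := fun i hi => ((hJ i).1 hi).1
  choose! κ hκ using fun i (hi : i ∈ J) => ((hJ i).1 hi).2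
  have htr : Algebra.trace K F (∑ i ∈ I, algebraMap K F (U i) * (θ i * θ i₀)) = 0 := by
    have : ∑ i ∈ I, algebraMap K F (U i) * (θ i * θ i₀) = 0 := by
      rw [← zero_mul (θ i₀), ← hsum, Finset.sum_mul]
      exact Finset.sum_congr rfl fun i _ => by ring
    rw [this, map_zero]
  have hterm : ∀ i ∈ I, i ∉ J →
      Algebra.trace K F (algebraMap K F (U i) * (θ i * θ i₀)) = 0 := by
    intro i hi hiJ
    rw [← Algebra.smul_def, map_smul, trace_eq_zero_of_sq_mem (a := g i * g i₀), smul_zero]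
    · rw [mul_pow, hθ i hi, hθ i₀ hi₀, map_mul]
    · intro h; exact hiJ ((hJ i).2 ⟨hi, h⟩)
  rw [map_sum, ← Finset.sum_subset hJI hterm] at htr
  have h2 : ∑ i ∈ J, (Module.finrank K F : K) * (U i * κ i) = 0 := by
    rw [← htr]
    refine Finset.sum_congr rfl fun i hi => ?_
    rw [← hκ i hi, ← map_mul, Algebra.trace_algebraMap, nsmul_eq_mul]
  rw [← Finset.mul_sum] at h2
  have h3 : ∑ i ∈ J, U i * κ i = 0 := by
    rcases mul_eq_zero.1 h2 with h | h
    · exact absurd h (by exact_mod_cast (Module.finrank_pos (R := K) (M := F)).ne')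
    · exact h
  have h4 : (∑ i ∈ J, algebraMap K F (U i) * θ i) * θ i₀ = 0 := by
    rw [Finset.sum_mul, ← map_zero (algebraMap K F), ← h3, map_sum]
    refine Finset.sum_congr rfl fun i hi => ?_
    rw [map_mul, hκ i hi]; ring
  exact (mul_eq_zero.1 h4).resolve_right h0

/-- Iterated divided differences: `newtonQuotient f t i k z` is `f[t i, …, t (i + k - 1), z]`. -/
noncomputable def newtonQuotient (f : ℂ → ℂ) (t : ℕ → ℂ) (i : ℕ) : ℕ → ℂ → ℂ
  | 0 => f
  | k + 1 => dslope (newtonQuotient f t i k) (t (i + k))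

lemma differentiable_newtonQuotient {f : ℂ → ℂ} (hf : Differentiable ℂ f) (t : ℕ → ℂ) (i k : ℕ) :
    Differentiable ℂ (newtonQuotient f t i k) := by
  induction k with
  | zero => exact hf
  | succ k ih =>
    rw [newtonQuotient, ← differentiableOn_univ,
      Complex.differentiableOn_dslope Filter.univ_mem, differentiableOn_univ]
    exact ih

lemma newton_interpolation (f : ℂ → ℂ) (t : ℕ → ℂ) (N : ℕ) (z : ℂ) :
    f z = ∑ k ∈ Finset.range N, newtonQuotient f t 0 k (t k) * ∏ j ∈ Finset.range k, (z - t j) +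
      (∏ j ∈ Finset.range N, (z - t j)) * newtonQuotient f t 0 N z := by
  induction N with
  | zero => simp [newtonQuotient]
  | succ N ih =>
    rw [Finset.sum_range_succ, Finset.prod_range_succ]
    have h := sub_smul_dslope (newtonQuotient f t 0 N) (t N) z
    have h2 : newtonQuotient f t 0 (N + 1) z = dslope (newtonQuotient f t 0 N) (t N) z := by
      simp [newtonQuotient]
    rw [h2]
    rw [smul_eq_mul] at h
    rw [mul_assoc, h]
    linear_combination ih

lemma sub_mul_newtonQuotient {f : ℂ → ℂ} (hf : Differentiable ℂ f) (t : ℕ → ℂ) (i k : ℕ) (z : ℂ) :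
    (z - t i) * newtonQuotient f t i (k + 1) z =
      newtonQuotient f t (i + 1) k z - newtonQuotient f t i k (t (i + k)) := by
  induction k generalizing z with
  | zero => simpa [newtonQuotient] using sub_smul_dslope f (t i) z
  | succ k ih =>
    set p := t (i + (k + 1)) with hp
    have hL : Continuous fun z => (z - t i) * newtonQuotient f t i (k + 1 + 1) z :=
      (continuous_id.sub continuous_const).mul (differentiable_newtonQuotient hf t _ _).continuous
    have hR : Continuous fun z => newtonQuotient f t (i + 1) (k + 1) z -
        newtonQuotient f t i (k + 1) p :=
      (differentiable_newtonQuotient hf t _ _).continuous.sub continuous_const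
    refine congrFun (Continuous.ext_on (dense_compl_singleton p) hL hR fun w hw => ?_) z
    have hw' : w - p ≠ 0 := sub_ne_zero.2 hw
    apply mul_left_cancel₀ hw'
    have e1 := sub_smul_dslope (newtonQuotient f t i (k + 1)) p w
    have e2 := sub_smul_dslope (newtonQuotient f t (i + 1) k) p w
    have e3 : newtonQuotient f t i (k + 1 + 1) = dslope (newtonQuotient f t i (k + 1)) p := rfl
    have e4 : newtonQuotient f t (i + 1) (k + 1) = dslope (newtonQuotient f t (i + 1) k) p := by
      rw [newtonQuotient, hp]; congr 2; omega
    have e5 := ih w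
    have e6 := ih p
    rw [smul_eq_mul] at e1 e2
    rw [e3, e4]
    linear_combination (w - t i) * e1 - e2 + e5 - e6

lemma newtonQuotient_eq_iterate {f : ℂ → ℂ} {t : ℕ → ℂ} {i k : ℕ} {s : ℂ}
    (h : ∀ j < k, t (i + j) = s) :
    newtonQuotient f t i k = (Function.swap dslope s)^[k] f := by
  induction k with
  | zero => rfl
  | succ k ih =>
    rw [newtonQuotient, Function.iterate_succ_apply', ih fun j hj => h j (by omega), h k (by omega)]

lemma newtonQuotient_eq_coeff {f : ℂ → ℂ} {t : ℕ → ℂ} {i k : ℕ} {s : ℂ}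
    (h : ∀ j ≤ k, t (i + j) = s) {p : FormalMultilinearSeries ℂ ℂ ℂ}
    (hp : HasFPowerSeriesAt f p s) :
    newtonQuotient f t i k (t (i + k)) = p.coeff k := by
  rw [newtonQuotient_eq_iterate fun j hj => h j hj.le, h k le_rfl]
  have h1 := (hp.has_fpower_series_iterate_dslope_fslope k).coeff_zero 1
  rw [← h1]
  have h2 := FormalMultilinearSeries.coeff_iterate_fslope (p := p) k 0
  rw [zero_add] at h2
  exact h2

/-- Divided differences at `1, 3, 5, …`, each repeated `M` times. -/
lemma norm_newtonQuotient_le {f : ℂ → ℂ} (hf : Differentiable ℂ f) {M n : ℕ} (hM : 0 < M)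
    {η : ℝ} (hη : 0 ≤ η)
    (hsmall : ∀ i < n, ∃ p, HasFPowerSeriesAt f p (2 * (i : ℂ) + 1) ∧ ∀ j < M, ‖p.coeff j‖ ≤ η)
    (k i : ℕ) (hik : i + k < M * n) :
    ‖newtonQuotient f (fun m => 2 * ((m / M : ℕ) : ℂ) + 1) i k
      (2 * (((i + k) / M : ℕ) : ℂ) + 1)‖ ≤ η * ((2 * M) ^ k / k.factorial) := by
  set t : ℕ → ℂ := fun m => 2 * ((m / M : ℕ) : ℂ) + 1 with ht
  induction k generalizing i with
  | zero =>
    obtain ⟨p, hp, hpM⟩ := hsmall (i / M) (Nat.div_lt_of_lt_mul hik)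
    have := newtonQuotient_eq_coeff (t := t) (i := i) (k := 0) (s := t i) (by simp) (f := f) hp
    simp only [pow_zero, Nat.factorial_zero, Nat.cast_one, div_one, mul_one]
    have h2 : t (i + 0) = 2 * (((i + 0) / M : ℕ) : ℂ) + 1 := rfl
    rw [← h2, this]
    exact hpM 0 hM
  | succ k ih =>
    have hle : i / M ≤ (i + (k + 1)) / M := Nat.div_le_div_right (by omega)
    rcases hle.eq_or_lt with heq | hlt
    · obtain ⟨p, hp, hpM⟩ := hsmall (i / M) (Nat.div_lt_of_lt_mul (by omega))
      have hkM : k + 1 < M := by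
        have h1 := Nat.div_add_mod i M
        have h2 := Nat.div_add_mod (i + (k + 1)) M
        have h3 := Nat.mod_lt (i + (k + 1)) hM
        rw [heq] at h1
        omega
      have hts : ∀ j ≤ k + 1, t (i + j) = t i := by
        intro j hj
        have h1 : i / M ≤ (i + j) / M := Nat.div_le_div_right (by omega)
        have h2 : (i + j) / M ≤ (i + (k + 1)) / M := Nat.div_le_div_right (by omega)
        have h3 : (i + j) / M = i / M := by omega
        simp [ht, h3]
      have h4 := newtonQuotient_eq_coeff (t := t) (i := i) (k := k + 1) (s := t i) hts (f := f) hp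
      have h2 : t (i + (k + 1)) = 2 * (((i + (k + 1)) / M : ℕ) : ℂ) + 1 := rfl
      rw [← h2, h4]
      refine (hpM _ hkM).trans (le_mul_of_one_le_right hη ?_)
      rw [one_le_div (by positivity)]
      have h5 : (k + 1).factorial ≤ (2 * M) ^ (k + 1) :=
        (Nat.factorial_le_pow _).trans (Nat.pow_le_pow_left (by omega) _)
      exact_mod_cast h5
    · have hrec := sub_mul_newtonQuotient hf t i k (t (i + (k + 1)))
      have ha := ih (i + 1) (by omega)
      have hb := ih i (by omega)
      have h2 : t (i + (k + 1)) = 2 * (((i + (k + 1)) / M : ℕ) : ℂ) + 1 := rfl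
      have h3 : t (i + (k + 1)) = 2 * (((i + 1 + k) / M : ℕ) : ℂ) + 1 := by
        rw [h2]; congr 4; ring
      have h4 : t (i + k) = 2 * (((i + k) / M : ℕ) : ℂ) + 1 := rfl
      rw [← h3] at ha
      rw [← h4] at hb
      rw [← h2]
      obtain ⟨q, hq⟩ : ∃ q, (i + (k + 1)) / M = i / M + q ∧ 1 ≤ q :=
        ⟨(i + (k + 1)) / M - i / M, by omega, by omega⟩
      have hdiff : t (i + (k + 1)) - t i = ((2 * q : ℝ) : ℂ) := by
        simp only [ht, hq.1]; push_cast; ring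
      have hkq : ((k : ℝ) + 1) ≤ 2 * q * M := by
        have h1 := Nat.div_add_mod i M
        have h2 := Nat.div_add_mod (i + (k + 1)) M
        have h3 := Nat.mod_lt (i + (k + 1)) hM
        rw [hq.1, mul_add] at h2
        have h5 : M ≤ M * q := Nat.le_mul_of_pos_right _ hq.2
        have : k + 1 ≤ 2 * q * M := by
          calc k + 1 ≤ M * q + M * q := by omega
            _ = 2 * q * M := by ring
        exact_mod_cast this
      have hq1 : (1 : ℝ) ≤ q := by exact_mod_cast hq.2
      have hn : (2 * q : ℝ) * ‖newtonQuotient f t i (k + 1) (t (i + (k + 1)))‖ ≤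
          2 * (η * ((2 * M) ^ k / k.factorial)) := by
        calc (2 * q : ℝ) * ‖newtonQuotient f t i (k + 1) (t (i + (k + 1)))‖
            = ‖(t (i + (k + 1)) - t i) * newtonQuotient f t i (k + 1) (t (i + (k + 1)))‖ := by
              rw [norm_mul, hdiff, Complex.norm_real, Real.norm_of_nonneg (by positivity)]
          _ ≤ _ := by
            rw [hrec]
            refine (norm_sub_le _ _).trans ?_
            linarith
      have hf1 : ((k + 1).factorial : ℝ) = (k + 1) * k.factorial := by
        rw [Nat.factorial_succ]; push_cast; ring
      rw [hf1, pow_succ]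
      have hfac : (0 : ℝ) < k.factorial := by positivity
      have hM' : (0 : ℝ) < M := by exact_mod_cast hM
      set A : ℝ := η * ((2 * M) ^ k / k.factorial) with hA
      have hA0 : 0 ≤ A := by positivity
      have hgoal : η * ((2 * (M : ℝ)) ^ k * (2 * M) / ((k + 1) * k.factorial)) =
          A * (2 * M) / (k + 1) := by
        rw [hA]; field_simp
      rw [hgoal, le_div_iff₀ (by positivity)]
      set X := ‖newtonQuotient f t i (k + 1) (t (i + (k + 1)))‖
      have hX : 0 ≤ X := norm_nonneg _
      calc X * (k + 1) ≤ X * (2 * q * M) := by gcongr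
        _ = (2 * q * X) * M := by ring
        _ ≤ (2 * A) * M := by gcongr
        _ = A * (2 * M) := by ring

/-- A Schwarz lemma for functions with approximate zeros at `1, 3, …, 2n - 1`. -/
lemma approximate_schwarz {f : ℂ → ℂ} (hf : Differentiable ℂ f) {M n : ℕ} (hM : 0 < M)
    (hn : 0 < n) {η : ℝ} (hη : 0 ≤ η)
    (hsmall : ∀ i < n, ∃ p, HasFPowerSeriesAt f p (2 * (i : ℂ) + 1) ∧ ∀ j < M, ‖p.coeff j‖ ≤ η)
    {E B : ℝ} (hE : 2 ≤ E) (hB : ∀ z : ℂ, ‖z‖ ≤ 2 * E * n → ‖f z‖ ≤ B)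
    {z : ℂ} (hz : ‖z‖ ≤ 2 * n) (hzn : ∀ i < n, ‖z - (2 * (i : ℂ) + 1)‖ ≤ 2 * n) :
    ‖f z‖ ≤ 2 * η * exp (4 * (M * n : ℕ) * (E + 1)) + B / (E - 1) ^ (M * n) := by
  set t : ℕ → ℂ := fun m => 2 * ((m / M : ℕ) : ℂ) + 1 with ht
  set N := M * n with hN
  have hn' : (1 : ℝ) ≤ n := by exact_mod_cast hn
  have htn : ∀ j < N, j / M < n := fun j hj => Nat.div_lt_of_lt_mul hj
  have htnorm : ∀ j < N, ‖t j‖ ≤ 2 * n := by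
    intro j hj
    have h1 : ((j / M : ℕ) : ℝ) + 1 ≤ n := by exact_mod_cast htn j hj
    calc ‖t j‖ ≤ ‖2 * ((j / M : ℕ) : ℂ)‖ + ‖(1 : ℂ)‖ := norm_add_le _ _
      _ = 2 * ((j / M : ℕ) : ℝ) + 1 := by simp
      _ ≤ _ := by linarith
  have hc : ∀ k < N, ‖newtonQuotient f t 0 k (t k)‖ ≤ η * ((2 * M) ^ k / k.factorial) := by
    intro k hk
    have := norm_newtonQuotient_le hf hM hη hsmall k 0 (by omega)
    simpa using this
  -- the interpolation polynomial
  have hpoly : ∀ (w : ℂ) (r : ℝ), 0 ≤ r → (∀ j < N, ‖w - t j‖ ≤ r) →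
      ‖∑ k ∈ Finset.range N, newtonQuotient f t 0 k (t k) * ∏ j ∈ Finset.range k, (w - t j)‖ ≤
        η * exp (2 * M * r) := by
    intro w r hr hw
    refine (norm_sum_le _ _).trans ?_
    have hM0 : (0 : ℝ) ≤ 2 * M * r := by positivity
    refine le_trans (Finset.sum_le_sum fun k hk => ?_)
      (show ∑ k ∈ Finset.range N, η * ((2 * M * r) ^ k / k.factorial) ≤ _ from ?_)
    · rw [Finset.mem_range] at hk
      rw [norm_mul, norm_prod]
      have h1 : ∏ j ∈ Finset.range k, ‖w - t j‖ ≤ r ^ k := by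
        calc _ ≤ ∏ _j ∈ Finset.range k, r :=
              Finset.prod_le_prod (fun _ _ => norm_nonneg _) fun j hj =>
                hw j (by rw [Finset.mem_range] at hj; omega)
          _ = _ := by simp
      calc _ ≤ (η * ((2 * M) ^ k / k.factorial)) * r ^ k := by
            gcongr; exact hc k hk
        _ = _ := by rw [mul_pow]; ring
    · rw [← Finset.mul_sum]
      gcongr
      exact Real.sum_le_exp_of_nonneg hM0 N
  set g := newtonQuotient f t 0 N with hg
  have hgd : Differentiable ℂ g := differentiable_newtonQuotient hf t 0 N
  have hE1 : 0 < E - 1 := by linarith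
  set G : ℝ := (B + η * exp (4 * N * (E + 1))) / (2 * n * (E - 1)) ^ N with hG
  have hgz : ‖g z‖ ≤ G := by
    have hR : (0 : ℝ) < 2 * E * n := by positivity
    refine Complex.norm_le_of_forall_mem_frontier_norm_le (U := Metric.ball 0 (2 * E * n))
      Metric.isBounded_ball hgd.diffContOnCl (fun w hw => ?_) (subset_closure ?_)
    · rw [frontier_ball _ hR.ne', mem_sphere_zero_iff_norm] at hw
      have h1 := newton_interpolation f t N w
      set H := ∑ k ∈ Finset.range N, newtonQuotient f t 0 k (t k) * ∏ j ∈ Finset.range k, (w - t j)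
      have hH : ‖H‖ ≤ η * exp (4 * N * (E + 1)) := by
        refine (hpoly w (2 * E * n + 2 * n) (by positivity) fun j hj => ?_).trans_eq ?_
        · exact (norm_sub_le _ _).trans (add_le_add hw.le (htnorm j hj))
        · congr 2; rw [hN]; push_cast; ring
      have hQ : (2 * n * (E - 1)) ^ N ≤ ‖∏ j ∈ Finset.range N, (w - t j)‖ := by
        rw [norm_prod]
        calc (2 * n * (E - 1)) ^ N = ∏ _j ∈ Finset.range N, (2 * n * (E - 1)) := by simp
          _ ≤ _ := Finset.prod_le_prod (fun _ _ => by positivity) fun j hj => by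
            have h2 := norm_sub_norm_le w (t j)
            have h3 := htnorm j (Finset.mem_range.1 hj)
            nlinarith
      rw [hG, le_div_iff₀ (by positivity)]
      calc ‖g w‖ * (2 * n * (E - 1)) ^ N ≤ ‖g w‖ * ‖∏ j ∈ Finset.range N, (w - t j)‖ := by gcongr
        _ = ‖f w - H‖ := by rw [← norm_mul, h1]; congr 1; ring
        _ ≤ ‖f w‖ + ‖H‖ := norm_sub_le _ _
        _ ≤ _ := add_le_add (hB w hw.le) hH
    · rw [mem_ball_zero_iff]
      calc ‖z‖ ≤ 2 * n := hz
        _ < _ := by nlinarith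
  have hB0 : 0 ≤ B := (norm_nonneg _).trans (hB 0 (by simp; positivity))
  rw [newton_interpolation f t N z]
  refine (norm_add_le _ _).trans ?_
  have h1 := hpoly z (2 * n) (by positivity) fun j hj => hzn _ (htn j hj)
  have h2 : ‖∏ j ∈ Finset.range N, (z - t j)‖ ≤ (2 * n) ^ N := by
    rw [norm_prod]
    calc _ ≤ ∏ _j ∈ Finset.range N, (2 * n : ℝ) :=
          Finset.prod_le_prod (fun _ _ => norm_nonneg _) fun j hj =>
            hzn _ (htn j (Finset.mem_range.1 hj))
      _ = _ := by simp
  have h3 : ‖(∏ j ∈ Finset.range N, (z - t j)) * g z‖ ≤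
      (B + η * exp (4 * N * (E + 1))) / (E - 1) ^ N := by
    rw [norm_mul]
    calc _ ≤ (2 * n : ℝ) ^ N * G := by gcongr
      _ = _ := by rw [hG, mul_pow (2 * (n : ℝ))]; field_simp
  have h4 : η * exp (2 * M * (2 * n)) + η * exp (4 * N * (E + 1)) / (E - 1) ^ N ≤
      2 * η * exp (4 * N * (E + 1)) := by
    have h5 : η * exp (2 * M * (2 * n)) ≤ η * exp (4 * N * (E + 1)) := by
      refine mul_le_mul_of_nonneg_left (exp_le_exp.2 ?_) hη
      rw [hN]; push_cast
      have : (0 : ℝ) ≤ M * n := by positivity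
      nlinarith
    have h6 : η * exp (4 * N * (E + 1)) / (E - 1) ^ N ≤ η * exp (4 * N * (E + 1)) :=
      div_le_self (by positivity) (one_le_pow₀ (by linarith))
    linarith
  calc _ ≤ η * exp (2 * M * (2 * n)) + (B + η * exp (4 * N * (E + 1))) / (E - 1) ^ N :=
        add_le_add h1 h3
    _ ≤ _ := by rw [add_div]; linarith

/-- Exponential sums with approximate zeros at odd integers. -/
lemma expSum_hasFPowerSeriesAt {ι : Type*} (I : Finset ι) (c ℓ : ι → ℂ) (s : ℂ) :
    ∃ p, HasFPowerSeriesAt (fun z => ∑ i ∈ I, c i * Complex.exp (ℓ i * z)) p s ∧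
      ∀ j, p.coeff j = (∑ i ∈ I, c i * ℓ i ^ j * Complex.exp (ℓ i * s)) / j.factorial := by
  refine ⟨FormalMultilinearSeries.ofScalars ℂ
    fun j => (∑ i ∈ I, c i * ℓ i ^ j * Complex.exp (ℓ i * s)) / j.factorial, ?_, fun j => ?_⟩
  · rw [hasFPowerSeriesAt_iff']
    refine Filter.Eventually.of_forall fun z => ?_
    have h : ∀ i ∈ I, HasSum (fun j : ℕ => (z - s) ^ j *
        (c i * ℓ i ^ j * Complex.exp (ℓ i * s) / j.factorial)) (c i * Complex.exp (ℓ i * z)) := by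
      intro i _
      have h1 : HasSum (fun j : ℕ => (ℓ i * (z - s)) ^ j / j.factorial)
          (Complex.exp (ℓ i * (z - s))) := by
        rw [Complex.exp_eq_exp_ℂ]
        exact NormedSpace.expSeries_div_hasSum_exp _
      have h2 := h1.mul_left (c i * Complex.exp (ℓ i * s))
      have h3 : c i * Complex.exp (ℓ i * z) =
          c i * Complex.exp (ℓ i * s) * Complex.exp (ℓ i * (z - s)) := by
        rw [mul_assoc, ← Complex.exp_add]; congr 2; ring
      rw [h3]
      refine (congrArg (HasSum · _) (funext fun j => ?_)).mpr h2
      rw [mul_pow]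
      ring
    have h4 := hasSum_sum h
    refine (congrArg (HasSum · _) (funext fun j => ?_)).mpr h4
    rw [FormalMultilinearSeries.coeff_ofScalars, smul_eq_mul, Finset.sum_div, Finset.mul_sum]
  · rw [FormalMultilinearSeries.coeff_ofScalars]

/-- Binomial coefficients with integral upper argument. -/
def intChoose (x : ℤ) (n : ℕ) : ℤ := Ring.choose x n

lemma intChoose_zero (x : ℤ) : intChoose x 0 = 1 := Ring.choose_zero_right x

lemma succ_mul_intChoose (x : ℤ) (n : ℕ) :
    ((n : ℤ) + 1) * intChoose x (n + 1) = intChoose x n * (x - n) := by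
  have h := Ring.choose_smul_choose x (n := n + 1) (k := n) (Nat.le_succ n)
  rw [Nat.add_sub_cancel_left, Ring.choose_one_right, Nat.choose_succ_self_right, nsmul_eq_mul] at h
  unfold intChoose
  exact_mod_cast h

lemma abs_intChoose_le (x : ℤ) (n : ℕ) {Y : ℝ} (hY : |(x : ℝ)| + n ≤ Y) :
    |(intChoose x n : ℝ)| ≤ Y ^ n / n.factorial := by
  induction n with
  | zero => simp [intChoose_zero]
  | succ n ih =>
    have hY' : |(x : ℝ)| + n ≤ Y := by push_cast at hY; linarith
    have h1 := succ_mul_intChoose x n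
    have h2 : ((n : ℝ) + 1) * (intChoose x (n + 1) : ℝ) = (intChoose x n : ℝ) * (x - n) := by
      exact_mod_cast h1
    have h3 : ((n : ℝ) + 1) * |(intChoose x (n + 1) : ℝ)| ≤ Y ^ n / n.factorial * Y := by
      calc ((n : ℝ) + 1) * |(intChoose x (n + 1) : ℝ)|
          = |((n : ℝ) + 1) * (intChoose x (n + 1) : ℝ)| := by
            rw [abs_mul, abs_of_nonneg (by positivity : (0 : ℝ) ≤ (n : ℝ) + 1)]
        _ = |(intChoose x n : ℝ)| * |(x : ℝ) - n| := by rw [h2, abs_mul]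
        _ ≤ _ := by
          have h4 : |(x : ℝ) - n| ≤ Y :=
            (abs_sub _ _).trans (by rwa [Nat.abs_cast])
          exact mul_le_mul (ih hY') h4 (abs_nonneg _) ((abs_nonneg _).trans (ih hY'))
    rw [Nat.factorial_succ, pow_succ]
    push_cast
    rw [le_div_iff₀ (by positivity)]
    have h5 : (0 : ℝ) < n.factorial := by positivity
    rw [div_mul_eq_mul_div, le_div_iff₀ h5] at h3
    linarith

/-- Vanishing against all products of binomial coefficients of bounded degree implies vanishing
against all polynomials of bounded degree. -/
lemma sum_intChoose_mul_pow_eq_zero {ι : Type*} {I : Finset ι} {u : ι → ℝ} {x y : ι → ℤ} {m : ℕ}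
    (h : ∀ τ τ' : ℕ, τ + τ' ≤ m →
      ∑ i ∈ I, u i * ((intChoose (x i) τ : ℝ) * (intChoose (y i) τ' : ℝ)) = 0)
    {ℓ : ι → ℝ} {A B c : ℝ} (hℓ : ∀ i, ℓ i = A * x i + B * y i + c) (j : ℕ) :
    ∀ τ τ' : ℕ, τ + τ' + j ≤ m →
      ∑ i ∈ I, u i * ((intChoose (x i) τ : ℝ) * (intChoose (y i) τ' : ℝ)) * ℓ i ^ j = 0 := by
  induction j with
  | zero => intro τ τ' hτ; simpa using h τ τ' hτ
  | succ j ih =>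
    intro τ τ' hτ
    have h1 := ih (τ + 1) τ' (by omega)
    have h2 := ih τ (τ' + 1) (by omega)
    have h3 := ih τ τ' (by omega)
    have hx : ∀ i, (x i : ℝ) * intChoose (x i) τ =
        (τ + 1) * intChoose (x i) (τ + 1) + τ * intChoose (x i) τ := by
      intro i
      have := succ_mul_intChoose (x i) τ
      have h2 : ((τ : ℝ) + 1) * (intChoose (x i) (τ + 1) : ℝ) =
        (intChoose (x i) τ : ℝ) * (x i - τ) := by exact_mod_cast this
      rw [h2]; ring
    have hy : ∀ i, (y i : ℝ) * intChoose (y i) τ' =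
        (τ' + 1) * intChoose (y i) (τ' + 1) + τ' * intChoose (y i) τ' := by
      intro i
      have := succ_mul_intChoose (y i) τ'
      have h2 : ((τ' : ℝ) + 1) * (intChoose (y i) (τ' + 1) : ℝ) =
        (intChoose (y i) τ' : ℝ) * (y i - τ') := by exact_mod_cast this
      rw [h2]; ring
    have key : ∑ i ∈ I, u i * ((intChoose (x i) τ : ℝ) * (intChoose (y i) τ' : ℝ)) *
        ℓ i ^ (j + 1) =
        A * (τ + 1) * ∑ i ∈ I, u i * ((intChoose (x i) (τ + 1) : ℝ) *
          (intChoose (y i) τ' : ℝ)) * ℓ i ^ j +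
        B * (τ' + 1) * ∑ i ∈ I, u i * ((intChoose (x i) τ : ℝ) *
          (intChoose (y i) (τ' + 1) : ℝ)) * ℓ i ^ j +
        (A * τ + B * τ' + c) * ∑ i ∈ I, u i * ((intChoose (x i) τ : ℝ) *
          (intChoose (y i) τ' : ℝ)) * ℓ i ^ j := by
      simp only [Finset.mul_sum, ← Finset.sum_add_distrib]
      refine Finset.sum_congr rfl fun i _ => ?_
      rw [pow_succ]
      linear_combination u i * intChoose (x i) τ * intChoose (y i) τ' * ℓ i ^ j * hℓ i
        + A * u i * intChoose (y i) τ' * ℓ i ^ j * hx i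
        + B * u i * intChoose (x i) τ * ℓ i ^ j * hy i
    rw [key, h1, h2, h3]; simp

lemma IntermediateField.coe_zpow_real {K : IntermediateField ℚ ℝ} (x : K) (n : ℤ) :
    ((x ^ n : K) : ℝ) = (x : ℝ) ^ n := map_zpow₀ (algebraMap K ℝ) x n

/-- Three positive elements of a real number field, with bounds for their conjugates and
denominators. -/
structure PositiveTriple (K : IntermediateField ℚ ℝ) where
  /-- the elements -/
  α : Fin 3 → K
  pos : ∀ i, 0 < (α i : ℝ)
  /-- bounds for the logarithmic sizes -/
  h : Fin 3 → ℝ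
  one_le_h : ∀ i, 1 ≤ h i
  conj_le : ∀ (φ : K →+* ℂ) i, ‖φ (α i)‖ ≤ exp (h i)
  conj_inv_le : ∀ (φ : K →+* ℂ) i, ‖φ (α i)⁻¹‖ ≤ exp (h i)
  /-- denominators -/
  D : Fin 3 → ℕ
  D_pos : ∀ i, 0 < D i
  D_le : ∀ i, (D i : ℝ) ≤ exp (h i)
  isIntegral : ∀ (φ : K →+* ℂ) i, IsIntegral ℤ ((D i : ℂ) * φ (α i))
  isIntegral_inv : ∀ (φ : K →+* ℂ) i, IsIntegral ℤ ((D i : ℂ) * φ (α i)⁻¹)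

namespace PositiveTriple

variable {K : IntermediateField ℚ ℝ} (S : PositiveTriple K)

/-- The monomial with exponent vector `n`. -/
noncomputable def mon (n : Fin 3 → ℤ) : K := ∏ i, S.α i ^ n i

lemma coe_mon (n : Fin 3 → ℤ) : (S.mon n : ℝ) = ∏ i, (S.α i : ℝ) ^ n i := by
  simp [mon, IntermediateField.coe_zpow_real]

lemma mon_pos (n : Fin 3 → ℤ) : 0 < (S.mon n : ℝ) := by
  rw [coe_mon]
  exact Finset.prod_pos fun i _ => zpow_pos (S.pos i) _

lemma α_ne_zero (i : Fin 3) : S.α i ≠ 0 := by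
  intro h; have := S.pos i; rw [h] at this; simp at this

lemma mon_ne_zero (n : Fin 3 → ℤ) : S.mon n ≠ 0 :=
  Finset.prod_ne_zero_iff.2 fun i _ => zpow_ne_zero _ (S.α_ne_zero i)

lemma mon_zero : S.mon 0 = 1 := by simp [mon]

lemma mon_add (n m : Fin 3 → ℤ) : S.mon (n + m) = S.mon n * S.mon m := by
  simp only [mon, ← Finset.prod_mul_distrib, Pi.add_apply]
  exact Finset.prod_congr rfl fun i _ => zpow_add₀ (S.α_ne_zero i) _ _

lemma mon_sub (n m : Fin 3 → ℤ) : S.mon (n - m) = S.mon n / S.mon m := by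
  rw [eq_div_iff (S.mon_ne_zero m), ← mon_add, sub_add_cancel]

lemma mon_zsmul (c : ℤ) (n : Fin 3 → ℤ) : S.mon (c • n) = S.mon n ^ c := by
  simp only [mon, Pi.smul_apply, smul_eq_mul, ← Finset.prod_zpow]
  exact Finset.prod_congr rfl fun i _ => by rw [mul_comm, zpow_mul]

lemma mon_sum {ι : Type*} (s : Finset ι) (n : ι → Fin 3 → ℤ) :
    S.mon (∑ j ∈ s, n j) = ∏ j ∈ s, S.mon (n j) := by
  classical
  induction s using Finset.induction_on with
  | empty => simp [mon_zero]
  | insert a s ha ih => rw [Finset.sum_insert ha, Finset.prod_insert ha, mon_add, ih]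

lemma log_mon (n : Fin 3 → ℤ) : Real.log (S.mon n : ℝ) = ∑ i, n i * Real.log (S.α i : ℝ) := by
  rw [coe_mon, Real.log_prod fun i _ => (zpow_pos (S.pos i) _).ne']
  exact Finset.sum_congr rfl fun i _ => Real.log_zpow _ _

lemma norm_conj_zpow_le (φ : K →+* ℂ) (i : Fin 3) {n : ℤ} {L : ℕ} (hn : |n| ≤ L) :
    ‖φ (S.α i ^ n)‖ ≤ exp (L * S.h i) := by
  have h0 : 0 ≤ S.h i := zero_le_one.trans (S.one_le_h i)
  have key : ∀ m : ℕ, m ≤ L → exp (S.h i) ^ m ≤ exp (L * S.h i) := by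
    intro m hm
    rw [← Real.exp_nat_mul]
    gcongr
  rcases Int.eq_nat_or_neg n with ⟨m, rfl | rfl⟩
  · have hm : m ≤ L := by simpa using hn
    rw [zpow_natCast, map_pow, norm_pow]
    exact (pow_le_pow_left₀ (norm_nonneg _) (S.conj_le φ i) m).trans (key m hm)
  · have hm : m ≤ L := by simpa using hn
    rw [zpow_neg, zpow_natCast, ← inv_pow, map_pow, norm_pow]
    exact (pow_le_pow_left₀ (norm_nonneg _) (S.conj_inv_le φ i) m).trans (key m hm)

lemma norm_conj_mon_le (φ : K →+* ℂ) {n : Fin 3 → ℤ} {L : Fin 3 → ℕ} (hn : ∀ i, |n i| ≤ L i) :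
    ‖φ (S.mon n)‖ ≤ exp (∑ i, L i * S.h i) := by
  rw [mon, map_prod, norm_prod, Real.exp_sum]
  exact Finset.prod_le_prod (fun _ _ => norm_nonneg _) fun i _ => S.norm_conj_zpow_le φ i (hn i)

/-- A common denominator of all monomials with exponents bounded by `L`. -/
def den (L : Fin 3 → ℕ) : ℕ := ∏ i, S.D i ^ L i

lemma one_le_den (L : Fin 3 → ℕ) : 1 ≤ S.den L :=
  Nat.one_le_iff_ne_zero.2 (Finset.prod_ne_zero_iff.2 fun i _ => pow_ne_zero _ (S.D_pos i).ne')

lemma den_le (L : Fin 3 → ℕ) : (S.den L : ℝ) ≤ exp (∑ i, L i * S.h i) := by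
  rw [den, Real.exp_sum]
  push_cast
  refine Finset.prod_le_prod (fun _ _ => by positivity) fun i _ => ?_
  rw [Real.exp_nat_mul]
  exact pow_le_pow_left₀ (by positivity) (S.D_le i) _

lemma isIntegral_zpow (φ : K →+* ℂ) (i : Fin 3) {n : ℤ} {L : ℕ} (hn : |n| ≤ L) :
    IsIntegral ℤ ((S.D i : ℂ) ^ L * φ (S.α i ^ n)) := by
  have key : ∀ (m : ℕ) (y : ℂ), m ≤ L → IsIntegral ℤ ((S.D i : ℂ) * y) →
      IsIntegral ℤ ((S.D i : ℂ) ^ L * y ^ m) := by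
    intro m y hm hy
    obtain ⟨l, rfl⟩ := Nat.exists_eq_add_of_le hm
    have h1 : (S.D i : ℂ) ^ (m + l) * y ^ m = ((S.D i : ℂ) * y) ^ m * (S.D i : ℂ) ^ l := by ring
    rw [h1]
    refine (hy.pow m).mul (IsIntegral.pow ?_ l)
    exact_mod_cast isIntegral_algebraMap (R := ℤ) (A := ℂ) (x := (S.D i : ℤ))
  rcases Int.eq_nat_or_neg n with ⟨m, rfl | rfl⟩
  · rw [zpow_natCast, map_pow]
    exact key m _ (by simpa using hn) (S.isIntegral φ i)
  · rw [zpow_neg, zpow_natCast, ← inv_pow, map_pow]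
    exact key m _ (by simpa using hn) (S.isIntegral_inv φ i)

lemma isIntegral_mon (φ : K →+* ℂ) {n : Fin 3 → ℤ} {L : Fin 3 → ℕ} (hn : ∀ i, |n i| ≤ L i) :
    IsIntegral ℤ ((S.den L : ℂ) * φ (S.mon n)) := by
  have : (S.den L : ℂ) * φ (S.mon n) = ∏ i, ((S.D i : ℂ) ^ L i * φ (S.α i ^ n i)) := by
    rw [mon, map_prod, Finset.prod_mul_distrib, den]; push_cast; rfl
  rw [this]
  exact IsIntegral.prod _ fun i _ => S.isIntegral_zpow φ i (hn i)

/-- Square roots of all `2 ^ k`-th roots of monomials lie in one extension of degree at most `8`. -/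
lemma exists_field_sqrt (k : ℕ) : ∃ F : IntermediateField K ℝ, FiniteDimensional K F ∧
    Module.finrank K F ≤ 8 ∧ ∀ (ρ : K) (n : Fin 3 → ℤ), 0 < (ρ : ℝ) → ρ ^ 2 ^ k = S.mon n →
      √(ρ : ℝ) ∈ F := by
  let Γ : Submodule ℤ (Fin 3 → ℤ) := AddSubgroup.toIntSubmodule
    { carrier := {n | ∃ ρ : K, 0 < (ρ : ℝ) ∧ ρ ^ 2 ^ k = S.mon n}
      zero_mem' := ⟨1, by simp, by simp [mon_zero]⟩
      add_mem' := by
        rintro n m ⟨ρ, hρ, hρn⟩ ⟨σ, hσ, hσm⟩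
        exact ⟨ρ * σ, by simpa using mul_pos hρ hσ, by rw [mul_pow, hρn, hσm, mon_add]⟩
      neg_mem' := by
        rintro n ⟨ρ, hρ, hρn⟩
        refine ⟨ρ⁻¹, by simpa using hρ, ?_⟩
        rw [inv_pow, hρn, ← zero_sub n, mon_sub, mon_zero, one_div] }
  have hΓ : ∀ n, n ∈ Γ ↔ ∃ ρ : K, 0 < (ρ : ℝ) ∧ ρ ^ 2 ^ k = S.mon n := fun n => Iff.rfl
  obtain ⟨m, snf⟩ := Submodule.smithNormalForm (Pi.basisFun ℤ (Fin 3)) Γ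
  have hm : m ≤ 3 := by simpa using Fintype.card_le_of_embedding snf.f
  choose r hr hrn using fun j => (hΓ _).1 (snf.bN j).2
  have hfield : ∀ (m : ℕ) (r : Fin m → K), (∀ j, 0 < (r j : ℝ)) →
      ∃ F : IntermediateField K ℝ, FiniteDimensional K F ∧
        Module.finrank K F ≤ 2 ^ m ∧ ∀ j, √(r j : ℝ) ∈ F := by
    intro m
    induction m with
    | zero => intro r _; exact ⟨⊥, inferInstance, by simp, fun j => j.elim0⟩
    | succ m ih =>
      intro r hr
      obtain ⟨F, hF, hFd, hFr⟩ := ih (fun j => r j.succ) fun j => hr _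
      have hroot : (Polynomial.X ^ 2 - Polynomial.C (r 0)).aeval (√(r 0 : ℝ)) = 0 := by
        simp [Real.sq_sqrt (hr 0).le, IntermediateField.algebraMap_apply]
      have hmonic : (Polynomial.X ^ 2 - Polynomial.C (r 0) : Polynomial K).Monic :=
        Polynomial.monic_X_pow_sub_C _ two_ne_zero
      have hint : IsIntegral K (√(r 0 : ℝ)) := ⟨_, hmonic, hroot⟩
      have := IntermediateField.adjoin.finiteDimensional hint
      have h2 : Module.finrank K (IntermediateField.adjoin K {√(r 0 : ℝ)}) ≤ 2 := by
        rw [IntermediateField.adjoin.finrank hint,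
          ← Polynomial.natDegree_X_pow_sub_C (n := 2) (r := r 0)]
        exact Polynomial.natDegree_le_of_dvd (minpoly.dvd _ _ hroot) hmonic.ne_zero
      refine ⟨IntermediateField.adjoin K {√(r 0 : ℝ)} ⊔ F, inferInstance, ?_, fun j => ?_⟩
      · refine (IntermediateField.finrank_sup_le _ _).trans ?_
        rw [pow_succ']
        exact Nat.mul_le_mul h2 hFd
      · refine Fin.cases ?_ (fun j => ?_) j
        · exact (le_sup_left : _ ≤ IntermediateField.adjoin K {√(r 0 : ℝ)} ⊔ F)
            (IntermediateField.mem_adjoin_simple_self K _)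
        · exact (le_sup_right : _ ≤ IntermediateField.adjoin K {√(r 0 : ℝ)} ⊔ F) (hFr j)
  obtain ⟨F, hF, hFd, hFr⟩ := hfield m r hr
  refine ⟨F, hF, hFd.trans ?_, fun ρ n hρ hρn => ?_⟩
  · calc 2 ^ m ≤ 2 ^ 3 := Nat.pow_le_pow_right two_pos hm
      _ = 8 := by norm_num
  · have hn : n ∈ Γ := (hΓ n).2 ⟨ρ, hρ, hρn⟩
    set c := snf.bN.repr ⟨n, hn⟩ with hc
    have hsum : n = ∑ j, c j • (snf.bN j : Fin 3 → ℤ) := by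
      have := congrArg (Subtype.val) (snf.bN.sum_repr ⟨n, hn⟩)
      rw [← hc] at this
      simpa using this.symm
    have hsqrt : √(ρ : ℝ) = ∏ j, √(r j : ℝ) ^ c j := by
      have hp : 0 < ∏ j, √(r j : ℝ) ^ c j :=
        Finset.prod_pos fun j _ => zpow_pos (Real.sqrt_pos.2 (hr j)) _
      rw [Real.sqrt_eq_iff_eq_sq hρ.le hp.le]
      have h1 : (ρ : ℝ) ^ 2 ^ k = ((∏ j, √(r j : ℝ) ^ c j) ^ 2) ^ 2 ^ k := by
        have h2 : (ρ : ℝ) ^ 2 ^ k = ((∏ j, r j ^ c j : K) : ℝ) ^ 2 ^ k := by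
          have h3 : ρ ^ 2 ^ k = (∏ j, r j ^ c j) ^ 2 ^ k := by
            rw [hρn, hsum, mon_sum, ← Finset.prod_pow]
            refine Finset.prod_congr rfl fun j _ => ?_
            rw [mon_zsmul, ← hrn, ← zpow_natCast, ← zpow_natCast, ← zpow_mul, ← zpow_mul, mul_comm]
          exact_mod_cast congrArg (fun x : K => (x : ℝ)) h3
        rw [h2]
        congr 1
        push_cast
        rw [← Finset.prod_pow]
        refine Finset.prod_congr rfl fun j _ => ?_
        rw [IntermediateField.coe_zpow_real, ← zpow_natCast, ← zpow_mul, mul_comm, zpow_mul,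
          zpow_natCast, Real.sq_sqrt (hr j).le]
      exact (pow_left_inj₀ hρ.le (by positivity) (by positivity)).1 h1
    rw [hsqrt]
    exact prod_mem fun j _ => zpow_mem (hFr j) _

end PositiveTriple

lemma finrank_rat_mul_finrank (K : IntermediateField ℚ ℝ) (F : IntermediateField K ℝ) :
    Module.finrank ℚ K * Module.finrank K F = Module.finrank ℚ F :=
  Module.finrank_mul_finrank _ _ _

namespace PositiveTriple

variable {K : IntermediateField ℚ ℝ} (S : PositiveTriple K)

lemma norm_root_le {F : Type*} [Field F] [Algebra K F] {θ : F} {n : Fin 3 → ℤ} {m : ℕ}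
    (hm : 0 < m) (hθ : θ ^ m = algebraMap K F (S.mon n)) {L : Fin 3 → ℕ} (hn : ∀ j, |n j| ≤ L j)
    {c : ℝ} (hc : ∑ j, L j * S.h j ≤ c * m) (φ : F →+* ℂ) : ‖φ θ‖ ≤ exp c := by
  refine le_of_pow_le_pow_left₀ hm.ne' (exp_pos c).le ?_
  rw [← norm_pow, ← map_pow, hθ, ← Real.exp_nat_mul]
  refine (S.norm_conj_mon_le (φ.comp (algebraMap K F)) hn).trans (exp_le_exp.2 ?_)
  rwa [mul_comm]

lemma exists_root_den (L : Fin 3 → ℕ) {m : ℕ} (hm : 0 < m) {c : ℝ}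
    (hc : ∑ j, L j * S.h j ≤ c * m) :
    ∃ Δ : ℝ, 1 ≤ Δ ∧ Δ ≤ exp c ∧ Δ ^ m = S.den L ∧
      ∀ (F : Type) [Field F] [Algebra K F] (θ : F) (n : Fin 3 → ℤ),
        θ ^ m = algebraMap K F (S.mon n) → (∀ j, |n j| ≤ L j) →
        ∀ φ : F →+* ℂ, IsIntegral ℤ ((Δ : ℂ) * φ θ) := by
  have h1 : (1 : ℝ) ≤ S.den L := by exact_mod_cast S.one_le_den L
  have hpow : ((S.den L : ℝ) ^ (1 / m : ℝ)) ^ m = S.den L := by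
    rw [← Real.rpow_natCast, ← Real.rpow_mul (by positivity), one_div,
      inv_mul_cancel₀ (by positivity), Real.rpow_one]
  refine ⟨(S.den L : ℝ) ^ (1 / m : ℝ), Real.one_le_rpow h1 (by positivity), ?_, hpow, ?_⟩
  · refine le_of_pow_le_pow_left₀ hm.ne' (exp_pos c).le ?_
    rw [hpow, ← Real.exp_nat_mul]
    refine (S.den_le L).trans (exp_le_exp.2 ?_)
    rwa [mul_comm]
  · intro F _ _ θ n hθ hn φ
    refine IsIntegral.of_pow hm ?_
    rw [mul_pow, ← map_pow, hθ]
    have h2 : (((S.den L : ℝ) ^ (1 / m : ℝ) : ℝ) : ℂ) ^ m = (S.den L : ℂ) := by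
      exact_mod_cast congrArg (fun r : ℝ => (r : ℂ)) hpow
    rw [h2]
    exact S.isIntegral_mon (φ.comp (algebraMap K F)) hn

lemma sum_root_pow_eq_zero_of_small [FiniteDimensional ℚ K] (hK : Module.finrank ℚ K ≤ 4)
    (F : IntermediateField K ℝ) [FiniteDimensional K F] (hF : Module.finrank K F ≤ 8)
    {ι : Type*} (I : Finset ι) (c : ι → ℤ) (θ : ι → F) (n : ι → Fin 3 → ℤ) {m : ℕ} (hm : 0 < m)
    (hθ : ∀ i ∈ I, θ i ^ m = algebraMap K F (S.mon (n i))) {L : Fin 3 → ℕ}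
    (hn : ∀ i ∈ I, ∀ j, |n i j| ≤ L j) {H₀ : ℝ} (hH₀ : ∑ j, L j * S.h j ≤ H₀) {s : ℕ} {r : ℝ}
    (hs : (s : ℝ) ≤ r * m) {A : ℝ} (hA : 1 ≤ A) (hcA : ∑ i ∈ I, |(c i : ℝ)| ≤ A)
    (hsmall : |∑ i ∈ I, (c i : ℝ) * (θ i : ℝ) ^ s| < ((A * exp (2 * r * H₀)) ^ 32)⁻¹) :
    ∑ i ∈ I, (c i : ℝ) * (θ i : ℝ) ^ s = 0 := by
  have : FiniteDimensional ℚ F := FiniteDimensional.trans ℚ K F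
  have : NumberField F := ⟨⟩
  by_contra hne
  have hH0 : 0 ≤ H₀ := le_trans (Finset.sum_nonneg fun j _ =>
    mul_nonneg (by positivity) (zero_le_one.trans (S.one_le_h j))) hH₀
  have hm' : (0 : ℝ) < m := by exact_mod_cast hm
  have hr : 0 ≤ r := by
    by_contra hr
    have : r * m < 0 := mul_neg_of_neg_of_pos (not_le.1 hr) hm'
    have h2 : (0 : ℝ) ≤ s := by positivity
    linarith
  have hc : ∑ j, L j * S.h j ≤ (H₀ / m) * m := by rwa [div_mul_cancel₀ _ hm'.ne']
  have hexp : exp (H₀ / m) ^ s ≤ exp (r * H₀) := by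
    rw [← Real.exp_nat_mul]
    refine exp_le_exp.2 ?_
    rw [← mul_div_assoc, div_le_iff₀ hm']
    nlinarith
  obtain ⟨Δ, hΔ1, hΔc, hΔm, hΔint⟩ := S.exists_root_den L hm hc
  set v : F := ∑ i ∈ I, (c i : F) * θ i ^ s with hv
  let ψ : F →+* ℂ := Complex.ofRealHom.comp (algebraMap F ℝ)
  have hψ : ∀ x : F, ψ x = ((x : ℝ) : ℂ) := fun x => rfl
  have hvR : (v : ℝ) = ∑ i ∈ I, (c i : ℝ) * (θ i : ℝ) ^ s := by
    rw [hv]; push_cast; rfl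
  have hv0 : v ≠ 0 := by
    intro h; apply hne; rw [← hvR, h]; rfl
  have hΔs : (Δ ^ s) ^ m = ((S.den L ^ s : ℕ) : ℝ) := by
    rw [← pow_mul, mul_comm, pow_mul, hΔm]; push_cast; rfl
  have hd : Module.finrank ℚ F ≤ 32 := by
    rw [← finrank_rat_mul_finrank]
    exact (Nat.mul_le_mul hK hF)
  have hL := liouville_lower_bound hv0 (one_le_pow₀ hΔ1 : 1 ≤ Δ ^ s) hm.ne' hΔs (fun φ => ?_)
    (H := A * exp (r * H₀)) (one_le_mul_of_one_le_of_one_le hA (Real.one_le_exp (by positivity)))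
    (fun φ => ?_) hd ψ
  · rw [hψ, hvR, Complex.norm_real, Real.norm_eq_abs] at hL
    refine absurd hsmall (not_lt.2 (le_trans ?_ hL))
    refine inv_anti₀ (by positivity) (pow_le_pow_left₀ (by positivity) ?_ 32)
    calc Δ ^ s * (A * exp (r * H₀)) ≤ exp (r * H₀) * (A * exp (r * H₀)) := by
          gcongr
          exact (pow_le_pow_left₀ (by linarith) hΔc s).trans hexp
      _ = A * exp (2 * r * H₀) := by
        rw [show 2 * r * H₀ = r * H₀ + r * H₀ by ring, Real.exp_add]; ring
  · rw [hv, map_sum, Finset.mul_sum]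
    refine IsIntegral.sum _ fun i hi => ?_
    have h2 : ((Δ ^ s : ℝ) : ℂ) * φ ((c i : F) * θ i ^ s) =
        (c i : ℂ) * ((Δ : ℂ) * φ (θ i)) ^ s := by
      rw [map_mul, map_pow, map_intCast]; push_cast; ring
    rw [h2]
    refine IsIntegral.mul ?_ ((hΔint F (θ i) (n i) (hθ i hi) (hn i hi) φ).pow s)
    exact isIntegral_algebraMap (R := ℤ) (A := ℂ) (x := c i)
  · rw [hv, map_sum]
    refine (norm_sum_le _ _).trans ?_
    calc ∑ i ∈ I, ‖φ ((c i : F) * θ i ^ s)‖ ≤ ∑ i ∈ I, |(c i : ℝ)| * exp (r * H₀) := by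
          refine Finset.sum_le_sum fun i hi => ?_
          rw [map_mul, map_pow, map_intCast, norm_mul, norm_pow, Complex.norm_intCast]
          gcongr
          exact (pow_le_pow_left₀ (norm_nonneg _)
            (S.norm_root_le hm (hθ i hi) (hn i hi) hc φ) s).trans hexp
      _ ≤ _ := by rw [← Finset.sum_mul]; gcongr

/-- Roots of large order of monomials with small exponents are trivial. -/
lemma root_eq_one [FiniteDimensional ℚ K] (hreal : ∀ (φ : K →+* ℂ) (x : K), (φ x).im = 0)
    {ρ : K} (hρ : 0 < (ρ : ℝ)) {n : Fin 3 → ℤ} {m : ℕ} (hm : 0 < m) (hρn : ρ ^ m = S.mon n)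
    {L : Fin 3 → ℕ} (hn : ∀ j, |n j| ≤ L j) {c : ℝ} (hc : ∑ j, L j * S.h j ≤ c * m)
    (hc' : c ≤ 1 / 100) : ρ = 1 := by
  have : NumberField K := ⟨⟩
  have hc0 : 0 ≤ c := by
    by_contra h
    have h1 : c * m < 0 := mul_neg_of_neg_of_pos (not_le.1 h) (by exact_mod_cast hm)
    have h2 : 0 ≤ ∑ j, L j * S.h j := Finset.sum_nonneg fun j _ =>
      mul_nonneg (by positivity) (zero_le_one.trans (S.one_le_h j))
    linarith
  by_contra hne
  have hv : ρ ^ 2 - 1 ≠ 0 := by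
    intro h
    have h1 : (ρ - 1) * (ρ + 1) = 0 := by linear_combination h
    rcases mul_eq_zero.1 h1 with h2 | h2
    · exact hne (sub_eq_zero.1 h2)
    · have h3 : (ρ : ℝ) + 1 = 0 := by exact_mod_cast congrArg (fun x : K => (x : ℝ)) h2
      linarith
  obtain ⟨Δ, hΔ1, hΔc, hΔm, hΔint⟩ := S.exists_root_den L hm hc
  have hΔs : (Δ ^ 2) ^ m = ((S.den L ^ 2 : ℕ) : ℝ) := by
    rw [← pow_mul, mul_comm, pow_mul, hΔm]; push_cast; rfl
  have hint : ∀ φ : K →+* ℂ, IsIntegral ℤ (((Δ ^ 2 : ℝ) : ℂ) * φ (ρ ^ 2 - 1)) := by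
    intro φ
    have h1 := hΔint K ρ n hρn hn φ
    have h2 := hΔint K 1 0 (by simp [mon_zero]) (by simp) φ
    rw [map_one, mul_one] at h2
    have h3 : ((Δ ^ 2 : ℝ) : ℂ) * φ (ρ ^ 2 - 1) = ((Δ : ℂ) * φ ρ) ^ 2 - (Δ : ℂ) ^ 2 := by
      simp only [map_sub, map_pow, map_one]; push_cast; ring
    rw [h3]
    exact (h1.pow 2).sub (h2.pow 2)
  have hprod := one_le_prod_embeddings hv (by positivity : (0 : ℝ) < Δ ^ 2) hm.ne' hΔs hint
  have hexp : exp c ^ 2 ≤ 50 / 49 := by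
    rw [← Real.exp_nat_mul]
    have h1 := Real.add_one_le_exp (-((2 : ℕ) * c))
    rw [Real.exp_neg] at h1
    have h2 : (49 / 50 : ℝ) ≤ (exp ((2 : ℕ) * c))⁻¹ := by
      refine le_trans ?_ h1; push_cast; linarith
    rw [le_inv_comm₀ (by norm_num) (exp_pos _)] at h2
    exact h2.trans_eq (by norm_num)
  have hbound : ∀ φ : K →+* ℂ, Δ ^ 2 * ‖φ (ρ ^ 2 - 1)‖ ≤ 1 / 2 := by
    intro φ
    have h1 := S.norm_root_le (F := K) hm hρn hn hc φ
    have h2 := S.norm_root_le (F := K) (θ := ρ⁻¹) (n := -n) hm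
      (by rw [inv_pow, hρn, ← zero_sub n, mon_sub, mon_zero, one_div]; rfl)
      (L := L) (by simpa using hn) hc φ
    rw [map_inv₀, norm_inv] at h2
    set y := (φ ρ).re with hy
    have hφ : φ ρ = (y : ℂ) := Complex.ext rfl (by simpa using hreal φ ρ)
    rw [hφ, Complex.norm_real, Real.norm_eq_abs] at h1 h2
    have hy0 : 0 < |y| := by
      rw [abs_pos]; rintro h0
      rw [h0, Complex.ofReal_zero, map_eq_zero] at hφ
      rw [hφ] at hρ; simp at hρ
    have h3 : y ^ 2 ≤ 50 / 49 := by
      rw [← sq_abs]; exact (pow_le_pow_left₀ hy0.le h1 2).trans hexp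
    have h4 : 49 / 50 ≤ y ^ 2 := by
      have h5 : (|y|⁻¹) ^ 2 ≤ 50 / 49 := (pow_le_pow_left₀ (by positivity) h2 2).trans hexp
      rw [inv_pow, sq_abs, inv_le_comm₀ (by rw [← sq_abs]; positivity) (by norm_num)] at h5
      linarith
    have h5 : φ (ρ ^ 2 - 1) = ((y ^ 2 - 1 : ℝ) : ℂ) := by
      simp only [map_sub, map_pow, map_one, hφ]; push_cast; rfl
    rw [h5, Complex.norm_real, Real.norm_eq_abs]
    have h6 : |y ^ 2 - 1| ≤ 1 / 49 := by rw [abs_le]; constructor <;> linarith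
    have h7 : Δ ^ 2 ≤ 50 / 49 := (pow_le_pow_left₀ (by linarith) hΔc 2).trans hexp
    calc Δ ^ 2 * |y ^ 2 - 1| ≤ 50 / 49 * (1 / 49) := by gcongr
      _ ≤ 1 / 2 := by norm_num
  have hcard : Fintype.card (K →+* ℂ) ≠ 0 := by
    rw [NumberField.Embeddings.card]; exact Module.finrank_pos.ne'
  have h1 : ∏ φ : K →+* ℂ, (Δ ^ 2 * ‖φ (ρ ^ 2 - 1)‖) ≤ (1 / 2) ^ Fintype.card (K →+* ℂ) := by
    calc _ ≤ ∏ _φ : K →+* ℂ, (1 / 2 : ℝ) :=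
          Finset.prod_le_prod (fun _ _ => by positivity) fun φ _ => hbound φ
      _ = _ := by simp
  have h2 : (1 / 2 : ℝ) ^ Fintype.card (K →+* ℂ) < 1 :=
    pow_lt_one₀ (by norm_num) (by norm_num) hcard
  linarith

end PositiveTriple

lemma abs_exp_sub_exp_le {a b ε : ℝ} (h : |a - b| ≤ ε) (hε : ε ≤ 1) :
    |exp a - exp b| ≤ exp b * (2 * ε) := by
  have h1 : exp a - exp b = exp b * (exp (a - b) - 1) := by
    rw [mul_sub, ← Real.exp_add]; ring_nf
  rw [h1, abs_mul, abs_of_pos (Real.exp_pos b)]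
  have := Real.abs_exp_sub_one_le (h.trans hε)
  gcongr
  linarith

/-- Extrapolation: if the sums `∑ p b_{τ,τ'} exp (g s)` vanish at the odd integers `s < 2 n` for all
`τ + τ' ≤ 2 M`, and `g` is close to an affine function of the integers `x`, `y`, then they are small
at half-integers below `2 n` for all `τ + τ' ≤ M`. -/
lemma expSum_half_odd_small {ι : Type*} {I : Finset ι} {p g : ι → ℝ} {x y : ι → ℤ} {A B c : ℝ}
    {M n : ℕ} (hM : 0 < M) (hn : 0 < n) {δ G W E : ℝ} (hE : 2 ≤ E) (hG : 0 ≤ G) (hδ0 : 0 ≤ δ)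
    (hδn : 2 * n * δ ≤ 1)
    (hg : ∀ i ∈ I, |g i| ≤ G) (hℓ : ∀ i ∈ I, |A * x i + B * y i + c| ≤ G)
    (hgℓ : ∀ i ∈ I, |A * x i + B * y i + c - g i| ≤ δ)
    (hW : ∀ τ τ', τ + τ' ≤ 2 * M →
      ∑ i ∈ I, |p i * ((intChoose (x i) τ : ℝ) * (intChoose (y i) τ' : ℝ))| ≤ W)
    (hvan : ∀ τ τ', τ + τ' ≤ 2 * M → ∀ i < n,
      ∑ l ∈ I, p l * exp (g l * (2 * i + 1)) *
        ((intChoose (x l) τ : ℝ) * (intChoose (y l) τ' : ℝ)) = 0)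
    {τ τ' : ℕ} (hτ : τ + τ' ≤ M) {j : ℕ} (hj : j < 2 * n) :
    |∑ l ∈ I, p l * exp (g l * ((2 * j + 1) / 2)) *
        ((intChoose (x l) τ : ℝ) * (intChoose (y l) τ' : ℝ))| ≤
      3 * (W * exp G * exp (2 * n * G) * (4 * n * δ)) * exp (4 * (M * n : ℕ) * (E + 1)) +
        W * exp (2 * E * n * G) / (E - 1) ^ (M * n) := by
  classical
  have hW0 : 0 ≤ W := (Finset.sum_nonneg fun _ _ => abs_nonneg _).trans (hW 0 0 (by simp))
  set ℓ : ι → ℝ := fun i => A * x i + B * y i + c with hℓdef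
  set u : ι → ℝ := fun i => p i * ((intChoose (x i) τ : ℝ) * (intChoose (y i) τ' : ℝ)) with hu
  have hWu : ∑ i ∈ I, |u i| ≤ W := hW τ τ' (by omega)
  have hdiff : ∀ i ∈ I, ∀ s : ℝ, 0 ≤ s → s ≤ 2 * n →
      |exp (ℓ i * s) - exp (g i * s)| ≤ exp (2 * n * G) * (4 * n * δ) := by
    intro i hi s hs0 hs
    have h1 : |ℓ i * s - g i * s| ≤ 2 * n * δ := by
      rw [← sub_mul, abs_mul, abs_of_nonneg hs0, mul_comm]
      exact mul_le_mul hs (hgℓ i hi) (abs_nonneg _) (by positivity)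
    refine (abs_exp_sub_exp_le h1 hδn).trans ?_
    have h2 : g i * s ≤ 2 * n * G := by
      calc g i * s ≤ G * (2 * n) :=
            mul_le_mul ((le_abs_self _).trans (hg i hi)) hs hs0 hG
        _ = _ := by ring
    have h3 : 2 * (2 * n * δ) = 4 * n * δ := by ring
    rw [h3]
    gcongr
  set η := W * exp G * exp (2 * n * G) * (4 * n * δ) with hη
  have hη0 : 0 ≤ η := by positivity
  set f : ℂ → ℂ := fun z => ∑ i ∈ I, (u i : ℂ) * Complex.exp ((ℓ i : ℂ) * z) with hf
  have hfd : Differentiable ℂ f := by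
    rw [hf]; fun_prop
  have hsmall : ∀ i < n, ∃ q, HasFPowerSeriesAt f q (2 * (i : ℂ) + 1) ∧
      ∀ j < M, ‖q.coeff j‖ ≤ η := by
    intro i hi
    obtain ⟨q, hq, hqc⟩ := expSum_hasFPowerSeriesAt I (fun i => (u i : ℂ)) (fun i => (ℓ i : ℂ))
      (2 * (i : ℂ) + 1)
    refine ⟨q, hq, fun j hj => ?_⟩
    have h0 := sum_intChoose_mul_pow_eq_zero (I := I) (u := fun l => p l * exp (g l * (2 * i + 1)))
      (x := x) (y := y) (m := 2 * M) (fun a b hab => hvan a b hab i hi)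
      (ℓ := ℓ) (A := A) (B := B) (c := c) (fun _ => rfl) j τ τ' (by omega)
    have h1 : q.coeff j = ((∑ l ∈ I, u l * (ℓ l ^ j / j.factorial) *
        (exp (ℓ l * (2 * i + 1)) - exp (g l * (2 * i + 1))) : ℝ) : ℂ) := by
      have h2 : ∑ l ∈ I, u l * (ℓ l ^ j / j.factorial) *
          (exp (ℓ l * (2 * i + 1)) - exp (g l * (2 * i + 1))) =
          (∑ l ∈ I, u l * ℓ l ^ j * exp (ℓ l * (2 * i + 1))) / j.factorial -
          (∑ l ∈ I, p l * exp (g l * (2 * i + 1)) *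
          ((intChoose (x l) τ : ℝ) * (intChoose (y l) τ' : ℝ)) * ℓ l ^ j) / j.factorial := by
        rw [Finset.sum_div, Finset.sum_div, ← Finset.sum_sub_distrib]
        refine Finset.sum_congr rfl fun l _ => ?_
        simp only [hu]
        ring
      rw [h2, h0, hqc]
      push_cast
      simp
    rw [h1, Complex.norm_real, Real.norm_eq_abs]
    refine (Finset.abs_sum_le_sum_abs _ _).trans ?_
    have h3 : ∀ l ∈ I, |u l * (ℓ l ^ j / j.factorial) *
        (exp (ℓ l * (2 * i + 1)) - exp (g l * (2 * i + 1)))| ≤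
        |u l| * (exp G * (exp (2 * n * G) * (4 * n * δ))) := by
      intro l hl
      rw [abs_mul, abs_mul, mul_assoc]
      have h4 : |ℓ l ^ j / j.factorial| ≤ exp G := by
        rw [abs_div, abs_pow, Nat.abs_cast]
        exact (Real.pow_div_factorial_le_exp _ (abs_nonneg _) j).trans
          (Real.exp_le_exp.2 (hℓ l hl))
      have h5 : (2 * (i : ℝ) + 1) ≤ 2 * n := by
        have : 2 * i + 1 ≤ 2 * n := by omega
        exact_mod_cast this
      have := hdiff l hl (2 * i + 1) (by positivity) h5
      gcongr
    refine (Finset.sum_le_sum h3).trans ?_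
    rw [← Finset.sum_mul, hη]
    calc (∑ l ∈ I, |u l|) * (exp G * (exp (2 * n * G) * (4 * n * δ)))
        ≤ W * (exp G * (exp (2 * n * G) * (4 * n * δ))) := by gcongr
      _ = _ := by ring
  have hB : ∀ z : ℂ, ‖z‖ ≤ 2 * E * n → ‖f z‖ ≤ W * exp (2 * E * n * G) := by
    intro z hz
    refine (norm_sum_le _ _).trans ?_
    have h3 : ∀ l ∈ I, ‖(u l : ℂ) * Complex.exp ((ℓ l : ℂ) * z)‖ ≤
        |u l| * exp (2 * E * n * G) := by
      intro l hl
      rw [norm_mul, Complex.norm_real, Real.norm_eq_abs, Complex.norm_exp]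
      gcongr
      refine (Complex.re_le_norm _).trans ?_
      rw [norm_mul, Complex.norm_real, Real.norm_eq_abs, mul_comm]
      exact mul_le_mul hz (hℓ l hl) (abs_nonneg _) (by positivity)
    refine (Finset.sum_le_sum h3).trans ?_
    rw [← Finset.sum_mul]
    gcongr
  have hjn : (2 * (j : ℝ) + 1) / 2 ≤ 2 * n := by
    have : (2 * (j : ℝ) + 1) ≤ 4 * n := by
      have : 2 * j + 1 ≤ 4 * n := by omega
      exact_mod_cast this
    linarith
  have hz1 : ‖(((2 * (j : ℝ) + 1) / 2 : ℝ) : ℂ)‖ ≤ 2 * n := by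
    rw [Complex.norm_real, Real.norm_eq_abs, abs_of_nonneg (by positivity)]
    exact hjn
  have hz2 : ∀ i < n, ‖(((2 * (j : ℝ) + 1) / 2 : ℝ) : ℂ) - (2 * (i : ℂ) + 1)‖ ≤ 2 * n := by
    intro i hi
    have : (((2 * (j : ℝ) + 1) / 2 : ℝ) : ℂ) - (2 * (i : ℂ) + 1) =
      (((2 * (j : ℝ) + 1) / 2 - (2 * i + 1) : ℝ) : ℂ) := by push_cast; ring
    rw [this, Complex.norm_real, Real.norm_eq_abs, abs_le]
    have h5 : (2 * (i : ℝ) + 1) ≤ 2 * n := by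
      have : 2 * i + 1 ≤ 2 * n := by omega
      exact_mod_cast this
    have h6 : (0 : ℝ) ≤ (2 * (j : ℝ) + 1) / 2 := by positivity
    have h7 : (0 : ℝ) ≤ i := by positivity
    constructor <;> linarith
  have key := approximate_schwarz hfd hM hn hη0 hsmall hE hB hz1 hz2
  have hfz : f (((2 * (j : ℝ) + 1) / 2 : ℝ) : ℂ) =
      ((∑ l ∈ I, u l * exp (ℓ l * ((2 * j + 1) / 2)) : ℝ) : ℂ) := by
    simp only [hf]; push_cast; rfl
  rw [hfz, Complex.norm_real, Real.norm_eq_abs] at key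
  have hlast : |∑ l ∈ I, u l * exp (g l * ((2 * j + 1) / 2)) -
      ∑ l ∈ I, u l * exp (ℓ l * ((2 * j + 1) / 2))| ≤ η := by
    rw [← Finset.sum_sub_distrib]
    refine (Finset.abs_sum_le_sum_abs _ _).trans ?_
    have h3 : ∀ l ∈ I, |u l * exp (g l * ((2 * j + 1) / 2)) - u l * exp (ℓ l * ((2 * j + 1) / 2))|
        ≤ |u l| * (exp G * (exp (2 * n * G) * (4 * n * δ))) := by
      intro l hl
      rw [← mul_sub, abs_mul, abs_sub_comm]
      have := hdiff l hl ((2 * j + 1) / 2) (by positivity) hjn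
      have h1 : 1 ≤ exp G := Real.one_le_exp hG
      have h2 : (0 : ℝ) ≤ exp (2 * n * G) * (4 * n * δ) := by positivity
      gcongr
      nlinarith
    refine (Finset.sum_le_sum h3).trans ?_
    rw [← Finset.sum_mul, hη]
    calc (∑ l ∈ I, |u l|) * (exp G * (exp (2 * n * G) * (4 * n * δ)))
        ≤ W * (exp G * (exp (2 * n * G) * (4 * n * δ))) := by gcongr
      _ = _ := by ring
  have hrw : ∑ l ∈ I, p l * exp (g l * ((2 * j + 1) / 2)) *
        ((intChoose (x l) τ : ℝ) * (intChoose (y l) τ' : ℝ)) =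
      ∑ l ∈ I, u l * exp (g l * ((2 * j + 1) / 2)) :=
    Finset.sum_congr rfl fun l _ => by simp only [hu]; ring
  rw [hrw]
  have h1 : 1 ≤ exp (4 * (M * n : ℕ) * (E + 1)) := Real.one_le_exp (by positivity)
  have h2 := abs_add_le (∑ l ∈ I, u l * exp (g l * ((2 * j + 1) / 2)) -
      ∑ l ∈ I, u l * exp (ℓ l * ((2 * j + 1) / 2))) (∑ l ∈ I, u l * exp (ℓ l * ((2 * j + 1) / 2)))
  rw [sub_add_cancel] at h2
  nlinarith

/-- Finitely many real linear forms take simultaneously small values at a nonzero integer point of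
controlled size. -/
lemma exists_int_abs_sum_lt {ι κ : Type*} [Fintype ι] [Fintype κ] (v : κ → ι → ℝ) {V δ : ℝ}
    (hδ : 0 < δ) (hv : ∀ k, ∑ i, |v k i| ≤ V) {P X : ℕ} (hX : P * V / δ ≤ X)
    (hcard : (2 * X + 1) ^ Fintype.card κ < (P + 1) ^ Fintype.card ι) :
    ∃ p : ι → ℤ, p ≠ 0 ∧ (∀ i, |p i| ≤ P) ∧ ∀ k, |∑ i, p i * v k i| < δ := by
  classical
  have hmaps : ∀ q ∈ Fintype.piFinset (fun _ : ι => Finset.Icc (0 : ℤ) P),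
      (fun k => ⌊(∑ i, q i * v k i) / δ⌋) ∈
        Fintype.piFinset (fun _ : κ => Finset.Icc (-(X : ℤ)) X) := by
    intro q hq
    rw [Fintype.mem_piFinset] at hq ⊢
    intro k
    have h1 : |∑ i, q i * v k i| ≤ P * V := by
      refine (Finset.abs_sum_le_sum_abs _ _).trans ?_
      refine le_trans ?_ (mul_le_mul_of_nonneg_left (hv k) (Nat.cast_nonneg P))
      rw [Finset.mul_sum]
      refine Finset.sum_le_sum fun i _ => ?_
      rw [abs_mul]
      have h2 := Finset.mem_Icc.1 (hq i)
      have h3 : (0 : ℝ) ≤ q i := by exact_mod_cast h2.1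
      have h4 : (q i : ℝ) ≤ P := by exact_mod_cast h2.2
      rw [abs_of_nonneg h3]
      gcongr
    have h2 : |(∑ i, q i * v k i) / δ| ≤ X := by
      rw [abs_div, abs_of_pos hδ]
      exact le_trans (by gcongr) hX
    rw [abs_le] at h2
    rw [Finset.mem_Icc]
    constructor
    · rw [Int.le_floor]; push_cast; exact h2.1
    · have : (⌊(∑ i, q i * v k i) / δ⌋ : ℝ) ≤ X := (Int.floor_le _).trans h2.2
      exact_mod_cast this
  have hc : (Fintype.piFinset (fun _ : κ => Finset.Icc (-(X : ℤ)) X)).card <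
      (Fintype.piFinset (fun _ : ι => Finset.Icc (0 : ℤ) P)).card := by
    rw [Fintype.card_piFinset, Fintype.card_piFinset]
    simp only [Int.card_Icc, Finset.prod_const, Finset.card_univ]
    convert hcard using 2 <;> omega
  obtain ⟨q, hq, q', hq', hne, heq⟩ := Finset.exists_ne_map_eq_of_card_lt_of_maps_to hc hmaps
  rw [Fintype.mem_piFinset] at hq hq'
  refine ⟨q - q', sub_ne_zero.2 hne, fun i => ?_, fun k => ?_⟩
  · have h1 := Finset.mem_Icc.1 (hq i)
    have h2 := Finset.mem_Icc.1 (hq' i)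
    rw [Pi.sub_apply, abs_le]
    constructor <;> omega
  · have h1 := Int.abs_sub_lt_one_of_floor_eq_floor (congrFun heq k)
    rw [← sub_div, abs_div, abs_of_pos hδ, div_lt_one hδ, ← Finset.sum_sub_distrib] at h1
    refine lt_of_eq_of_lt (congrArg abs (Finset.sum_congr rfl fun i _ => ?_)) h1
    rw [Pi.sub_apply, Int.cast_sub, sub_mul]

namespace PositiveTriple

variable {K : IntermediateField ℚ ℝ} (S : PositiveTriple K)

lemma sum_sqrt_eq_zero [FiniteDimensional ℚ K] (hK : Module.finrank ℚ K ≤ 4)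
    {I : Finset (Fin 3 → ℤ)} {p x y : (Fin 3 → ℤ) → ℤ} {L : Fin 3 → ℕ} {l₀ : Fin 3 → ℤ}
    {ρ : (Fin 3 → ℤ) → K} {k M s₀ : ℕ} (hM : 0 < M) (hs₀ : 0 < s₀)
    (hbox : ∀ l ∈ I, ∀ i, |(l - l₀) i| ≤ L i) (hρ : ∀ l ∈ I, 0 < (ρ l : ℝ))
    (hρk : ∀ l ∈ I, ρ l ^ 2 ^ k = S.mon (l - l₀)) {t t' ε H U : ℝ}
    (happrox : ∀ l ∈ I, |t * (x l - x l₀) + t' * (y l - y l₀) -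
      Real.log (S.mon (l - l₀) : ℝ)| ≤ ε)
    (hlog : ∀ l ∈ I, |Real.log (S.mon (l - l₀) : ℝ)| ≤ H)
    (hLH : ∑ j, L j * S.h j ≤ H) (hU : U = 2 * M * (s₀ * 2 ^ k)) (hU1 : 1 ≤ U)
    (hHU : H * exp 1100 * s₀ ≤ U) (hε0 : 0 ≤ ε) (hεH : ε ≤ H)
    (hε : ε ≤ exp (-((2 * exp 1100 + 700) * U)))
    (hW : ∀ τ τ', τ + τ' ≤ 2 * M →
      ∑ l ∈ I, |((p l * (intChoose (x l) τ * intChoose (y l) τ') : ℤ) : ℝ)| ≤ exp (14 * U))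
    (hvan : ∀ τ τ', τ + τ' ≤ 2 * M → ∀ i < s₀ * 2 ^ k,
      ∑ l ∈ I, ((p l * (intChoose (x l) τ * intChoose (y l) τ') : ℤ) : ℝ) *
        (ρ l : ℝ) ^ (2 * i + 1) = 0)
    {τ τ' : ℕ} (hτ : τ + τ' ≤ M) {j : ℕ} (hj : j < 2 * (s₀ * 2 ^ k)) :
    ∑ l ∈ I, ((p l * (intChoose (x l) τ * intChoose (y l) τ') : ℤ) : ℝ) *
        √(ρ l : ℝ) ^ (2 * j + 1) = 0 := by
  classical
  obtain ⟨F, hF, hFd, hFs⟩ := S.exists_field_sqrt k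
  have hH0 : 0 ≤ H := hε0.trans hεH
  have hE1101 : 1101 ≤ exp 1100 := by have := Real.add_one_le_exp (1100 : ℝ); linarith
  have hs1 : (1 : ℝ) ≤ s₀ := by exact_mod_cast hs₀
  have h2k : (1 : ℝ) ≤ 2 ^ k := one_le_pow₀ (by norm_num)
  have h2kpos : (0 : ℝ) < 2 ^ k := by positivity
  have hM1 : (1 : ℝ) ≤ M := by exact_mod_cast hM
  have hsU : (s₀ : ℝ) ≤ U := by
    have : 1 ≤ (M : ℝ) * 2 ^ k := one_le_mul_of_one_le_of_one_le hM1 h2k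
    rw [hU]; nlinarith
  have hHs : 100 * (H * s₀) ≤ U := by
    have : 0 ≤ H * s₀ := by positivity
    nlinarith
  set g : (Fin 3 → ℤ) → ℝ := fun l => Real.log (ρ l : ℝ) with hg
  have hgl : ∀ l ∈ I, g l = Real.log (S.mon (l - l₀) : ℝ) / 2 ^ k := by
    intro l hl
    rw [← hρk l hl, eq_div_iff h2kpos.ne', hg]
    push_cast
    rw [Real.log_pow]; push_cast; ring
  have hexp : ∀ l ∈ I, ∀ i : ℕ, (ρ l : ℝ) ^ i = exp (g l * i) := by
    intro l hl i
    rw [hg, mul_comm, Real.exp_nat_mul, Real.exp_log (hρ l hl)]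
  have hsqrt : ∀ l ∈ I, ∀ i : ℕ, √(ρ l : ℝ) ^ i = exp (g l * (i / 2)) := by
    intro l hl i
    have h1 : g l * (i / 2) = i * Real.log (√(ρ l : ℝ)) := by
      rw [Real.log_sqrt (hρ l hl).le]; simp only [hg]; ring
    rw [h1, Real.exp_nat_mul, Real.exp_log (Real.sqrt_pos.2 (hρ l hl))]
  set G := 2 * H / 2 ^ k with hG
  set δ := ε / 2 ^ k with hδ
  have hrepr : ∀ l, t / 2 ^ k * x l + t' / 2 ^ k * y l +
      (-(t * x l₀ + t' * y l₀) / 2 ^ k) = (t * (x l - x l₀) + t' * (y l - y l₀)) / 2 ^ k := by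
    intro l; field_simp; ring
  have hn : 0 < s₀ * 2 ^ k := by positivity
  have hnG : ((s₀ * 2 ^ k : ℕ) : ℝ) * G = 2 * (H * s₀) := by
    rw [hG]; push_cast; field_simp
  have hnδ : ((s₀ * 2 ^ k : ℕ) : ℝ) * δ = s₀ * ε := by
    rw [hδ]; push_cast; field_simp
  have hεs : s₀ * ε ≤ exp (-((2 * exp 1100 + 699) * U)) := by
    calc s₀ * ε ≤ exp U * exp (-((2 * exp 1100 + 700) * U)) := by
          gcongr
          exact hsU.trans (by linarith [Real.add_one_le_exp U])
      _ = _ := by rw [← Real.exp_add]; ring_nf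
  have key := expSum_half_odd_small (I := I) (p := fun l => (p l : ℝ)) (g := g) (x := x) (y := y)
    (A := t / 2 ^ k) (B := t' / 2 ^ k) (c := -(t * x l₀ + t' * y l₀) / 2 ^ k) (M := M)
    (n := s₀ * 2 ^ k) hM hn (δ := δ) (G := G) (W := exp (14 * U)) (E := exp 1100)
    (by linarith) (by positivity) (by positivity)
    (by
      rw [mul_assoc, hnδ]
      have h1 : exp (-((2 * exp 1100 + 699) * U)) ≤ exp (-1) := by
        apply Real.exp_le_exp.2; nlinarith
      have h2 : exp (-1 : ℝ) ≤ 1 / 2 := by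
        rw [Real.exp_neg, one_div]
        apply inv_anti₀ (by norm_num); have := Real.add_one_le_exp (1 : ℝ); linarith
      linarith)
    (fun l hl => by
      rw [hgl l hl, abs_div, abs_of_pos h2kpos, hG]
      have := hlog l hl
      gcongr
      linarith)
    (fun l hl => by
      rw [hrepr, abs_div, abs_of_pos h2kpos, hG]
      have h1 := hlog l hl
      have h2 := abs_add_le (t * (x l - x l₀) + t' * (y l - y l₀) -
        Real.log (S.mon (l - l₀) : ℝ)) (Real.log (S.mon (l - l₀) : ℝ))
      have h3 := happrox l hl
      rw [sub_add_cancel] at h2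
      gcongr
      linarith)
    (fun l hl => by
      rw [hrepr, hgl l hl, ← sub_div, abs_div, abs_of_pos h2kpos, hδ]
      have := happrox l hl
      gcongr)
    (fun τ τ' h => by
      refine le_of_eq_of_le (Finset.sum_congr rfl fun l _ => ?_) (hW τ τ' h)
      push_cast; rfl)
    (fun τ τ' h i hi => by
      rw [← hvan τ τ' h i hi]
      refine Finset.sum_congr rfl fun l hl => ?_
      rw [hexp l hl]; push_cast; ring)
    hτ hj
  have hsum : ∑ l ∈ I, (p l : ℝ) * exp (g l * ((2 * j + 1) / 2)) *
      ((intChoose (x l) τ : ℝ) * (intChoose (y l) τ' : ℝ)) =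
      ∑ l ∈ I, ((p l * (intChoose (x l) τ * intChoose (y l) τ') : ℤ) : ℝ) *
        √(ρ l : ℝ) ^ (2 * j + 1) := by
    refine Finset.sum_congr rfl fun l hl => ?_
    rw [hsqrt l hl]; push_cast; ring
  rw [hsum] at key
  have hMn : ((M * (s₀ * 2 ^ k) : ℕ) : ℝ) = U / 2 := by rw [hU]; push_cast; ring
  have hG1 : G ≤ U / 2 := by
    have : G ≤ 2 * H := div_le_self (by positivity) h2k
    nlinarith
  have hb1 : 3 * (exp (14 * U) * exp G * exp (2 * (s₀ * 2 ^ k : ℕ) * G) *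
      (4 * (s₀ * 2 ^ k : ℕ) * δ)) * exp (4 * (M * (s₀ * 2 ^ k) : ℕ) * (exp 1100 + 1)) ≤
      exp (-(600 * U)) := by
    rw [hMn]
    rw [show (4 * ((s₀ * 2 ^ k : ℕ) : ℝ) * δ) = 4 * (s₀ * ε) by rw [← hnδ]; ring,
      show (2 * ((s₀ * 2 ^ k : ℕ) : ℝ) * G) = 4 * (H * s₀) by rw [mul_assoc, hnG]; ring]
    have h12 : (12 : ℝ) ≤ exp (11 * U) := by
      have := Real.add_one_le_exp (11 * U); linarith
    calc 3 * (exp (14 * U) * exp G * exp (4 * (H * s₀)) * (4 * (s₀ * ε))) *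
          exp (4 * (U / 2) * (exp 1100 + 1))
        = 12 * (exp (14 * U) * exp G * exp (4 * (H * s₀)) * (s₀ * ε) *
          exp (4 * (U / 2) * (exp 1100 + 1))) := by ring
      _ ≤ exp (11 * U) * (exp (14 * U) * exp (U / 2) * exp (U / 2) *
          exp (-((2 * exp 1100 + 699) * U)) * exp (4 * (U / 2) * (exp 1100 + 1))) := by
        gcongr
        linarith
      _ = exp (-(671 * U)) := by
        simp only [← Real.exp_add]; congr 1; ring
      _ ≤ _ := by apply Real.exp_le_exp.2; linarith
  have hb2 : exp (14 * U) * exp (2 * exp 1100 * (s₀ * 2 ^ k : ℕ) * G) /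
      (exp 1100 - 1) ^ (M * (s₀ * 2 ^ k)) ≤ exp (-(530 * U)) := by
    rw [div_le_iff₀ (pow_pos (by linarith) _)]
    have h1 : exp 1099 ≤ exp 1100 - 1 := by
      have h2 : exp 1100 = exp 1099 * exp 1 := by rw [← Real.exp_add]; norm_num
      have h3 := Real.add_one_le_exp (1 : ℝ)
      have h4 := Real.add_one_le_exp (1099 : ℝ)
      nlinarith
    have h2 : exp (1099 * (U / 2)) ≤ (exp 1100 - 1) ^ (M * (s₀ * 2 ^ k)) := by
      rw [← hMn, mul_comm, Real.exp_nat_mul]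
      exact pow_le_pow_left₀ (Real.exp_pos _).le h1 _
    have h3 : 2 * exp 1100 * ((s₀ * 2 ^ k : ℕ) : ℝ) * G ≤ 4 * U := by
      rw [mul_assoc, hnG]; linarith
    calc exp (14 * U) * exp (2 * exp 1100 * (s₀ * 2 ^ k : ℕ) * G)
        ≤ exp (14 * U) * exp (4 * U) := by gcongr
      _ ≤ exp (-(530 * U)) * exp (1099 * (U / 2)) := by
        rw [← Real.exp_add, ← Real.exp_add]
        apply Real.exp_le_exp.2; linarith
      _ ≤ _ := by gcongr
  let θ : (Fin 3 → ℤ) → F := fun l => if h : √(ρ l : ℝ) ∈ F then ⟨_, h⟩ else 0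
  have hθ : ∀ l ∈ I, (θ l : ℝ) = √(ρ l : ℝ) := by
    intro l hl
    have := hFs (ρ l) _ (hρ l hl) (hρk l hl)
    simp [θ, this]
  have hthr : |∑ l ∈ I, ((p l * (intChoose (x l) τ * intChoose (y l) τ') : ℤ) : ℝ) *
      (θ l : ℝ) ^ (2 * j + 1)| < ((exp (14 * U) * exp (2 * (2 * s₀ : ℝ) * H)) ^ 32)⁻¹ := by
    have h1 : ∑ l ∈ I, ((p l * (intChoose (x l) τ * intChoose (y l) τ') : ℤ) : ℝ) *
      (θ l : ℝ) ^ (2 * j + 1) = ∑ l ∈ I, ((p l * (intChoose (x l) τ * intChoose (y l) τ') : ℤ) : ℝ) *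
      √(ρ l : ℝ) ^ (2 * j + 1) := Finset.sum_congr rfl fun l hl => by rw [hθ l hl]
    rw [h1]
    have h2 : exp (-(480 * U)) ≤ ((exp (14 * U) * exp (2 * (2 * s₀ : ℝ) * H)) ^ 32)⁻¹ := by
      rw [← Real.exp_add, ← Real.exp_nat_mul, ← Real.exp_neg]
      apply Real.exp_le_exp.2
      push_cast
      linarith
    have h3 : exp (-(600 * U)) ≤ exp (-(530 * U)) := by apply Real.exp_le_exp.2; linarith
    have h4 : exp (-(530 * U)) * 2 < exp (-(480 * U)) := by
      have h5 : exp (-(480 * U)) = exp (-(530 * U)) * exp (50 * U) := by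
        rw [← Real.exp_add]; congr 1; ring
      rw [h5]
      have := Real.add_one_le_exp (50 * U)
      exact mul_lt_mul_of_pos_left (by linarith) (Real.exp_pos _)
    linarith
  have hzero := S.sum_root_pow_eq_zero_of_small hK F hFd I
    (fun l => p l * (intChoose (x l) τ * intChoose (y l) τ')) θ (fun l => l - l₀)
    (m := 2 ^ (k + 1)) (by positivity)
    (fun l hl => by
      apply Subtype.ext
      rw [SubmonoidClass.coe_pow, hθ l hl, pow_succ', pow_mul, Real.sq_sqrt (hρ l hl).le,
        ← hρk l hl]
      push_cast; rfl)
    (L := L) hbox (H₀ := H) hLH (s := 2 * j + 1) (r := 2 * s₀)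
    (by
      have : 2 * j + 1 ≤ 2 * s₀ * 2 ^ (k + 1) := by rw [pow_succ]; nlinarith
      exact_mod_cast this)
    (A := exp (14 * U)) (Real.one_le_exp (by linarith)) (hW τ τ' (by omega)) hthr
  rw [← hzero]
  exact Finset.sum_congr rfl fun l hl => by rw [hθ l hl]

/-- On a nonempty set of exponents in `B`, all `2 ^ k`-th roots of the monomials (relative to some
base exponent) exist, and the corresponding sums weighted by binomial coefficients of total degree at
most `m` vanish at the first `n` odd integers. -/
def Vanishes (p x y : (Fin 3 → ℤ) → ℤ) (B : Finset (Fin 3 → ℤ)) (n k m : ℕ) : Prop :=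
  ∃ I ⊆ B, I.Nonempty ∧ ∃ l₀ ∈ B, ∃ ρ : (Fin 3 → ℤ) → K,
    (∀ l ∈ I, 0 < (ρ l : ℝ)) ∧ (∀ l ∈ I, ρ l ^ 2 ^ k = S.mon (l - l₀)) ∧
    ∀ τ τ', τ + τ' ≤ m → ∀ i < n,
      ∑ l ∈ I, ((p l * (intChoose (x l) τ * intChoose (y l) τ') : ℤ) : ℝ) *
        (ρ l : ℝ) ^ (2 * i + 1) = 0

section

variable [FiniteDimensional ℚ K] (hK : Module.finrank ℚ K ≤ 4)
  {p x y : (Fin 3 → ℤ) → ℤ} {B : Finset (Fin 3 → ℤ)} {L : Fin 3 → ℕ}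
  (hbox : ∀ l ∈ B, ∀ l₀ ∈ B, ∀ i, |(l - l₀) i| ≤ L i)
  {t t' ε H U : ℝ}
  (happrox : ∀ l ∈ B, ∀ l₀ ∈ B, |t * (x l - x l₀) + t' * (y l - y l₀) -
    Real.log (S.mon (l - l₀) : ℝ)| ≤ ε)
  (hlog : ∀ l ∈ B, ∀ l₀ ∈ B, |Real.log (S.mon (l - l₀) : ℝ)| ≤ H)
  (hLH : ∑ j, L j * S.h j ≤ H) {s₀ : ℕ} (hs₀ : 0 < s₀) (hU1 : 1 ≤ U)
  (hHU : H * exp 1100 * s₀ ≤ U) (hε0 : 0 ≤ ε) (hεH : ε ≤ H)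
  (hε : ε ≤ exp (-((2 * exp 1100 + 700) * U)))

include hK hbox happrox hlog hLH hs₀ hU1 hHU hε0 hεH hε

lemma Vanishes.step {k M : ℕ} (hM : 0 < M) (hU : U = 2 * M * (s₀ * 2 ^ k))
    (hW : ∀ τ τ', τ + τ' ≤ 2 * M →
      ∑ l ∈ B, |((p l * (intChoose (x l) τ * intChoose (y l) τ') : ℤ) : ℝ)| ≤ exp (14 * U))
    (h : S.Vanishes p x y B (s₀ * 2 ^ k) k (2 * M)) :
    S.Vanishes p x y B (s₀ * 2 ^ (k + 1)) (k + 1) M := by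
  classical
  obtain ⟨I, hIB, ⟨i₀, hi₀⟩, l₀, hl₀, ρ, hρ, hρk, hvan⟩ := h
  obtain ⟨F, hF, -, hFs⟩ := S.exists_field_sqrt k
  have hzero := fun τ τ' hτ j hj => S.sum_sqrt_eq_zero hK (I := I) (p := p) (x := x) (y := y)
    (L := L) (l₀ := l₀) (ρ := ρ) (k := k) (τ := τ) (τ' := τ') (j := j) hM hs₀
    (fun l hl => hbox l (hIB hl) l₀ hl₀) hρ hρk
    (fun l hl => happrox l (hIB hl) l₀ hl₀) (fun l hl => hlog l (hIB hl) l₀ hl₀) hLH hU hU1 hHU hε0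
    hεH hε (fun τ τ' h => (Finset.sum_le_sum_of_subset_of_nonneg hIB
      fun _ _ _ => abs_nonneg _).trans (hW τ τ' h)) hvan hτ hj
  let θ : (Fin 3 → ℤ) → F := fun l => if h : √(ρ l : ℝ) ∈ F then ⟨_, h⟩ else 0
  have hθ : ∀ l ∈ I, (θ l : ℝ) = √(ρ l : ℝ) := by
    intro l hl
    have := hFs (ρ l) _ (hρ l hl) (hρk l hl)
    simp [θ, this]
  have hcoe : ∀ (n : ℤ) (q : K), ((algebraMap K F ((n : K) * q) : F) : ℝ) = n * (q : ℝ) := by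
    intro n q
    change (((n : K) * q : K) : ℝ) = _
    push_cast
    rfl
  have hr0 : 0 < √(ρ i₀ : ℝ) := Real.sqrt_pos.2 (hρ i₀ hi₀)
  let J := I.filter fun l => θ l * θ i₀ ∈ Set.range (algebraMap K F)
  have hJI : J ⊆ I := Finset.filter_subset _ _
  let r : (Fin 3 → ℤ) → K := fun l =>
    if h : θ l * θ i₀ ∈ Set.range (algebraMap K F) then h.choose / ρ i₀ else 0
  have hr : ∀ l ∈ J, (r l : ℝ) = √(ρ l : ℝ) / √(ρ i₀ : ℝ) := by
    intro l hl
    have h := (Finset.mem_filter.1 hl).2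
    have h1 : (h.choose : ℝ) = √(ρ l : ℝ) * √(ρ i₀ : ℝ) := by
      rw [← hθ l (hJI hl), ← hθ i₀ hi₀]
      exact congrArg (fun z : F => (z : ℝ)) h.choose_spec
    simp only [r, h, dif_pos]
    push_cast
    rw [h1, div_eq_div_iff (hρ i₀ hi₀).ne' hr0.ne', mul_assoc, Real.mul_self_sqrt (hρ i₀ hi₀).le]
  refine ⟨J, hJI.trans hIB, ⟨i₀, ?_⟩, i₀, hIB hi₀, r, ?_, ?_, ?_⟩
  · refine Finset.mem_filter.2 ⟨hi₀, ρ i₀, ?_⟩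
    apply Subtype.ext
    rw [MulMemClass.coe_mul, hθ i₀ hi₀, Real.mul_self_sqrt (hρ i₀ hi₀).le]
    rfl
  · intro l hl
    rw [hr l hl]
    exact div_pos (Real.sqrt_pos.2 (hρ l (hJI hl))) hr0
  · intro l hl
    have h1 : r l ^ 2 = ρ l / ρ i₀ := by
      apply Subtype.ext
      push_cast
      rw [hr l hl, div_pow, Real.sq_sqrt (hρ l (hJI hl)).le, Real.sq_sqrt (hρ i₀ hi₀).le]
    rw [pow_succ', pow_mul, h1, div_pow, hρk l (hJI hl), hρk i₀ hi₀, ← mon_sub, sub_sub_sub_cancel_right]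
  · intro τ τ' hτ i hi
    have h1 := hzero τ τ' hτ i (by rw [pow_succ] at hi; linarith)
    have h2 : ∑ l ∈ I, algebraMap K F
        (((p l * (intChoose (x l) τ * intChoose (y l) τ') : ℤ) : K) * ρ l ^ i) * θ l = 0 := by
      apply Subtype.ext
      rw [AddSubmonoidClass.coe_finsetSum, ZeroMemClass.coe_zero, ← h1]
      refine Finset.sum_congr rfl fun l hl => ?_
      rw [MulMemClass.coe_mul, hcoe, hθ l hl, pow_succ, pow_mul, Real.sq_sqrt (hρ l hl).le]
      push_cast
      ring
    have h3 := sum_sqrt_class_eq_zero (K := K) (F := F) (I := I) (θ := θ) (g := ρ)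
      (fun l hl => by
        apply Subtype.ext
        rw [SubmonoidClass.coe_pow, hθ l hl, Real.sq_sqrt (hρ l hl).le]; rfl) hi₀
      (by
        intro h
        have := hθ i₀ hi₀
        rw [h, ZeroMemClass.coe_zero] at this
        exact hr0.ne this) h2 J (fun l => Finset.mem_filter)
    have h4 := congrArg (fun z : F => (z : ℝ)) h3
    simp only [AddSubmonoidClass.coe_finsetSum, ZeroMemClass.coe_zero] at h4
    have h5 : ∑ l ∈ J, ((p l * (intChoose (x l) τ * intChoose (y l) τ') : ℤ) : ℝ) *
        (r l : ℝ) ^ (2 * i + 1) = (∑ l ∈ J, ((algebraMap K F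
        (((p l * (intChoose (x l) τ * intChoose (y l) τ') : ℤ) : K) * ρ l ^ i) * θ l : F) : ℝ)) /
        √(ρ i₀ : ℝ) ^ (2 * i + 1) := by
      rw [Finset.sum_div]
      refine Finset.sum_congr rfl fun l hl => ?_
      rw [MulMemClass.coe_mul, hcoe, hθ l (hJI hl), hr l hl, div_pow, pow_succ (√(ρ l : ℝ)),
        pow_mul (√(ρ l : ℝ)), Real.sq_sqrt (hρ l (hJI hl)).le]
      push_cast
      ring
    rw [h5, h4, zero_div]

lemma not_vanishes (hreal : ∀ (φ : K →+* ℂ) (x : K), (φ x).im = 0)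
    (hind : ∀ n, S.mon n = 1 → n = 0) {κ : ℕ} (hU : U = 2 ^ κ * s₀)
    (hW : ∀ τ τ', τ + τ' ≤ 2 ^ κ →
      ∑ l ∈ B, |((p l * (intChoose (x l) τ * intChoose (y l) τ') : ℤ) : ℝ)| ≤ exp (14 * U))
    (hp : ∀ l ∈ B, p l ≠ 0) : ¬ S.Vanishes p x y B s₀ 0 (2 ^ κ) := by
  intro h
  have key : ∀ k ≤ κ, S.Vanishes p x y B (s₀ * 2 ^ k) k (2 ^ (κ - k)) := by
    intro k
    induction k with
    | zero => intro _; simpa using h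
    | succ k ih =>
      intro hk
      obtain ⟨m, rfl⟩ := Nat.exists_eq_add_of_le hk
      have h1 : k + 1 + m - k = m + 1 := by omega
      have h2 : k + 1 + m - (k + 1) = m := by omega
      have h3 := ih (by omega)
      rw [h1, pow_succ'] at h3
      rw [h2]
      refine h3.step S hK hbox happrox hlog hLH hs₀ hU1 hHU hε0 hεH hε (by positivity) ?_ ?_
      · rw [hU]; push_cast; ring
      · intro τ τ' hτ
        refine hW τ τ' (hτ.trans ?_)
        rw [← pow_succ']
        exact Nat.pow_le_pow_right two_pos (by omega)
  obtain ⟨I, hIB, hI, l₀, hl₀, ρ, hρ, hρk, hvan⟩ := key κ le_rfl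
  have hone : ∀ l ∈ I, ρ l = 1 := by
    intro l hl
    have hE1101 : 1101 ≤ exp 1100 := by have := Real.add_one_le_exp (1100 : ℝ); linarith
    refine S.root_eq_one hreal (hρ l hl) (m := 2 ^ κ) (by positivity) (hρk l hl)
      (hbox l (hIB hl) l₀ hl₀) (c := 1 / 100) ?_ le_rfl
    refine hLH.trans ?_
    rw [hU] at hHU
    have hs1 : (0 : ℝ) < s₀ := by exact_mod_cast hs₀
    have := le_of_mul_le_mul_right hHU hs1
    have hH0 : 0 ≤ H := hε0.trans hεH
    push_cast
    nlinarith
  have heq : ∀ l ∈ I, l = l₀ := by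
    intro l hl
    have := hρk l hl
    rw [hone l hl, one_pow] at this
    exact sub_eq_zero.1 (hind _ this.symm)
  have hI1 : I = {l₀} := Finset.eq_singleton_iff_nonempty_unique_mem.2 ⟨hI, heq⟩
  have := hvan 0 0 (by simp) 0 (by positivity)
  rw [hI1, Finset.sum_singleton, hone l₀ (by rw [hI1]; simp)] at this
  simp only [intChoose_zero] at this
  exact hp l₀ hl₀ (by simpa using this)

end

end PositiveTriple

/-- Integer vectors with `i`-th coordinate between `0` and `L i`. -/
noncomputable def intBox (L : Fin 3 → ℕ) : Finset (Fin 3 → ℤ) :=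
  Fintype.piFinset fun i => Finset.Icc (0 : ℤ) (L i)

lemma mem_intBox {L : Fin 3 → ℕ} {l : Fin 3 → ℤ} : l ∈ intBox L ↔ ∀ i, 0 ≤ l i ∧ l i ≤ L i := by
  simp [intBox, Fintype.mem_piFinset]

lemma abs_sub_le_of_mem_intBox {L : Fin 3 → ℕ} {l l₀ : Fin 3 → ℤ} (hl : l ∈ intBox L)
    (hl₀ : l₀ ∈ intBox L) (i : Fin 3) : |(l - l₀) i| ≤ L i := by
  have h1 := mem_intBox.1 hl i
  have h2 := mem_intBox.1 hl₀ i
  rw [Pi.sub_apply, abs_le]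
  constructor <;> omega

lemma card_intBox (L : Fin 3 → ℕ) : (intBox L).card = ∏ i, (L i + 1) := by
  rw [intBox, Fintype.card_piFinset]
  refine Finset.prod_congr rfl fun i _ => ?_
  rw [Int.card_Icc]; omega

lemma abs_intChoose_le_exp {x : ℤ} {T s τ : ℕ} (hs : 0 < s) (hx : |(x : ℝ)| + T ≤ T * exp s)
    (hτ : τ ≤ T) : |(intChoose x τ : ℝ)| ≤ exp (2 * (T * s)) := by
  have h1 : |(x : ℝ)| + τ ≤ T * exp s := by
    have : (τ : ℝ) ≤ T := by exact_mod_cast hτ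
    linarith
  refine (abs_intChoose_le x τ h1).trans ?_
  rw [mul_pow, mul_div_right_comm, ← Real.exp_nat_mul]
  have h2 := Real.pow_div_factorial_le_exp (T : ℝ) (Nat.cast_nonneg T) τ
  have hs1 : (1 : ℝ) ≤ s := by exact_mod_cast hs
  have hτ' : (τ : ℝ) ≤ T := by exact_mod_cast hτ
  have hT : (0 : ℝ) ≤ T := by positivity
  calc (T : ℝ) ^ τ / τ.factorial * exp (τ * s) ≤ exp (T * s) * exp (T * s) := by
        gcongr
        refine h2.trans (Real.exp_le_exp.2 ?_)
        nlinarith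
    _ = _ := by rw [← Real.exp_add]; ring_nf

namespace PositiveTriple

variable {K : IntermediateField ℚ ℝ} (S : PositiveTriple K)

lemma abs_log_α_le (i : Fin 3) : |Real.log (S.α i : ℝ)| ≤ S.h i := by
  have h1 := S.conj_le (Complex.ofRealHom.comp (algebraMap K ℝ)) i
  have h2 := S.conj_inv_le (Complex.ofRealHom.comp (algebraMap K ℝ)) i
  have h1' : (S.α i : ℝ) ≤ exp (S.h i) := by
    refine le_trans (le_abs_self _) (le_of_eq_of_le ?_ h1)
    rw [← Real.norm_eq_abs, ← Complex.norm_real]; rfl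
  have h2' : (S.α i : ℝ)⁻¹ ≤ exp (S.h i) := by
    refine le_trans (le_abs_self _) (le_of_eq_of_le ?_ h2)
    rw [← Real.norm_eq_abs, ← Complex.norm_real]; rfl
  have h3 := (Real.log_le_iff_le_exp (S.pos i)).2 h1'
  have h4 := (Real.log_le_iff_le_exp (inv_pos.2 (S.pos i))).2 h2'
  rw [Real.log_inv] at h4
  exact abs_le.2 ⟨by linarith, h3⟩

lemma abs_log_mon_le {n : Fin 3 → ℤ} {L : Fin 3 → ℕ} (hn : ∀ i, |n i| ≤ L i) {H : ℝ}
    (hH : ∑ j, L j * S.h j ≤ H) : |Real.log (S.mon n : ℝ)| ≤ H := by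
  rw [S.log_mon]
  refine (Finset.abs_sum_le_sum_abs _ _).trans (le_trans (Finset.sum_le_sum fun i _ => ?_) hH)
  rw [abs_mul]
  have h1 : |(n i : ℝ)| ≤ L i := by exact_mod_cast hn i
  exact mul_le_mul h1 (S.abs_log_α_le i) (abs_nonneg _) (Nat.cast_nonneg _)

lemma exists_vanishes [FiniteDimensional ℚ K] (hK : Module.finrank ℚ K ≤ 4)
    {x y : (Fin 3 → ℤ) → ℤ} {L : Fin 3 → ℕ} {H U : ℝ} {T s₀ : ℕ} (hs₀ : 0 < s₀) (hT : 0 < T)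
    (hU : U = T * s₀) (hLH : ∑ j, L j * S.h j ≤ H) (hHU : H * exp 1100 * s₀ ≤ U)
    (hx : ∀ l ∈ intBox L, |(x l : ℝ)| + T ≤ T * exp s₀)
    (hy : ∀ l ∈ intBox L, |(y l : ℝ)| + T ≤ T * exp s₀)
    (hN : 100 * (s₀ * (T + 1) ^ 2) ≤ ∏ i, (L i + 1))
    (hN' : ((∏ i, (L i + 1) : ℕ) : ℝ) ≤ exp (3 * U)) :
    ∃ p : (Fin 3 → ℤ) → ℤ, ∃ B ⊆ intBox L, (∀ l ∈ B, p l ≠ 0) ∧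
      (∀ τ τ', τ + τ' ≤ T →
        ∑ l ∈ B, |((p l * (intChoose (x l) τ * intChoose (y l) τ') : ℤ) : ℝ)| ≤ exp (14 * U)) ∧
      S.Vanishes p x y B s₀ 0 T := by
  classical
  have hT1 : (1 : ℝ) ≤ T := by exact_mod_cast hT
  have hs1 : (1 : ℝ) ≤ s₀ := by exact_mod_cast hs₀
  have hU1 : 1 ≤ U := by rw [hU]; exact one_le_mul_of_one_le_of_one_le hT1 hs1
  have hE1101 : 1101 ≤ exp 1100 := by have := Real.add_one_le_exp (1100 : ℝ); linarith
  have hH0 : 0 ≤ H := le_trans (Finset.sum_nonneg fun j _ =>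
    mul_nonneg (by positivity) (zero_le_one.trans (S.one_le_h j))) hLH
  have hHs : 100 * (H * s₀) ≤ U := by
    have : 0 ≤ H * s₀ := by positivity
    nlinarith
  have hb : ∀ l ∈ intBox L, ∀ τ τ', τ ≤ T → τ' ≤ T →
      |((intChoose (x l) τ * intChoose (y l) τ' : ℤ) : ℝ)| ≤ exp (4 * U) := by
    intro l hl τ τ' hτ hτ'
    push_cast
    rw [abs_mul]
    refine (mul_le_mul (abs_intChoose_le_exp hs₀ (hx l hl) hτ)
      (abs_intChoose_le_exp hs₀ (hy l hl) hτ') (abs_nonneg _) (Real.exp_pos _).le).trans ?_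
    rw [← Real.exp_add, hU]
    apply Real.exp_le_exp.2
    linarith
  have hL : ∀ l ∈ intBox L, ∀ i, |l i| ≤ L i := by
    intro l hl i
    have := mem_intBox.1 hl i
    rw [abs_of_nonneg this.1]; exact this.2
  have hmon : ∀ l ∈ intBox L, ∀ i < s₀, |(S.mon l : ℝ) ^ (2 * i + 1)| ≤ exp U := by
    intro l hl i hi
    have h1 : (S.mon l : ℝ) ≤ exp H := by
      rw [← Real.log_le_iff_le_exp (S.mon_pos l)]
      exact (le_abs_self _).trans (S.abs_log_mon_le (hL l hl) hLH)
    rw [abs_of_pos (pow_pos (S.mon_pos l) _)]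
    refine (pow_le_pow_left₀ (S.mon_pos l).le h1 _).trans ?_
    rw [← Real.exp_nat_mul]
    apply Real.exp_le_exp.2
    have : ((2 * i + 1 : ℕ) : ℝ) ≤ 2 * s₀ := by
      have : 2 * i + 1 ≤ 2 * s₀ := by omega
      exact_mod_cast this
    nlinarith
  set P := ⌈exp (6 * U)⌉₊ with hP
  set X := ⌈P * exp (8 * U) / exp (-(480 * U))⌉₊ with hX
  have hP1 : exp (6 * U) ≤ P := Nat.le_ceil _
  have hP2 : (P : ℝ) ≤ exp (7 * U) := by
    have h1 : (P : ℝ) < exp (6 * U) + 1 := Nat.ceil_lt_add_one (Real.exp_pos _).le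
    have h2 : exp (7 * U) = exp (6 * U) * exp U := by rw [← Real.exp_add]; ring_nf
    have h3 := Real.add_one_le_exp U
    have h4 := Real.one_le_exp (x := 6 * U) (by linarith)
    rw [h2]; nlinarith
  have hX1 : ((2 * X + 1 : ℕ) : ℝ) ≤ exp (500 * U) := by
    have h1 : (X : ℝ) < P * exp (8 * U) / exp (-(480 * U)) + 1 := Nat.ceil_lt_add_one (by positivity)
    have h2 : P * exp (8 * U) / exp (-(480 * U)) ≤ exp (495 * U) := by
      rw [div_le_iff₀ (Real.exp_pos _)]
      calc P * exp (8 * U) ≤ exp (7 * U) * exp (8 * U) := by gcongr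
        _ = _ := by rw [← Real.exp_add, ← Real.exp_add]; ring_nf
    have h3 : exp (500 * U) = exp (495 * U) * exp (5 * U) := by rw [← Real.exp_add]; ring_nf
    have h4 := Real.add_one_le_exp (5 * U)
    have h5 := Real.one_le_exp (x := 495 * U) (by linarith)
    push_cast
    rw [h3]; nlinarith
  let v : Fin (T + 1) × Fin (T + 1) × Fin s₀ → intBox L → ℝ := fun c l =>
    ((intChoose (x l) c.1 * intChoose (y l) c.2.1 : ℤ) : ℝ) * (S.mon l : ℝ) ^ (2 * (c.2.2 : ℕ) + 1)
  have hv : ∀ c, ∑ l, |v c l| ≤ exp (8 * U) := by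
    intro c
    have h1 : ∀ l : intBox L, |v c l| ≤ exp (4 * U) * exp U := by
      intro l
      simp only [v]
      rw [abs_mul]
      exact mul_le_mul (hb l l.2 _ _ (by omega) (by omega)) (hmon l l.2 _ c.2.2.2)
        (abs_nonneg _) (Real.exp_pos _).le
    refine (Finset.sum_le_sum fun l _ => h1 l).trans ?_
    rw [Finset.sum_const, Finset.card_univ, Fintype.card_coe, card_intBox, nsmul_eq_mul]
    calc _ ≤ exp (3 * U) * (exp (4 * U) * exp U) := by gcongr
      _ = _ := by rw [← Real.exp_add, ← Real.exp_add]; ring_nf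
  have hcard : (2 * X + 1) ^ Fintype.card (Fin (T + 1) × Fin (T + 1) × Fin s₀) <
      (P + 1) ^ Fintype.card (intBox L) := by
    have h0 : Fintype.card (Fin (T + 1) × Fin (T + 1) × Fin s₀) = s₀ * (T + 1) ^ 2 := by
      simp only [Fintype.card_prod, Fintype.card_fin]; ring
    have h1 : Fintype.card (intBox L) = ∏ i, (L i + 1) := by
      rw [Fintype.card_coe, card_intBox]
    rw [h0, h1]
    have hM0 : 0 < s₀ * (T + 1) ^ 2 := by positivity
    have h2 : 2 * X + 1 < (P + 1) ^ 100 := by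
      have : ((2 * X + 1 : ℕ) : ℝ) < (P + 1 : ℝ) ^ 100 := by
        refine hX1.trans_lt ?_
        calc exp (500 * U) < exp ((100 : ℕ) * (6 * U)) := by
              apply Real.exp_lt_exp.2; push_cast; linarith
          _ = exp (6 * U) ^ 100 := Real.exp_nat_mul _ _
          _ ≤ (P + 1 : ℝ) ^ 100 := by gcongr; linarith
      exact_mod_cast this
    calc (2 * X + 1) ^ (s₀ * (T + 1) ^ 2) < ((P + 1) ^ 100) ^ (s₀ * (T + 1) ^ 2) :=
          Nat.pow_lt_pow_left h2 hM0.ne'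
      _ = (P + 1) ^ (100 * (s₀ * (T + 1) ^ 2)) := (pow_mul _ _ _).symm
      _ ≤ _ := Nat.pow_le_pow_right (by omega) hN
  obtain ⟨q, hq0, hqP, hqs⟩ := exists_int_abs_sum_lt v (Real.exp_pos _) hv (Nat.le_ceil _) hcard
  let p : (Fin 3 → ℤ) → ℤ := fun l => if h : l ∈ intBox L then q ⟨l, h⟩ else 0
  have hpq : ∀ l : intBox L, p l = q l := fun l => by simp [p]
  have hpP : ∀ l ∈ intBox L, |(p l : ℝ)| ≤ exp (7 * U) := by
    intro l hl
    have h1 := hqP ⟨l, hl⟩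
    rw [← hpq] at h1
    have h2 : |(p l : ℝ)| ≤ P := by exact_mod_cast h1
    exact h2.trans hP2
  have hWbox : ∀ τ τ', τ + τ' ≤ T →
      ∑ l ∈ intBox L, |((p l * (intChoose (x l) τ * intChoose (y l) τ') : ℤ) : ℝ)| ≤
        exp (14 * U) := by
    intro τ τ' hτ
    have h1 : ∀ l ∈ intBox L, |((p l * (intChoose (x l) τ * intChoose (y l) τ') : ℤ) : ℝ)| ≤
        exp (7 * U) * exp (4 * U) := by
      intro l hl
      rw [Int.cast_mul, abs_mul]
      exact mul_le_mul (hpP l hl) (hb l hl _ _ (by omega) (by omega)) (abs_nonneg _)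
        (Real.exp_pos _).le
    refine (Finset.sum_le_sum h1).trans ?_
    rw [Finset.sum_const, card_intBox, nsmul_eq_mul]
    calc _ ≤ exp (3 * U) * (exp (7 * U) * exp (4 * U)) := by gcongr
      _ = _ := by rw [← Real.exp_add, ← Real.exp_add]; ring_nf
  have hzero : ∀ τ τ', τ + τ' ≤ T → ∀ i < s₀,
      ∑ l ∈ intBox L, ((p l * (intChoose (x l) τ * intChoose (y l) τ') : ℤ) : ℝ) *
        (S.mon l : ℝ) ^ (2 * i + 1) = 0 := by
    intro τ τ' hτ i hi
    refine S.sum_root_pow_eq_zero_of_small hK ⊥ (by simp) (intBox L)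
      (fun l => p l * (intChoose (x l) τ * intChoose (y l) τ')) (fun l => algebraMap K _ (S.mon l))
      (fun l => l) (m := 1) one_pos (fun l _ => pow_one _) hL hLH (s := 2 * i + 1) (r := 2 * s₀)
      ?_ (A := exp (14 * U)) (Real.one_le_exp (by linarith)) (hWbox τ τ' hτ) ?_
    · have : 2 * i + 1 ≤ 2 * s₀ := by omega
      rw [Nat.cast_one, mul_one]
      exact_mod_cast this
    · have h1 := hqs (⟨τ, by omega⟩, ⟨τ', by omega⟩, ⟨i, hi⟩)
      refine lt_of_lt_of_le (lt_of_eq_of_lt (congrArg abs ?_) h1) ?_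
      · rw [← Finset.sum_coe_sort]
        refine Finset.sum_congr rfl fun l _ => ?_
        simp only [v]
        rw [← hpq, Int.cast_mul, mul_assoc]
        rfl
      · rw [← Real.exp_add, ← Real.exp_nat_mul, ← Real.exp_neg]
        apply Real.exp_le_exp.2
        push_cast
        linarith
  have hne : ∃ l ∈ intBox L, p l ≠ 0 := by
    obtain ⟨l, hl⟩ := Function.ne_iff.1 hq0
    exact ⟨l, l.2, by rw [hpq]; exact hl⟩
  obtain ⟨l₀, hl₀, hpl₀⟩ := hne
  let B := (intBox L).filter fun l => p l ≠ 0
  have hB : B ⊆ intBox L := Finset.filter_subset _ _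
  have hl₀B : l₀ ∈ B := Finset.mem_filter.2 ⟨hl₀, hpl₀⟩
  refine ⟨p, B, hB, fun l hl => (Finset.mem_filter.1 hl).2, fun τ τ' hτ =>
    (Finset.sum_le_sum_of_subset_of_nonneg hB fun _ _ _ => abs_nonneg _).trans (hWbox τ τ' hτ),
    B, subset_rfl, ⟨l₀, hl₀B⟩, l₀, hl₀B, fun l => S.mon (l - l₀), fun l _ => S.mon_pos _,
    fun l _ => by simp, fun τ τ' hτ i hi => ?_⟩
  have h1 : ∑ l ∈ B, ((p l * (intChoose (x l) τ * intChoose (y l) τ') : ℤ) : ℝ) *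
      (S.mon (l - l₀) : ℝ) ^ (2 * i + 1) =
      (∑ l ∈ intBox L, ((p l * (intChoose (x l) τ * intChoose (y l) τ') : ℤ) : ℝ) *
      (S.mon l : ℝ) ^ (2 * i + 1)) / (S.mon l₀ : ℝ) ^ (2 * i + 1) := by
    rw [Finset.sum_div, ← Finset.sum_subset hB]
    · refine Finset.sum_congr rfl fun l _ => ?_
      rw [mon_sub, mul_div_assoc, ← div_pow]
      rfl
    · intro l hl hlB
      have : p l = 0 := by
        by_contra h
        exact hlB (Finset.mem_filter.2 ⟨hl, h⟩)
      rw [this]; simp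
  rw [h1, hzero τ τ' hτ i hi, zero_div]

end PositiveTriple

namespace PositiveTriple

set_option maxHeartbeats 800000 in
/-- A lower bound for the simultaneous approximation of three logarithms by two fixed real numbers
with integral coefficients. -/
theorem exists_exp_neg_lt_abs_log_sub : ∃ C : ℝ, 0 < C ∧ ∀ (K : IntermediateField ℚ ℝ)
    [FiniteDimensional ℚ K], Module.finrank ℚ K ≤ 4 → (∀ (φ : K →+* ℂ) (x : K), (φ x).im = 0) →
    ∀ S : PositiveTriple K, (∀ n, S.mon n = 1 → n = 0) →
    ∀ (u v : Fin 3 → ℤ) (t t' : ℝ) (s₀ : ℕ), 0 < s₀ →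
      ∑ i, |(u i : ℝ)| / S.h i + 1 ≤ exp s₀ → ∑ i, |(v i : ℝ)| / S.h i + 1 ≤ exp s₀ →
      ∃ i, exp (-(C * (S.h 0 * S.h 1 * S.h 2) * s₀ ^ 2)) <
        |Real.log (S.α i : ℝ) - (u i * t + v i * t')| := by
  set E := exp 1100 with hE
  have hE1101 : 1101 ≤ E := by have := Real.add_one_le_exp (1100 : ℝ); linarith
  have hE0 : 0 < E := by linarith
  refine ⟨(2 * E + 701) * (2 * (10800 * E ^ 3)), by positivity, ?_⟩
  intro K _ hK hreal S hind u v t t' s₀ hs₀ hu hv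
  by_contra! hcon
  have hh : ∀ i, 0 < S.h i := fun i => zero_lt_one.trans_le (S.one_le_h i)
  set Ω := S.h 0 * S.h 1 * S.h 2 with hΩ
  have hΩ1 : 1 ≤ Ω := one_le_mul_of_one_le_of_one_le
    (one_le_mul_of_one_le_of_one_le (S.one_le_h 0) (S.one_le_h 1)) (S.one_le_h 2)
  have hs1 : (1 : ℝ) ≤ s₀ := by exact_mod_cast hs₀
  set X := 10800 * E ^ 3 * Ω * s₀ with hX
  have hE3 : 1 ≤ E ^ 3 := one_le_pow₀ (by linarith)
  have hX1 : 1 ≤ X := by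
    have := one_le_mul_of_one_le_of_one_le (one_le_mul_of_one_le_of_one_le hE3 hΩ1) hs1
    rw [hX]; nlinarith
  obtain ⟨κ', hκ1, hκ2⟩ := exists_nat_pow_near hX1 one_lt_two
  set κ := κ' + 1 with hκ
  set T := 2 ^ κ with hT
  have hTX : X < T := by rw [hT]; exact_mod_cast hκ2
  have hTX' : (T : ℝ) ≤ 2 * X := by
    rw [hT, hκ, pow_succ]; push_cast; linarith
  have hT0 : 0 < T := by positivity
  have hT1 : (1 : ℝ) ≤ T := by exact_mod_cast hT0
  set U : ℝ := T * s₀ with hU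
  have hU1 : 1 ≤ U := one_le_mul_of_one_le_of_one_le hT1 hs1
  let L : Fin 3 → ℕ := fun i => ⌊(T : ℝ) / (3 * E * S.h i)⌋₊
  have hLle : ∀ i, (L i : ℝ) ≤ T / (3 * E * S.h i) := fun i =>
    Nat.floor_le (by have := hh i; positivity)
  have hLlt : ∀ i, (T : ℝ) / (3 * E * S.h i) < L i + 1 := fun i => Nat.lt_floor_add_one _
  set H : ℝ := T / E with hH
  have hH0 : 0 ≤ H := by positivity
  have hLh : ∀ i, L i * S.h i ≤ H / 3 := by
    intro i
    calc L i * S.h i ≤ T / (3 * E * S.h i) * S.h i := by gcongr; exact (hh i).le; exact hLle i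
      _ = H / 3 := by have := (hh i).ne'; rw [hH]; field_simp
  have hLH : ∑ j, L j * S.h j ≤ H := by
    refine (Finset.sum_le_sum fun i _ => hLh i).trans (le_of_eq ?_)
    simp; ring
  have hHU : H * exp 1100 * s₀ ≤ U := by
    rw [hH, ← hE, div_mul_cancel₀ _ hE0.ne']
  have hLsum : ∀ i, (L i : ℝ) ≤ H / 3 := fun i =>
    (le_mul_of_one_le_right (Nat.cast_nonneg _) (S.one_le_h i)).trans (hLh i)
  have hH3 : H / 3 ≤ T := by
    rw [hH, div_div, div_le_iff₀ (by positivity)]; nlinarith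
  have hform : ∀ w : Fin 3 → ℤ, ∑ i, |(w i : ℝ)| / S.h i + 1 ≤ exp s₀ → ∀ l ∈ intBox L,
      |((∑ i, w i * l i : ℤ) : ℝ)| + T ≤ T * exp s₀ := by
    intro w hw l hl
    have h1 : |((∑ i, w i * l i : ℤ) : ℝ)| ≤ T * ∑ i, |(w i : ℝ)| / S.h i := by
      push_cast
      rw [Finset.mul_sum]
      refine (Finset.abs_sum_le_sum_abs _ _).trans (Finset.sum_le_sum fun i _ => ?_)
      rw [abs_mul]
      have h2 := mem_intBox.1 hl i
      have h3 : |(l i : ℝ)| ≤ T / (3 * E * S.h i) := by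
        have h4 : (0 : ℝ) ≤ l i := by exact_mod_cast h2.1
        have h5 : (l i : ℝ) ≤ L i := by exact_mod_cast h2.2
        rw [abs_of_nonneg h4]
        exact h5.trans (hLle i)
      calc |(w i : ℝ)| * |(l i : ℝ)| ≤ |(w i : ℝ)| * (T / (1 * S.h i)) := by
            refine mul_le_mul_of_nonneg_left (h3.trans ?_) (abs_nonneg _)
            have := hh i
            gcongr
            linarith
        _ = _ := by rw [one_mul]; ring
    nlinarith
  have hNlow : 100 * (s₀ * (T + 1) ^ 2) ≤ ∏ i, (L i + 1) := by
    have h1 : (T : ℝ) / (3 * E * S.h 0) * (T / (3 * E * S.h 1)) * (T / (3 * E * S.h 2)) ≤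
        (L 0 + 1) * (L 1 + 1) * (L 2 + 1) := by
      have h0 := hh 0
      have h1 := hh 1
      have h2 := hh 2
      gcongr
      exacts [(hLlt 0).le, (hLlt 1).le, (hLlt 2).le]
    have h2 : (T : ℝ) / (3 * E * S.h 0) * (T / (3 * E * S.h 1)) * (T / (3 * E * S.h 2)) =
        T ^ 3 / (27 * E ^ 3 * Ω) := by
      have h0 := (hh 0).ne'
      have h1 := (hh 1).ne'
      have h2 := (hh 2).ne'
      rw [hΩ]; field_simp; norm_num
    have h3 : 400 * s₀ * (T : ℝ) ^ 2 ≤ T ^ 3 / (27 * E ^ 3 * Ω) := by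
      rw [le_div_iff₀ (by positivity)]
      calc 400 * (s₀ : ℝ) * (T : ℝ) ^ 2 * (27 * E ^ 3 * Ω) = X * (T : ℝ) ^ 2 := by rw [hX]; ring
        _ ≤ T * (T : ℝ) ^ 2 := by gcongr
        _ = _ := by ring
    have h4 : (100 * (s₀ * (T + 1) ^ 2) : ℝ) ≤ (L 0 + 1) * (L 1 + 1) * (L 2 + 1) := by
      refine le_trans ?_ (h3.trans (h2 ▸ h1))
      have h5 : ((T : ℝ) + 1) ^ 2 ≤ 4 * T ^ 2 := by nlinarith
      nlinarith
    rw [Fin.prod_univ_three]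
    exact_mod_cast h4
  have hNup : ((∏ i, (L i + 1) : ℕ) : ℝ) ≤ exp (3 * U) := by
    push_cast
    have hTU : (T : ℝ) ≤ U := le_mul_of_one_le_right (by positivity) hs1
    calc ∏ i, ((L i : ℝ) + 1) ≤ ∏ _i : Fin 3, exp U := by
          refine Finset.prod_le_prod (fun _ _ => by positivity) fun i _ => ?_
          have := Real.add_one_le_exp U
          have := hLsum i
          linarith
      _ = exp (3 * U) := by
          rw [Finset.prod_const, Finset.card_univ, Fintype.card_fin, ← Real.exp_nat_mul]; norm_num
  obtain ⟨p, B, hB, hp, hW, hvan⟩ := S.exists_vanishes hK (x := fun l => ∑ i, u i * l i)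
    (y := fun l => ∑ i, v i * l i) hs₀ hT0 hU hLH hHU (hform u hu) (hform v hv) hNlow hNup
  set ε₀ := exp (-((2 * E + 701) * (2 * (10800 * E ^ 3)) * Ω * s₀ ^ 2)) with hε₀
  have hε₀U : ε₀ ≤ exp (-((2 * E + 701) * U)) := by
    apply Real.exp_le_exp.2
    have : U ≤ 2 * (10800 * E ^ 3) * Ω * s₀ ^ 2 := by
      calc U ≤ 2 * X * s₀ := by rw [hU]; gcongr
        _ = _ := by rw [hX]; ring
    rw [neg_le_neg_iff]
    calc (2 * E + 701) * U ≤ (2 * E + 701) * (2 * (10800 * E ^ 3) * Ω * s₀ ^ 2) := by gcongr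
      _ = _ := by ring
  have hHU' : H ≤ U := by
    have : H ≤ T := div_le_self (by positivity) (by linarith)
    exact this.trans (le_mul_of_one_le_right (by positivity) hs1)
  refine S.not_vanishes hK (x := fun l => ∑ i, u i * l i) (y := fun l => ∑ i, v i * l i) (L := L)
    (fun l hl l₀ hl₀ => abs_sub_le_of_mem_intBox (hB hl) (hB hl₀)) (t := t) (t' := t')
    (ε := H * ε₀) ?_ (fun l hl l₀ hl₀ => S.abs_log_mon_le
    (abs_sub_le_of_mem_intBox (hB hl) (hB hl₀)) hLH) hLH hs₀ hU1 hHU (by positivity) ?_ ?_ hreal hind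
    (κ := κ) (by rw [hU, hT]; push_cast; rfl) hW hp hvan
  · intro l hl l₀ hl₀
    have h1 : t * (((∑ i, u i * l i : ℤ) : ℝ) - ((∑ i, u i * l₀ i : ℤ) : ℝ)) +
        t' * (((∑ i, v i * l i : ℤ) : ℝ) - ((∑ i, v i * l₀ i : ℤ) : ℝ)) -
        Real.log (S.mon (l - l₀) : ℝ) =
        -∑ i, ((l - l₀) i : ℝ) * (Real.log (S.α i : ℝ) - (u i * t + v i * t')) := by
      rw [S.log_mon]
      simp only [Fin.sum_univ_three, Pi.sub_apply]
      push_cast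
      ring
    rw [h1, abs_neg]
    refine (Finset.abs_sum_le_sum_abs _ _).trans ?_
    calc ∑ i, |((l - l₀) i : ℝ) * (Real.log (S.α i : ℝ) - (u i * t + v i * t'))|
        ≤ ∑ _i : Fin 3, H / 3 * ε₀ := by
          refine Finset.sum_le_sum fun i _ => ?_
          rw [abs_mul]
          have h2 : |((l - l₀) i : ℝ)| ≤ L i := by
            exact_mod_cast abs_sub_le_of_mem_intBox (hB hl) (hB hl₀) i
          exact mul_le_mul (h2.trans (hLsum i)) (hcon i) (abs_nonneg _) (by positivity)
      _ = H * ε₀ := by simp; ring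
  · refine mul_le_of_le_one_right hH0 ?_
    rw [hε₀, Real.exp_le_one_iff, neg_nonpos]
    positivity
  · calc H * ε₀ ≤ exp U * exp (-((2 * E + 701) * U)) := by
          gcongr
          exact hHU'.trans (by linarith [Real.add_one_le_exp U])
      _ = _ := by rw [← Real.exp_add, hE]; ring_nf

end PositiveTriple

/-- If `r₀² ≡ k (mod n)` with `k` squarefree, then any divisor of `n` whose square divides `n` and
which divides `2 r₀` is at most `2`. -/
lemma dvd_two_of_sq_dvd {k : ℕ} (hk : Squarefree k) {t : ℕ} {r : ℤ} (h1 : (t : ℤ) ∣ 2 * r)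
    (h2 : (t : ℤ) ^ 2 ∣ r ^ 2 - k) : t ∣ 2 := by
  have h3 : (t : ℤ) ^ 2 ∣ 4 * k := by
    have h4 : (t : ℤ) ^ 2 ∣ (2 * r) ^ 2 := pow_dvd_pow_of_dvd h1 2
    have h5 : (4 * k : ℤ) = (2 * r) ^ 2 - 4 * (r ^ 2 - k) := by ring
    rw [h5]
    exact dvd_sub h4 (h2.mul_left 4)
  have h4 : t ^ 2 ∣ 4 * k := by exact_mod_cast h3
  have hodd : ∀ m : ℕ, Odd m → m ∣ t → m = 1 := by
    intro m hm hmt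
    have h5 : m ^ 2 ∣ 4 * k := (pow_dvd_pow_of_dvd hmt 2).trans h4
    have h6 : Nat.Coprime (m ^ 2) 4 := by
      have : Nat.Coprime m 2 := (Nat.coprime_two_right).2 hm
      exact (Nat.Coprime.pow 2 2 this : Nat.Coprime (m ^ 2) (2 ^ 2))
    have h7 : m * m ∣ k := by rw [← sq]; exact h6.dvd_of_dvd_mul_left h5
    exact Nat.isUnit_iff.1 (hk m h7)
  have ht0 : t ≠ 0 := by
    rintro rfl
    have : k = 0 := by simpa using h4
    exact hk.ne_zero this
  obtain ⟨e, m, hm, rfl⟩ := Nat.exists_eq_two_pow_mul_odd ht0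
  have hm1 := hodd m hm (dvd_mul_left _ _)
  subst hm1
  rw [mul_one] at h4 ⊢
  rcases Nat.lt_or_ge e 2 with he | he
  · exact (Nat.pow_dvd_pow 2 (Nat.lt_succ_iff.1 he)).trans (by simp)
  · exfalso
    have h5 : (2 ^ 2) ^ 2 ∣ 4 * k := (pow_dvd_pow_of_dvd (Nat.pow_dvd_pow 2 he) 2).trans h4
    have h6 : 2 * 2 ∣ k := by
      have : 4 * 4 ∣ 4 * k := by simpa using h5
      exact Nat.dvd_of_mul_dvd_mul_left (by norm_num) this
    exact absurd (Nat.isUnit_iff.1 (hk 2 h6)) (by norm_num)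

/-- The number of square roots of a squarefree number modulo `n` is at most `2 d(n)`. -/
lemma card_sqrt_mod_le {k : ℕ} (hk : Squarefree k) {n : ℕ} (hn : 0 < n) :
    ((Finset.range n).filter fun r : ℕ => (n : ℤ) ∣ (r : ℤ) ^ 2 - k).card ≤ 2 * n.divisors.card := by
  classical
  set R := (Finset.range n).filter fun r : ℕ => (n : ℤ) ∣ (r : ℤ) ^ 2 - k with hR
  rcases R.eq_empty_or_nonempty with h | ⟨r₀, hr₀⟩
  · simp [h]
  have hmem : ∀ r ∈ R, r < n ∧ (n : ℤ) ∣ (r : ℤ) ^ 2 - k := by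
    intro r hr
    simpa [hR] using hr
  have himg : R.image (fun r : ℕ => Int.gcd ((r : ℤ) - r₀) n) ⊆ n.divisors := by
    intro d hd
    obtain ⟨r, -, rfl⟩ := Finset.mem_image.1 hd
    rw [Nat.mem_divisors]
    exact ⟨by exact_mod_cast Int.gcd_dvd_right ((r : ℤ) - r₀) n, hn.ne'⟩
  refine (Finset.card_le_mul_card_image (f := fun r : ℕ => Int.gcd ((r : ℤ) - r₀) n) R 2 ?_).trans
    (Nat.mul_le_mul_left 2 (Finset.card_le_card himg))
  intro d hd
  have hdn : d ∣ n := (Nat.mem_divisors.1 (himg hd)).1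
  obtain ⟨m, hm⟩ := hdn
  have hd0 : 0 < d := Nat.pos_of_ne_zero (by rintro rfl; simp at hm; omega)
  have hfib : ∀ r ∈ R, Int.gcd ((r : ℤ) - r₀) n = d → (d : ℤ) ∣ r - r₀ ∧ (m : ℤ) ∣ r + r₀ := by
    intro r hr hrd
    have h1 : (d : ℤ) ∣ r - r₀ := by rw [← hrd]; exact Int.gcd_dvd_left _ _
    refine ⟨h1, ?_⟩
    have h2 : (n : ℤ) ∣ (r - r₀) * (r + r₀) := by
      have h3 : ((r : ℤ) - r₀) * (r + r₀) = (r ^ 2 - k) - (r₀ ^ 2 - k) := by ring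
      rw [h3]
      exact dvd_sub (hmem r hr).2 (hmem r₀ hr₀).2
    obtain ⟨q, hq⟩ := h1
    have hcop : IsCoprime (m : ℤ) q := by
      rw [Int.isCoprime_iff_gcd_eq_one]
      have h4 : Int.gcd ((d : ℤ) * q) (d * m) = d * Int.gcd q m := by
        rw [Int.gcd_mul_left]; simp
      rw [hq, hm] at hrd
      push_cast at hrd
      rw [h4] at hrd
      have := Nat.eq_of_mul_eq_mul_left hd0 (hrd.trans (mul_one d).symm)
      rw [Int.gcd_comm]; exact this
    rw [hq, hm] at h2
    push_cast at h2
    rw [mul_assoc] at h2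
    exact hcop.dvd_of_dvd_mul_left (Int.dvd_of_mul_dvd_mul_left (by exact_mod_cast hd0.ne') h2)
  by_contra! hlt
  obtain ⟨r₁, h1, r₂, h2, r₃, h3, h12, h13, h23⟩ := Finset.two_lt_card.1 hlt
  rw [Finset.mem_filter] at h1 h2 h3
  have hpair : ∀ r ∈ R, Int.gcd ((r : ℤ) - r₀) n = d → ∀ s ∈ R, Int.gcd ((s : ℤ) - r₀) n = d →
      (n : ℤ) ∣ 2 * (r - s) := by
    intro r hr hrd s hs hsd
    obtain ⟨hr1, hr2⟩ := hfib r hr hrd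
    obtain ⟨hs1, hs2⟩ := hfib s hs hsd
    have ht : Nat.gcd d m ∣ 2 := by
      apply dvd_two_of_sq_dvd hk (r := r₀)
      · have h4 : ((Nat.gcd d m : ℕ) : ℤ) ∣ r - r₀ :=
          (Int.natCast_dvd_natCast.2 (Nat.gcd_dvd_left d m)).trans hr1
        have h5 : ((Nat.gcd d m : ℕ) : ℤ) ∣ r + r₀ :=
          (Int.natCast_dvd_natCast.2 (Nat.gcd_dvd_right d m)).trans hr2
        have h6 : (2 * r₀ : ℤ) = (r + r₀) - (r - r₀) := by ring
        rw [h6]; exact dvd_sub h5 h4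
      · refine dvd_trans ?_ (hmem r₀ hr₀).2
        have h4 : Nat.gcd d m ^ 2 ∣ n := by
          rw [hm, sq]; exact mul_dvd_mul (Nat.gcd_dvd_left d m) (Nat.gcd_dvd_right d m)
        exact_mod_cast h4
    have hl1 : (d : ℤ) ∣ r - s := by
      have : (r - s : ℤ) = (r - r₀) - (s - r₀) := by ring
      rw [this]; exact dvd_sub hr1 hs1
    have hl2 : (m : ℤ) ∣ r - s := by
      have : (r - s : ℤ) = (r + r₀) - (s + r₀) := by ring
      rw [this]; exact dvd_sub hr2 hs2
    have hl : ((Nat.lcm d m : ℕ) : ℤ) ∣ r - s := by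
      rw [Int.natCast_dvd] at hl1 hl2 ⊢
      exact Nat.lcm_dvd hl1 hl2
    have hn2 : (n : ℤ) = Nat.gcd d m * Nat.lcm d m := by
      have := Nat.gcd_mul_lcm d m
      rw [hm]; exact_mod_cast this.symm
    rw [hn2]
    exact mul_dvd_mul (by exact_mod_cast ht) hl
  have hval : ∀ r ∈ R, Int.gcd ((r : ℤ) - r₀) n = d → ∀ s ∈ R, Int.gcd ((s : ℤ) - r₀) n = d →
      r < s → 2 * s = 2 * r + n := by
    intro r hr hrd s hs hsd hrs
    obtain ⟨q, hq⟩ := hpair s hs hsd r hr hrd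
    have hsn := (hmem s hs).1
    have hq1 : 0 < q := by
      by_contra hq0
      have : (n : ℤ) * q ≤ 0 := mul_nonpos_of_nonneg_of_nonpos (by positivity) (by omega)
      omega
    have hq2 : q < 2 := by
      by_contra hq0
      have : (n : ℤ) * 2 ≤ n * q := mul_le_mul_of_nonneg_left (by omega) (by positivity)
      omega
    have : q = 1 := by omega
    subst this
    omega
  have e12 := hval r₁ h1.1 h1.2 r₂ h2.1 h2.2
  have e21 := hval r₂ h2.1 h2.2 r₁ h1.1 h1.2
  have e13 := hval r₁ h1.1 h1.2 r₃ h3.1 h3.2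
  have e31 := hval r₃ h3.1 h3.2 r₁ h1.1 h1.2
  have e23 := hval r₂ h2.1 h2.2 r₃ h3.1 h3.2
  have e32 := hval r₃ h3.1 h3.2 r₂ h2.1 h2.2
  omega

lemma sum_one_div_sqrt_le (n : ℕ) : ∑ b ∈ Finset.Icc 1 n, 1 / √(b : ℝ) ≤ 2 * √(n : ℝ) := by
  induction n with
  | zero => simp
  | succ n ih =>
    rw [Finset.sum_Icc_succ_top (by omega)]
    have h1 : 0 < √((n + 1 : ℕ) : ℝ) := Real.sqrt_pos.2 (by positivity)
    have h2 : √((n + 1 : ℕ) : ℝ) ^ 2 = n + 1 := by rw [Real.sq_sqrt (by positivity)]; push_cast; ring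
    have h3 : √(n : ℝ) ^ 2 = n := Real.sq_sqrt (by positivity)
    have h4 : 1 / √((n + 1 : ℕ) : ℝ) ≤ 2 * √((n + 1 : ℕ) : ℝ) - 2 * √(n : ℝ) := by
      rw [div_le_iff₀ h1]
      nlinarith [sq_nonneg (√((n + 1 : ℕ) : ℝ) - √(n : ℝ))]
    linarith

lemma sum_card_divisors_div_sqrt_le (n : ℕ) :
    ∑ m ∈ Finset.Icc 1 n, (m.divisors.card : ℝ) / √(m : ℝ) ≤ 2 * √(n : ℝ) * (1 + Real.log n) := by
  classical
  have h1 : ∀ m ∈ Finset.Icc 1 n, (m.divisors.card : ℝ) / √(m : ℝ) =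
      ∑ a ∈ Finset.Icc 1 n, if a ∣ m then 1 / √(m : ℝ) else 0 := by
    intro m hm
    rw [Finset.mem_Icc] at hm
    rw [← Finset.sum_filter, Finset.sum_const, nsmul_eq_mul, mul_one_div]
    congr 2
    refine congrArg Finset.card (Finset.ext fun a => ?_)
    rw [Nat.mem_divisors, Finset.mem_filter, Finset.mem_Icc]
    constructor
    · rintro ⟨h, h0⟩
      exact ⟨⟨Nat.pos_of_dvd_of_pos h (by omega), (Nat.le_of_dvd (by omega) h).trans hm.2⟩, h⟩
    · rintro ⟨-, h⟩
      exact ⟨h, by omega⟩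
  rw [Finset.sum_congr rfl h1, Finset.sum_comm]
  have h2 : ∀ a ∈ Finset.Icc 1 n, (∑ m ∈ Finset.Icc 1 n, if a ∣ m then 1 / √(m : ℝ) else 0) ≤
      2 * √(n : ℝ) * (a : ℝ)⁻¹ := by
    intro a ha
    rw [Finset.mem_Icc] at ha
    have ha0 : (0 : ℝ) < a := by exact_mod_cast ha.1
    have hsa : 0 < √(a : ℝ) := Real.sqrt_pos.2 ha0
    have h3 : (∑ m ∈ Finset.Icc 1 n, if a ∣ m then 1 / √(m : ℝ) else 0) =
        ∑ b ∈ Finset.Icc 1 (n / a), 1 / √((a * b : ℕ) : ℝ) := by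
      rw [← Finset.sum_filter]
      symm
      refine Finset.sum_bij (fun b _ => a * b) ?_ ?_ ?_ ?_
      · intro b hb
        rw [Finset.mem_Icc] at hb
        rw [Finset.mem_filter, Finset.mem_Icc]
        exact ⟨⟨Nat.mul_pos ha.1 hb.1, (Nat.mul_le_mul_left a hb.2).trans (Nat.mul_div_le n a)⟩,
          dvd_mul_right _ _⟩
      · intro b _ b' _ h
        exact Nat.eq_of_mul_eq_mul_left ha.1 h
      · intro m hm
        rw [Finset.mem_filter, Finset.mem_Icc] at hm
        obtain ⟨⟨hm1, hm2⟩, b, rfl⟩ := hm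
        refine ⟨b, ?_, rfl⟩
        rw [Finset.mem_Icc]
        exact ⟨Nat.pos_of_ne_zero (by rintro rfl; simp at hm1),
          (Nat.le_div_iff_mul_le ha.1).2 (by rw [mul_comm]; exact hm2)⟩
      · intros; rfl
    rw [h3]
    have h4 : ∀ b ∈ Finset.Icc 1 (n / a), 1 / √((a * b : ℕ) : ℝ) = 1 / √(a : ℝ) * (1 / √(b : ℝ)) := by
      intro b _
      push_cast
      rw [Real.sqrt_mul ha0.le, one_div_mul_one_div]
    rw [Finset.sum_congr rfl h4, ← Finset.mul_sum]
    have h5 : √((n / a : ℕ) : ℝ) ≤ √(n : ℝ) / √(a : ℝ) := by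
      rw [← Real.sqrt_div' _ ha0.le]
      exact Real.sqrt_le_sqrt Nat.cast_div_le
    calc 1 / √(a : ℝ) * ∑ b ∈ Finset.Icc 1 (n / a), 1 / √(b : ℝ)
        ≤ 1 / √(a : ℝ) * (2 * (√(n : ℝ) / √(a : ℝ))) := by
          gcongr
          exact (sum_one_div_sqrt_le _).trans (by linarith)
      _ = 2 * √(n : ℝ) * (√(a : ℝ) * √(a : ℝ))⁻¹ := by field_simp
      _ = _ := by rw [Real.mul_self_sqrt ha0.le]
  refine (Finset.sum_le_sum h2).trans ?_
  rw [← Finset.mul_sum]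
  have h3 := harmonic_le_one_add_log n
  rw [harmonic_eq_sum_Icc] at h3
  push_cast at h3
  gcongr

lemma Squarefree.irrational_sqrt {k : ℕ} (hk : Squarefree k) (h1 : 1 < k) : Irrational √(k : ℝ) := by
  rw [irrational_sqrt_natCast_iff]
  rintro ⟨r, rfl⟩
  have := Nat.isUnit_iff.1 (hk r dvd_rfl)
  subst this
  omega

/-- Good primitive approximations to `√k`. -/
lemma exists_coprime_approx {k : ℕ} (hk : Squarefree k) (h1 : 1 < k) (j : ℕ) :
    ∃ x y : ℤ, IsCoprime x y ∧ x ^ 2 - k * y ^ 2 ≠ 0 ∧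
      2 ^ j * |((x ^ 2 - k * y ^ 2 : ℤ) : ℝ)| < x + y * √(k : ℝ) ∧
      x + y * √(k : ℝ) ≤ 2 ^ j * (3 * √(k : ℝ)) := by
  have hs1 : 1 ≤ √(k : ℝ) := by
    rw [Real.one_le_sqrt]; exact_mod_cast h1.le
  have hs2 : √(k : ℝ) ^ 2 = k := Real.sq_sqrt (Nat.cast_nonneg k)
  set s := √(k : ℝ) with hs
  obtain ⟨X, Y, hY0, hY, hXY⟩ := Real.exists_int_int_abs_mul_sub_le s (n := 2 ^ j) (by positivity)
  obtain ⟨g, x, y, hg, hcop, hX', hY'⟩ := Int.exists_gcd_one' (m := X) (n := Y)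
    (Int.gcd_pos_of_ne_zero_right _ hY0.ne')
  have hg1 : (1 : ℤ) ≤ g := by exact_mod_cast hg
  have hy0 : 0 < y := by
    rw [hY'] at hY0
    exact pos_of_mul_pos_left hY0 (by omega)
  have hyj : y ≤ 2 ^ j := by
    push_cast at hY
    nlinarith
  have hyR : (1 : ℝ) ≤ y := by exact_mod_cast hy0
  have hyR' : (y : ℝ) ≤ 2 ^ j := by exact_mod_cast hyj
  have hP : (1 : ℝ) ≤ 2 ^ j := one_le_pow₀ (by norm_num)
  have happ : |y * s - x| * 2 ^ j < 1 := by
    have h2 : |Y * s - X| = |y * s - x| * g := by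
      rw [hX', hY']
      push_cast
      rw [← abs_of_nonneg (Nat.cast_nonneg g : (0 : ℝ) ≤ g), ← abs_mul,
        abs_of_nonneg (Nat.cast_nonneg g : (0 : ℝ) ≤ g)]
      congr 1; ring
    rw [h2, le_div_iff₀ (by positivity)] at hXY
    push_cast at hXY
    have hgR : (1 : ℝ) ≤ g := by exact_mod_cast hg
    have h3 : |y * s - x| * (2 ^ j + 1) ≤ 1 := by
      refine le_trans ?_ hXY
      rw [mul_assoc]
      gcongr
      nlinarith
    rcases eq_or_lt_of_le (abs_nonneg (y * s - x)) with h4 | h4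
    · rw [← h4]; simp
    · nlinarith
  have happ' : |y * s - x| < 1 := by nlinarith [abs_nonneg (y * s - x)]
  obtain ⟨h5, h6⟩ := abs_lt.1 happ'
  have hxpos : 0 < (x : ℝ) := by nlinarith
  have hn : ((x ^ 2 - k * y ^ 2 : ℤ) : ℝ) = (x - y * s) * (x + y * s) := by
    push_cast
    linear_combination (y : ℝ) ^ 2 * hs2
  have hξ : 0 < x + y * s := by positivity
  refine ⟨x, y, Int.isCoprime_iff_gcd_eq_one.2 hcop, ?_, ?_, ?_⟩
  · intro h0
    rw [h0, Int.cast_zero] at hn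
    have h7 : x - y * s = 0 := by
      rcases mul_eq_zero.1 hn.symm with h | h
      · exact h
      · exact absurd h hξ.ne'
    have hirr := hk.irrational_sqrt h1
    apply hirr
    refine ⟨(x : ℚ) / y, ?_⟩
    push_cast
    rw [div_eq_iff (by positivity)]
    linarith
  · rw [hn, abs_mul, abs_of_pos hξ, abs_sub_comm]
    calc 2 ^ j * (|y * s - x| * (x + y * s)) = |y * s - x| * 2 ^ j * (x + y * s) := by ring
      _ < 1 * (x + y * s) := by gcongr
      _ = _ := one_mul _
  · nlinarith

/-- Two approximations in the same residue class give a unit. -/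
lemma exists_unit_of_class {k : ℕ} {x y x' y' n r : ℤ} (hn : x ^ 2 - k * y ^ 2 = n)
    (hn' : x' ^ 2 - k * y' ^ 2 = n) (hn0 : n ≠ 0) (hr : n ∣ r ^ 2 - k) (h1 : n ∣ r * y - x)
    (h2 : n ∣ r * y' - x') (hξ : 0 < x + y * √(k : ℝ)) :
    ∃ X Y : ℤ, X ^ 2 - k * Y ^ 2 = 1 ∧ X + Y * √(k : ℝ) = (x' + y' * √(k : ℝ)) / (x + y * √(k : ℝ)) := by
  have hs2 : √(k : ℝ) ^ 2 = k := Real.sq_sqrt (Nat.cast_nonneg k)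
  obtain ⟨q, hq⟩ := hr
  obtain ⟨q1, hq1⟩ := h1
  obtain ⟨q2, hq2⟩ := h2
  obtain ⟨X, hX⟩ : n ∣ x' * x - k * y * y' := by
    refine ⟨y * y' * q - q2 * r * y - q1 * r * y' + n * q1 * q2, ?_⟩
    have hx : x = r * y - n * q1 := by linarith
    have hx' : x' = r * y' - n * q2 := by linarith
    rw [hx, hx']
    linear_combination y * y' * hq
  obtain ⟨Y, hY⟩ : n ∣ y' * x - x' * y := by
    refine ⟨q2 * y - q1 * y', ?_⟩
    linear_combination y * hq2 - y' * hq1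
  refine ⟨X, Y, ?_, ?_⟩
  · have : n ^ 2 * (X ^ 2 - k * Y ^ 2) = n ^ 2 * 1 := by
      have e1 : n ^ 2 * (X ^ 2 - k * Y ^ 2) = (n * X) ^ 2 - k * (n * Y) ^ 2 := by ring
      rw [e1, ← hX, ← hY]
      have e2 : (x' * x - k * y * y') ^ 2 - k * (y' * x - x' * y) ^ 2 =
        (x ^ 2 - k * y ^ 2) * (x' ^ 2 - k * y' ^ 2) := by ring
      rw [e2, hn, hn']; ring
    exact mul_left_cancel₀ (pow_ne_zero 2 hn0) this
  · rw [eq_div_iff hξ.ne']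
    have hnR : (n : ℝ) ≠ 0 := by exact_mod_cast hn0
    apply mul_left_cancel₀ hnR
    have eX : (n : ℝ) * X = x' * x - k * y * y' := by exact_mod_cast hX.symm
    have eY : (n : ℝ) * Y = y' * x - x' * y := by exact_mod_cast hY.symm
    have en : (n : ℝ) = x ^ 2 - k * y ^ 2 := by exact_mod_cast hn.symm
    calc (n : ℝ) * ((X + Y * √(k : ℝ)) * (x + y * √(k : ℝ)))
        = (n * X + n * Y * √(k : ℝ)) * (x + y * √(k : ℝ)) := by ring
      _ = (x' * x - k * y * y' + (y' * x - x' * y) * √(k : ℝ)) * (x + y * √(k : ℝ)) := by rw [eX, eY]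
      _ = (x ^ 2 - k * y ^ 2) * (x' + y' * √(k : ℝ)) := by
        linear_combination (y * (y' * x - x' * y) : ℝ) * hs2
      _ = _ := by rw [en]

lemma one_add_natLog_le {u : ℝ} (hu : 1 ≤ u) : (1 + Nat.log 2 ⌊u⌋₊ : ℝ) ≤ 3 * √u := by
  have hfl : ⌊u⌋₊ ≠ 0 := (Nat.floor_pos.2 hu).ne'
  set i := Nat.log 2 ⌊u⌋₊ with hi
  have h1 : (2 : ℝ) ^ i ≤ u := by
    have h2 : 2 ^ i ≤ ⌊u⌋₊ := Nat.pow_log_le_self 2 hfl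
    have h3 : ((2 ^ i : ℕ) : ℝ) ≤ ⌊u⌋₊ := by exact_mod_cast h2
    push_cast at h3
    exact h3.trans (Nat.floor_le (by linarith))
  have h2 : ∀ n : ℕ, (1 + n : ℝ) ^ 2 ≤ 9 * 2 ^ n := by
    intro n
    induction n with
    | zero => norm_num
    | succ n ih =>
      rcases Nat.lt_or_ge n 2 with h | h
      · interval_cases n <;> norm_num
      · have : (2 : ℝ) ≤ n := by exact_mod_cast h
        have h3 : (2 : ℝ) ^ (n + 1) = 2 * 2 ^ n := pow_succ' 2 n
        rw [h3]; push_cast; nlinarith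
  have h3 : 0 ≤ √u := Real.sqrt_nonneg _
  have h4 : √u ^ 2 = u := Real.sq_sqrt (by linarith)
  refine abs_le_of_sq_le_sq' ?_ (by positivity) |>.2
  nlinarith [h2 i]

lemma sum_class_card_le {k : ℕ} (hk : Squarefree k) (h1 : 1 < k) :
    ∑ m ∈ Finset.Icc 1 ⌊3 * √(k : ℝ)⌋₊,
      ((((Finset.range m).filter fun r : ℕ => (m : ℤ) ∣ (r : ℤ) ^ 2 - k).card : ℝ) *
        (1 + Nat.log 2 ⌊3 * √(k : ℝ) / m⌋₊)) ≤ 144 * (√(k : ℝ) * Real.log k) := by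
  have hs1 : 1 ≤ √(k : ℝ) := by
    rw [Real.one_le_sqrt]; exact_mod_cast h1.le
  have hk2 : (2 : ℝ) ≤ k := by exact_mod_cast h1
  set Y := 3 * √(k : ℝ) with hY
  have hY3 : 3 ≤ Y := by linarith
  have h2 : ∀ m ∈ Finset.Icc 1 ⌊Y⌋₊,
      ((((Finset.range m).filter fun r : ℕ => (m : ℤ) ∣ (r : ℤ) ^ 2 - k).card : ℝ) *
        (1 + Nat.log 2 ⌊Y / m⌋₊)) ≤ 6 * √Y * ((m.divisors.card : ℝ) / √(m : ℝ)) := by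
    intro m hm
    rw [Finset.mem_Icc] at hm
    have hm0 : (0 : ℝ) < m := by exact_mod_cast hm.1
    have hmY : (m : ℝ) ≤ Y := (Nat.le_floor_iff (by linarith)).1 hm.2
    have h3 := card_sqrt_mod_le hk hm.1
    have h4 := one_add_natLog_le ((one_le_div hm0).2 hmY)
    rw [Real.sqrt_div' _ hm0.le] at h4
    have h5 : (((Finset.range m).filter fun r : ℕ => (m : ℤ) ∣ (r : ℤ) ^ 2 - k).card : ℝ) ≤
        2 * m.divisors.card := by exact_mod_cast h3
    calc _ ≤ 2 * (m.divisors.card : ℝ) * (3 * (√Y / √(m : ℝ))) := by gcongr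
      _ = _ := by ring
  refine (Finset.sum_le_sum h2).trans ?_
  rw [← Finset.mul_sum]
  have h6 := sum_card_divisors_div_sqrt_le ⌊Y⌋₊
  have hfl : (⌊Y⌋₊ : ℝ) ≤ Y := Nat.floor_le (by linarith)
  have hfl1 : (1 : ℝ) ≤ ⌊Y⌋₊ := by
    exact_mod_cast Nat.floor_pos.2 (by linarith : (1 : ℝ) ≤ Y)
  have hl2 := Real.log_two_gt_d9
  have hlk : Real.log 2 ≤ Real.log k := Real.log_le_log (by norm_num) hk2
  have hl3 : Real.log 3 ≤ 2 * Real.log 2 := by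
    rw [← Real.log_rpow (by norm_num)]
    exact Real.log_le_log (by norm_num) (by norm_num)
  have hlY : Real.log Y = Real.log 3 + Real.log k / 2 := by
    rw [hY, Real.log_mul (by norm_num) (by positivity), Real.log_sqrt (by positivity)]
  have hlog : 1 + Real.log ⌊Y⌋₊ ≤ 4 * Real.log k := by
    have : Real.log ⌊Y⌋₊ ≤ Real.log Y := Real.log_le_log (by linarith) hfl
    linarith
  have hsY : √Y * √Y = Y := Real.mul_self_sqrt (by linarith)
  have hL0 : 0 ≤ Real.log ⌊Y⌋₊ := Real.log_nonneg hfl1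
  calc 6 * √Y * ∑ m ∈ Finset.Icc 1 ⌊Y⌋₊, (m.divisors.card : ℝ) / √(m : ℝ)
      ≤ 6 * √Y * (2 * √(⌊Y⌋₊ : ℝ) * (1 + Real.log ⌊Y⌋₊)) := by gcongr
    _ ≤ 6 * √Y * (2 * √Y * (4 * Real.log k)) := by gcongr
    _ = 48 * (√Y * √Y) * Real.log k := by ring
    _ = _ := by rw [hsY, hY]; ring

/-- The Pell equation has a nontrivial solution of logarithmic size `O(√k log k)`. -/
lemma exists_pell_solution_log_le {k : ℕ} (hk : Squarefree k) (h1 : 1 < k) :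
    ∃ x y : ℤ, x ^ 2 - k * y ^ 2 = 1 ∧ 1 < x + y * √(k : ℝ) ∧
      Real.log (x + y * √(k : ℝ)) ≤ 300 * (√(k : ℝ) * Real.log k) := by
  classical
  have hs1 : 1 ≤ √(k : ℝ) := by
    rw [Real.one_le_sqrt]; exact_mod_cast h1.le
  have hk2 : (2 : ℝ) ≤ k := by exact_mod_cast h1
  have hl2 := Real.log_two_gt_d9
  have hlk : Real.log 2 ≤ Real.log k := Real.log_le_log (by norm_num) hk2
  set s := √(k : ℝ) with hs
  set Y := 3 * s with hY
  have hY3 : 3 ≤ Y := by linarith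
  choose x y hcop hn0 hlo hhi using exists_coprime_approx hk h1
  set n : ℕ → ℤ := fun j => x j ^ 2 - k * y j ^ 2 with hn
  set ξ : ℕ → ℝ := fun j => x j + y j * s with hξ
  have hn0' : ∀ j, n j ≠ 0 := hn0
  have hlo' : ∀ j, 2 ^ j * |(n j : ℝ)| < ξ j := hlo
  have hhi' : ∀ j, ξ j ≤ 2 ^ j * Y := hhi
  have hnabs : ∀ j, (1 : ℝ) ≤ |(n j : ℝ)| := fun j => by
    exact_mod_cast Int.one_le_abs (hn0' j)
  have hP : ∀ j : ℕ, (1 : ℝ) ≤ 2 ^ j := fun j => one_le_pow₀ (by norm_num)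
  have hξj : ∀ j, (2 : ℝ) ^ j < ξ j := fun j => by
    refine lt_of_le_of_lt ?_ (hlo' j)
    exact le_mul_of_one_le_right (by positivity) (hnabs j)
  have hξ0 : ∀ j, 0 < ξ j := fun j => lt_of_lt_of_le (by positivity) (hξj j).le
  have hr : ∀ j, ∃ r : ℕ, r < (n j).natAbs ∧ n j ∣ r * y j - x j ∧ n j ∣ (r : ℤ) ^ 2 - k := by
    intro j
    have hc : IsCoprime (y j) (n j) := by
      have h2 : IsCoprime (y j) (x j ^ 2) := (hcop j).symm.pow_right
      have h3 : n j = x j ^ 2 + y j * (-(k * y j)) := by simp only [hn]; ring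
      rw [h3]
      exact h2.add_mul_left_right _
    obtain ⟨p, q, hpq⟩ := id hc
    have hnn : (n j : ℤ) ≠ 0 := hn0' j
    refine ⟨((x j * p) % n j).toNat, ?_, ?_⟩
    · have h4 := Int.emod_lt_abs (x j * p) hnn
      have h5 := Int.emod_nonneg (x j * p) hnn
      rw [Int.abs_eq_natAbs] at h4
      omega
    · have h5 := Int.emod_nonneg (x j * p) hnn
      rw [Int.toNat_of_nonneg h5]
      have h6 : n j ∣ (x j * p) % n j * y j - x j := by
        refine ⟨-(x j * p / n j * y j) - x j * q, ?_⟩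
        have := Int.emod_add_mul_ediv (x j * p) (n j)
        linear_combination (y j) * this + x j * hpq
      refine ⟨h6, ?_⟩
      have h7 : n j ∣ y j ^ 2 * (((x j * p) % n j) ^ 2 - k) := by
        obtain ⟨q', hq'⟩ := h6
        refine ⟨q' * ((x j * p) % n j * y j + x j) + 1, ?_⟩
        have h8 : n j = x j ^ 2 - k * y j ^ 2 := rfl
        linear_combination ((x j * p) % n j * y j + x j) * hq' - h8
      exact hc.symm.pow_right.dvd_of_dvd_mul_left h7
  choose r hrlt hr1 hr2 using hr
  set N := ⌊Y⌋₊ with hN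
  set T : Finset (Bool × (Σ _ : ℕ, ℕ × ℕ)) := Finset.univ ×ˢ (Finset.Icc 1 N).sigma (fun m =>
    ((Finset.range m).filter fun r : ℕ => (m : ℤ) ∣ (r : ℤ) ^ 2 - k) ×ˢ
      Finset.range (1 + Nat.log 2 ⌊Y / m⌋₊)) with hT
  have hTcard : (T.card : ℝ) ≤ 288 * (s * Real.log k) := by
    have h2 := sum_class_card_le hk h1
    rw [hT, Finset.card_product, Finset.card_sigma]
    simp only [Finset.card_product, Finset.card_range, Finset.card_univ, Fintype.card_bool]
    push_cast
    linarith
  set F : ℕ → Bool × (Σ _ : ℕ, ℕ × ℕ) := fun j =>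
    (decide (0 < n j), ⟨(n j).natAbs, r j, Nat.log 2 ⌊2 ^ j * Y / ξ j⌋₊⟩) with hF
  set J := ⌊288 * (s * Real.log k)⌋₊ with hJ
  have hmaps : ∀ j ∈ Finset.range (J + 1), F j ∈ T := by
    intro j _
    rw [hT, Finset.mem_product, Finset.mem_sigma, Finset.mem_product, Finset.mem_filter]
    have hm1 : 1 ≤ (n j).natAbs := Int.natAbs_pos.2 (hn0' j)
    have hmR : (((n j).natAbs : ℕ) : ℝ) = |(n j : ℝ)| := by
      rw [Nat.cast_natAbs, Int.cast_abs]
    refine ⟨Finset.mem_univ _, ?_, ⟨Finset.mem_range.2 (hrlt j), ?_⟩, ?_⟩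
    · rw [Finset.mem_Icc]
      refine ⟨hm1, (Nat.le_floor_iff (by linarith)).2 ?_⟩
      have h3 := (hlo' j).le.trans (hhi' j)
      have h4 := le_of_mul_le_mul_left h3 (by positivity)
      rwa [← hmR] at h4
    · exact Int.natAbs_dvd.2 (hr2 j)
    · rw [Finset.mem_range]
      have h3 : Nat.log 2 ⌊2 ^ j * Y / ξ j⌋₊ ≤ Nat.log 2 ⌊Y / ((n j).natAbs : ℕ)⌋₊ := by
        apply Nat.log_mono_right
        apply Nat.floor_le_floor
        rw [hmR, div_le_div_iff₀ (hξ0 j) (by linarith [hnabs j])]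
        nlinarith [hlo' j]
      exact Nat.lt_of_le_of_lt h3 (Nat.lt_one_add_iff.2 le_rfl)
  have hcard : T.card < (Finset.range (J + 1)).card := by
    rw [Finset.card_range]
    have h3 : (T.card : ℝ) < J + 1 := lt_of_le_of_lt hTcard (Nat.lt_floor_add_one _)
    exact_mod_cast h3
  obtain ⟨j₁, hj₁, j₂, hj₂, hne, heq⟩ := Finset.exists_ne_map_eq_of_card_lt_of_maps_to hcard hmaps
  wlog hlt : j₁ < j₂ generalizing j₁ j₂ with H
  · exact H j₂ hj₂ j₁ hj₁ hne.symm heq.symm (by omega)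
  simp only [hF, Prod.mk.injEq, Sigma.mk.injEq, heq_eq_eq] at heq
  obtain ⟨hsgn, habs, hreq, hlog⟩ := heq
  have hneq : n j₁ = n j₂ := by
    rcases Int.natAbs_eq_natAbs_iff.1 habs with h | h
    · exact h
    · have h2 := hn0' j₁
      have h3 : (0 < n j₁ ↔ 0 < n j₂) := by simpa using hsgn
      omega
  obtain ⟨A, B, hAB, hval⟩ := exists_unit_of_class (k := k) (x := x j₁) (y := y j₁) (x' := x j₂)
    (y' := y j₂) (n := n j₁) (r := r j₁) rfl hneq.symm (hn0' j₁) (hr2 j₁) (hr1 j₁)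
    (by rw [hneq, hreq]; exact hr1 j₂) (hξ0 j₁)
  have hval' : (A : ℝ) + B * s = ξ j₂ / ξ j₁ := hval
  refine ⟨A, B, hAB, ?_, ?_⟩
  · rw [hval', one_lt_div (hξ0 j₁)]
    have hw : ∀ j, 1 ≤ 2 ^ j * Y / ξ j := fun j => (one_le_div (hξ0 j)).2 (hhi' j)
    have hlow : (2 : ℝ) ^ Nat.log 2 ⌊2 ^ j₁ * Y / ξ j₁⌋₊ ≤ 2 ^ j₁ * Y / ξ j₁ := by
      refine le_trans ?_ (Nat.floor_le (by linarith [hw j₁]))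
      exact_mod_cast Nat.pow_log_le_self 2 (Nat.floor_pos.2 (hw j₁)).ne'
    have hupp : 2 ^ j₂ * Y / ξ j₂ < (2 : ℝ) ^ (Nat.log 2 ⌊2 ^ j₂ * Y / ξ j₂⌋₊ + 1) := by
      refine lt_of_lt_of_le (Nat.lt_floor_add_one _) ?_
      exact_mod_cast Nat.lt_pow_succ_log_self (by norm_num) ⌊2 ^ j₂ * Y / ξ j₂⌋₊
    rw [← hlog, pow_succ] at hupp
    have h3 : 2 ^ j₂ * Y / ξ j₂ < 2 ^ j₁ * Y / ξ j₁ * 2 := hupp.trans_le (by gcongr)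
    rw [div_mul_eq_mul_div, div_lt_div_iff₀ (hξ0 _) (hξ0 _)] at h3
    have h4 : (2 : ℝ) ^ j₁ * 2 ≤ 2 ^ j₂ := by
      rw [← pow_succ]; exact pow_le_pow_right₀ (by norm_num) hlt
    have h5 : 2 ^ j₂ * Y * ξ j₁ < 2 ^ j₂ * Y * ξ j₂ := by
      refine h3.trans_le ?_
      calc 2 ^ j₁ * Y * 2 * ξ j₂ = 2 ^ j₁ * 2 * (Y * ξ j₂) := by ring
        _ ≤ 2 ^ j₂ * (Y * ξ j₂) := by
          have := hξ0 j₂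
          gcongr
        _ = _ := by ring
    exact lt_of_mul_lt_mul_left h5 (by positivity)
  · rw [hval']
    have hj2 : j₂ ≤ J := by
      have := Finset.mem_range.1 hj₂; omega
    have h3 : ξ j₂ / ξ j₁ ≤ 2 ^ J * Y := by
      rw [div_le_iff₀ (hξ0 _)]
      have h4 : (1 : ℝ) ≤ ξ j₁ := (hP j₁).trans (hξj j₁).le
      calc ξ j₂ ≤ 2 ^ j₂ * Y := hhi' j₂
        _ ≤ 2 ^ J * Y := by gcongr; norm_num
        _ ≤ _ := le_mul_of_one_le_right (by positivity) h4
    have hlogs : Real.log s = Real.log k / 2 := by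
      rw [hs, Real.log_sqrt (by positivity)]
    have hl3 : Real.log 3 ≤ 2 * Real.log 2 := by
      rw [← Real.log_rpow (by norm_num)]
      exact Real.log_le_log (by norm_num) (by norm_num)
    have hJ' : (J : ℝ) ≤ 288 * (s * Real.log k) :=
      Nat.floor_le (by have : 0 ≤ Real.log k := by linarith
                       positivity)
    have hl2' : Real.log 2 ≤ 1 := by linarith [Real.log_two_lt_d9]
    have hl20 : 0 ≤ Real.log 2 := by linarith
    calc Real.log (ξ j₂ / ξ j₁) ≤ Real.log (2 ^ J * Y) :=
          Real.log_le_log (div_pos (hξ0 _) (hξ0 _)) h3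
      _ = J * Real.log 2 + (Real.log 3 + Real.log k / 2) := by
          rw [Real.log_mul (by positivity) (by positivity), Real.log_pow, hY,
            Real.log_mul (by norm_num) (by positivity), hlogs]
      _ ≤ 288 * (s * Real.log k) * 1 + 3 * (1 * Real.log k) := by
          gcongr
          linarith
      _ ≤ 288 * (s * Real.log k) + 12 * (s * Real.log k) := by
          have : 0 ≤ Real.log k := by linarith
          nlinarith
      _ = _ := by ring

/-- Two squarefree numbers whose product is a square are equal. -/
lemma Squarefree.eq_of_isSquare_mul {a b : ℕ} (ha : Squarefree a) (hb : Squarefree b)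
    (h : IsSquare (a * b)) : a = b := by
  obtain ⟨w, hw⟩ := h
  have key : ∀ {a b : ℕ}, Squarefree a → a * b = w * w → ∀ p, p.Prime → p ∣ a → p ∣ b := by
    intro a b ha hw p hp hpa
    have h1 : p ∣ w := by
      have : p ∣ w * w := hw ▸ hpa.mul_right b
      exact (hp.dvd_mul.1 this).elim id id
    obtain ⟨q, rfl⟩ := hpa
    have h2 : p * p ∣ p * (q * b) := by
      rw [← mul_assoc, hw]; exact mul_dvd_mul h1 h1
    have h3 : p ∣ q * b := Nat.dvd_of_mul_dvd_mul_left hp.pos h2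
    rcases hp.dvd_mul.1 h3 with h4 | h4
    · exact absurd (Nat.isUnit_iff.1 (ha p (mul_dvd_mul_left p h4))) hp.one_lt.ne'
    · exact h4
  exact (Nat.Squarefree.ext_iff ha hb).2 fun p hp =>
    ⟨key ha hw p hp, key hb (by rw [mul_comm]; exact hw) p hp⟩

/-- Positive elements of norm one in `ℚ(√m)`. -/
def IsNormOne (m : ℕ) (ξ : ℝ) : Prop :=
  0 < ξ ∧ ∃ r t : ℚ, ξ = r + t * √(m : ℝ) ∧ r ^ 2 - m * t ^ 2 = 1

namespace IsNormOne

variable {m : ℕ} {ξ ζ : ℝ}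

lemma one : IsNormOne m 1 := ⟨one_pos, 1, 0, by simp, by simp⟩

lemma inv_eq {r t : ℚ} (h1 : ξ = r + t * √(m : ℝ)) (h2 : r ^ 2 - m * t ^ 2 = 1) :
    ξ⁻¹ = r - t * √(m : ℝ) := by
  apply inv_eq_of_mul_eq_one_right
  have hs : √(m : ℝ) ^ 2 = m := Real.sq_sqrt (Nat.cast_nonneg m)
  have h3 : (r : ℝ) ^ 2 - m * t ^ 2 = 1 := by exact_mod_cast h2
  rw [h1]
  linear_combination h3 - (t : ℝ) ^ 2 * hs

lemma mul (h : IsNormOne m ξ) (h' : IsNormOne m ζ) : IsNormOne m (ξ * ζ) := by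
  obtain ⟨h0, r, t, h1, h2⟩ := h
  obtain ⟨h0', r', t', h1', h2'⟩ := h'
  have hs : √(m : ℝ) ^ 2 = m := Real.sq_sqrt (Nat.cast_nonneg m)
  refine ⟨mul_pos h0 h0', r * r' + m * t * t', r * t' + r' * t, ?_, ?_⟩
  · rw [h1, h1']; push_cast
    linear_combination (t * t' : ℝ) * hs
  · linear_combination h2 * (r' ^ 2 - m * t' ^ 2) + h2'

lemma inv (h : IsNormOne m ξ) : IsNormOne m ξ⁻¹ := by
  obtain ⟨h0, r, t, h1, h2⟩ := h
  refine ⟨inv_pos.2 h0, r, -t, ?_, ?_⟩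
  · rw [inv_eq h1 h2]; push_cast; ring
  · linear_combination h2

lemma pow (h : IsNormOne m ξ) (n : ℕ) : IsNormOne m (ξ ^ n) := by
  induction n with
  | zero => simpa using one
  | succ n ih => rw [pow_succ]; exact ih.mul h

lemma zpow (h : IsNormOne m ξ) (n : ℤ) : IsNormOne m (ξ ^ n) := by
  cases n with
  | ofNat n => simpa using h.pow n
  | negSucc n => rw [zpow_negSucc]; exact (h.pow _).inv

lemma prod {ι : Type*} {s : Finset ι} {f : ι → ℝ} (h : ∀ i ∈ s, IsNormOne m (f i)) :
    IsNormOne m (∏ i ∈ s, f i) :=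
  Finset.prod_induction f (IsNormOne m) (fun _ _ => mul) one h

end IsNormOne

/-- Positive integral elements of norm one in `ℚ(√m)`. -/
def IsNormOneUnit (m : ℕ) (ξ : ℝ) : Prop :=
  IsNormOne m ξ ∧ IsIntegral ℤ ξ ∧ IsIntegral ℤ ξ⁻¹

namespace IsNormOneUnit

variable {m : ℕ} {ξ ζ : ℝ}

lemma mul (h : IsNormOneUnit m ξ) (h' : IsNormOneUnit m ζ) : IsNormOneUnit m (ξ * ζ) :=
  ⟨h.1.mul h'.1, h.2.1.mul h'.2.1, by rw [mul_inv]; exact h.2.2.mul h'.2.2⟩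

lemma inv (h : IsNormOneUnit m ξ) : IsNormOneUnit m ξ⁻¹ :=
  ⟨h.1.inv, h.2.2, by rw [inv_inv]; exact h.2.1⟩

lemma pow (h : IsNormOneUnit m ξ) (n : ℕ) : IsNormOneUnit m (ξ ^ n) :=
  ⟨h.1.pow n, h.2.1.pow n, by rw [← inv_pow]; exact h.2.2.pow n⟩

lemma zpow (h : IsNormOneUnit m ξ) (n : ℤ) : IsNormOneUnit m (ξ ^ n) := by
  cases n with
  | ofNat n => simpa using h.pow n
  | negSucc n => rw [zpow_negSucc]; exact (h.pow _).inv

lemma of_pow (h : IsNormOne m ξ) {n : ℕ} (hn : 0 < n) (h' : IsNormOneUnit m (ξ ^ n)) :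
    IsNormOneUnit m ξ :=
  ⟨h, h'.2.1.of_pow hn, IsIntegral.of_pow hn (by rw [inv_pow]; exact h'.2.2)⟩

lemma of_zpow (h : IsNormOne m ξ) {n : ℤ} (hn : n ≠ 0) (h' : IsNormOneUnit m (ξ ^ n)) :
    IsNormOneUnit m ξ := by
  refine of_pow h (Int.natAbs_pos.2 hn) ?_
  rcases Int.natAbs_eq n with h1 | h1
  · rw [h1, zpow_natCast] at h'; exact h'
  · rw [h1, zpow_neg, zpow_natCast] at h'
    simpa using h'.inv

lemma exists_trace (h : IsNormOneUnit m ξ) : ∃ n : ℕ, ξ + ξ⁻¹ = n := by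
  obtain ⟨⟨h0, r, t, h1, h2⟩, h3, h4⟩ := h
  have h5 : IsIntegral ℤ (ξ + ξ⁻¹) := h3.add h4
  have h6 : ξ + ξ⁻¹ = algebraMap ℚ ℝ (2 * r) := by
    rw [IsNormOne.inv_eq h1 h2, h1]
    simp; ring
  rw [h6, isIntegral_algebraMap_iff (algebraMap ℚ ℝ).injective] at h5
  obtain ⟨n, hn⟩ := IsIntegrallyClosed.isIntegral_iff.1 h5
  have h7 : ξ + ξ⁻¹ = n := by
    rw [h6, ← hn]; simp
  have h8 : (0 : ℝ) < n := by rw [← h7]; positivity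
  have h9 : 0 < n := by exact_mod_cast h8
  refine ⟨n.toNat, ?_⟩
  rw [h7]
  exact_mod_cast (Int.toNat_of_nonneg h9.le).symm

end IsNormOneUnit

/-- Existence of a small fundamental unit of norm one. -/
lemma exists_fundamental_unit {m : ℕ} (hm : ¬ IsSquare m) :
    ∃ ε : ℝ, IsNormOneUnit m ε ∧ 2 ≤ ε ∧ Real.log ε ≤ 300 * (√(m : ℝ) * Real.log m) ∧
      ∀ ξ, IsNormOneUnit m ξ → 1 ≤ ξ → ξ < ε → ξ = 1 := by
  classical
  have hm0 : 0 < m := Nat.pos_of_ne_zero (by rintro rfl; exact hm ⟨0, rfl⟩)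
  obtain ⟨k, g, hk0, hg0, hkg, hk⟩ := Nat.sq_mul_squarefree_of_pos hm0
  have hk1 : 1 < k := by
    rcases Nat.lt_or_ge 1 k with h | h
    · exact h
    · exfalso
      have : k = 1 := by omega
      subst this
      exact hm ⟨g, by rw [← hkg]; ring⟩
  obtain ⟨x, y, hxy, h1, h2⟩ := exists_pell_solution_log_le hk hk1
  have hgR : (0 : ℝ) < g := by exact_mod_cast hg0
  have hsm : √(m : ℝ) = g * √(k : ℝ) := by
    rw [← hkg]; push_cast
    rw [Real.sqrt_mul (by positivity), Real.sqrt_sq hgR.le]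
  have hsint : IsIntegral ℤ √(k : ℝ) := by
    refine IsIntegral.of_pow (n := 2) (by norm_num) ?_
    rw [Real.sq_sqrt (Nat.cast_nonneg k)]
    exact isIntegral_algebraMap (R := ℤ) (A := ℝ) (x := (k : ℤ))
  have hxyR : ((x : ℝ) + y * √(k : ℝ)) * (x - y * √(k : ℝ)) = 1 := by
    have hs : √(k : ℝ) ^ 2 = k := Real.sq_sqrt (Nat.cast_nonneg k)
    have : (x : ℝ) ^ 2 - k * y ^ 2 = 1 := by exact_mod_cast hxy
    linear_combination this - (y : ℝ) ^ 2 * hs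
  set ξ₀ := (x : ℝ) + y * √(k : ℝ) with hξ₀
  have hU : IsNormOneUnit m ξ₀ := by
    refine ⟨⟨by linarith, x, y / g, ?_, ?_⟩, ?_, ?_⟩
    · rw [hsm, hξ₀]; push_cast; field_simp
    · have hgQ : (g : ℚ) ≠ 0 := by exact_mod_cast hg0.ne'
      rw [← hkg]; push_cast
      field_simp
      have : (x : ℚ) ^ 2 - k * y ^ 2 = 1 := by exact_mod_cast hxy
      linarith
    · exact (isIntegral_algebraMap (R := ℤ) (A := ℝ) (x := x)).add
        ((isIntegral_algebraMap (R := ℤ) (A := ℝ) (x := y)).mul hsint)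
    · rw [inv_eq_of_mul_eq_one_right hxyR]
      exact (isIntegral_algebraMap (R := ℤ) (A := ℝ) (x := x)).sub
        ((isIntegral_algebraMap (R := ℤ) (A := ℝ) (x := y)).mul hsint)
  have hex : ∃ n : ℕ, ∃ ξ, IsNormOneUnit m ξ ∧ 1 < ξ ∧ ξ + ξ⁻¹ = n := by
    obtain ⟨n, hn⟩ := hU.exists_trace
    exact ⟨n, ξ₀, hU, h1, hn⟩
  obtain ⟨ε, hε, hε1, hεn⟩ := Nat.find_spec hex
  have hmin : ∀ ξ, IsNormOneUnit m ξ → 1 < ξ → ε ≤ ξ := by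
    intro ξ hξ hξ1
    obtain ⟨n, hn⟩ := hξ.exists_trace
    have h3 := Nat.find_min' hex ⟨ξ, hξ, hξ1, hn⟩
    have h4 : ε + ε⁻¹ ≤ ξ + ξ⁻¹ := by
      rw [hεn, hn]; exact_mod_cast h3
    by_contra! hlt
    have h5 : (ε - ξ) * (1 - (ε * ξ)⁻¹) = (ε + ε⁻¹) - (ξ + ξ⁻¹) := by
      field_simp; ring
    have h6 : (ε * ξ)⁻¹ < 1 := inv_lt_one_of_one_lt₀ (by nlinarith)
    have h7 : 0 < (ε - ξ) * (1 - (ε * ξ)⁻¹) := mul_pos (by linarith) (by linarith)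
    linarith
  refine ⟨ε, hε, ?_, ?_, ?_⟩
  · have h3 : (2 : ℝ) < Nat.find hex := by
      rw [← hεn]
      have : ε + ε⁻¹ - 2 = (ε - 1) ^ 2 * ε⁻¹ := by field_simp; ring
      have h4 : 0 < (ε - 1) ^ 2 * ε⁻¹ := by
        have : 0 < ε - 1 := by linarith
        positivity
      linarith
    have h4 : (3 : ℝ) ≤ Nat.find hex := by
      have : 2 < Nat.find hex := by exact_mod_cast h3
      exact_mod_cast this
    have h5 : ε⁻¹ < 1 := inv_lt_one_of_one_lt₀ hε1
    linarith
  · have hkm : (k : ℝ) ≤ m := by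
      have : k ≤ m := by rw [← hkg]; exact Nat.le_mul_of_pos_left _ (by positivity)
      exact_mod_cast this
    have hk1R : (1 : ℝ) < k := by exact_mod_cast hk1
    have hlk : 0 ≤ Real.log k := Real.log_nonneg hk1R.le
    calc Real.log ε ≤ Real.log ξ₀ := Real.log_le_log (by linarith) (hmin ξ₀ hU h1)
      _ ≤ 300 * (√(k : ℝ) * Real.log k) := h2
      _ ≤ _ := by gcongr
  · intro ξ hξ h3 h4
    rcases h3.eq_or_lt with h5 | h5
    · exact h5.symm
    · exact absurd (hmin ξ hξ h5) (not_le.2 h4)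

/-- Elements of norm one in two distinct quadratic fields are multiplicatively independent, even
together with the rationals. -/
lemma IsNormOne.eq_one_of_mul_eq_one {m m' : ℕ} (hm : ¬ IsSquare m) (hm' : ¬ IsSquare m')
    (hmm' : ¬ IsSquare (m * m')) {q : ℚ} {ξ ζ : ℝ} (hq : 0 < q) (hξ : IsNormOne m ξ)
    (hζ : IsNormOne m' ζ) (h : (q : ℝ) * ξ * ζ = 1) : q = 1 ∧ ξ = 1 ∧ ζ = 1 := by
  obtain ⟨hξ0, r, t, h1, h2⟩ := hξ
  obtain ⟨hζ0, r', t', h1', h2'⟩ := hζ.inv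
  have hi := irrational_sqrt_natCast_iff.2 hm
  have hi' := irrational_sqrt_natCast_iff.2 hm'
  have hii' := irrational_sqrt_natCast_iff.2 hmm'
  have hs : √(m : ℝ) ^ 2 = m := Real.sq_sqrt (Nat.cast_nonneg m)
  have hs' : √(m' : ℝ) ^ 2 = m' := Real.sq_sqrt (Nat.cast_nonneg m')
  push_cast at hii'
  rw [Real.sqrt_mul (Nat.cast_nonneg m)] at hii'
  set s := √(m : ℝ)
  set s' := √(m' : ℝ)
  have hz : (q : ℝ) * ξ = ζ⁻¹ := eq_inv_of_mul_eq_one_left h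
  rw [h1', h1] at hz
  have indep : ∀ {z : ℝ}, Irrational z → ∀ A B : ℚ, (A : ℝ) + B * z = 0 → A = 0 ∧ B = 0 := by
    intro z hz A B h
    have hB : B = 0 := by
      by_contra hB
      apply hz
      refine ⟨-A / B, ?_⟩
      have : (B : ℝ) ≠ 0 := by exact_mod_cast hB
      push_cast
      rw [div_eq_iff this]; linarith
    subst hB
    simp at h
    exact ⟨h, rfl⟩
  have h3 : (q * r - r') * (q * t) = 0 := by
    have := (indep hi ((q * r - r') ^ 2 + (q * t) ^ 2 * m - t' ^ 2 * m')
      (2 * ((q * r - r') * (q * t))) (by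
        push_cast
        have h4 : (q * r - r' : ℝ) + q * t * s = t' * s' := by linarith
        have h5 : ((q * r - r' : ℝ) + q * t * s) ^ 2 = (t' * s') ^ 2 := by rw [h4]
        linear_combination h5 - (q * t : ℝ) ^ 2 * hs + (t' : ℝ) ^ 2 * hs')).2
    simpa using this
  have htt : t = 0 ∧ t' = 0 := by
    rcases mul_eq_zero.1 h3 with h4 | h4
    · have h4' : (q : ℝ) * r - r' = 0 := by exact_mod_cast h4
      obtain ⟨h5, h6⟩ := indep hii' (q * t * m) (-t') (by
        push_cast
        linear_combination s * hz - s * h4' - (q * t : ℝ) * hs)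
      have h7 : t' = 0 := by linarith
      rw [h7] at hz
      have h8 := (indep hi (q * r - r') (q * t) (by push_cast; push_cast at hz; linarith)).2
      exact ⟨(mul_eq_zero.1 h8).resolve_left hq.ne', h7⟩
    · have h5 : t = 0 := (mul_eq_zero.1 h4).resolve_left hq.ne'
      rw [h5] at hz
      have h8 := (indep hi' (q * r - r') (-t') (by push_cast; push_cast at hz; linarith)).2
      exact ⟨h5, by linarith⟩
  obtain ⟨rfl, rfl⟩ := htt
  have e1 : ξ = 1 := by
    have h4 : (r : ℝ) ^ 2 = 1 := by
      have : r ^ 2 = 1 := by simpa using h2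
      exact_mod_cast this
    have h5 : ξ = r := by simpa using h1
    rw [h5] at hξ0 ⊢
    nlinarith
  have e2 : ζ = 1 := by
    have h4 : (r' : ℝ) ^ 2 = 1 := by
      have : r' ^ 2 = 1 := by simpa using h2'
      exact_mod_cast this
    have h5 : ζ⁻¹ = r' := by simpa using h1'
    rw [h5] at hζ0
    have h6 : ζ⁻¹ = 1 := by rw [h5]; nlinarith
    exact inv_eq_one.1 h6
  refine ⟨?_, e1, e2⟩
  rw [e1, e2, mul_one, mul_one] at h
  exact_mod_cast h

/-- The real field `ℚ(√m, √m')`. -/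
noncomputable def biquadraticField (m m' : ℕ) : IntermediateField ℚ ℝ :=
  IntermediateField.adjoin ℚ {√(m : ℝ), √(m' : ℝ)}

namespace biquadraticField

variable (m m' : ℕ)

lemma sqrt_left_mem : √(m : ℝ) ∈ biquadraticField m m' :=
  IntermediateField.subset_adjoin _ _ (by simp)

lemma sqrt_right_mem : √(m' : ℝ) ∈ biquadraticField m m' :=
  IntermediateField.subset_adjoin _ _ (by simp)

lemma isIntegral_sqrt (R : Type*) [CommRing R] [Algebra R ℝ] : IsIntegral R √(m : ℝ) := by
  refine IsIntegral.of_pow (n := 2) (by norm_num) ?_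
  rw [Real.sq_sqrt (Nat.cast_nonneg m)]
  simpa using isIntegral_algebraMap (R := R) (A := ℝ) (x := (m : R))

lemma finrank_adjoin_sqrt_le :
    Module.finrank ℚ (IntermediateField.adjoin ℚ {√(m : ℝ)}) ≤ 2 := by
  rw [IntermediateField.adjoin.finrank (isIntegral_sqrt m ℚ)]
  have h1 : (Polynomial.X ^ 2 - Polynomial.C (m : ℚ)).natDegree = 2 :=
    Polynomial.natDegree_X_pow_sub_C
  rw [← h1]
  refine Polynomial.natDegree_le_of_dvd (minpoly.dvd ℚ _ ?_) ?_
  · simp [Real.sq_sqrt (Nat.cast_nonneg m)]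
  · intro h
    rw [h] at h1
    simp at h1

lemma eq_sup : biquadraticField m m' =
    IntermediateField.adjoin ℚ {√(m : ℝ)} ⊔ IntermediateField.adjoin ℚ {√(m' : ℝ)} := by
  rw [← IntermediateField.adjoin_union]; rfl

instance : FiniteDimensional ℚ (biquadraticField m m') := by
  have h1 := IntermediateField.adjoin.finiteDimensional (isIntegral_sqrt m ℚ)
  have h2 := IntermediateField.adjoin.finiteDimensional (isIntegral_sqrt m' ℚ)
  rw [eq_sup]
  infer_instance

lemma finrank_le : Module.finrank ℚ (biquadraticField m m') ≤ 4 := by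
  rw [eq_sup]
  exact (IntermediateField.finrank_sup_le _ _).trans
    (Nat.mul_le_mul (finrank_adjoin_sqrt_le m) (finrank_adjoin_sqrt_le m'))

variable {m m'}

lemma map_sqrt {K : IntermediateField ℚ ℝ} (φ : K →+* ℂ) {s : K} (hs : (s : ℝ) = √(m : ℝ)) :
    φ s = (√(m : ℝ) : ℂ) ∨ φ s = -(√(m : ℝ) : ℂ) := by
  rw [← sq_eq_sq_iff_eq_or_eq_neg, ← map_pow]
  have h1 : s ^ 2 = (m : K) := by
    apply Subtype.ext
    push_cast
    rw [hs, Real.sq_sqrt (Nat.cast_nonneg m)]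
  rw [h1, map_natCast, ← Complex.ofReal_pow, Real.sq_sqrt (Nat.cast_nonneg m)]
  simp

lemma map_im (φ : biquadraticField m m' →+* ℂ) (x : biquadraticField m m') : (φ x).im = 0 := by
  obtain ⟨x, hx⟩ := x
  unfold biquadraticField at hx
  induction hx using IntermediateField.adjoin_induction with
  | mem y hy =>
    rcases hy with rfl | rfl
    · rcases map_sqrt (m := m) φ (s := ⟨_, sqrt_left_mem m m'⟩) rfl with h | h <;>
        exact (congrArg Complex.im h).trans (by simp)
    · rcases map_sqrt (m := m') φ (s := ⟨_, sqrt_right_mem m m'⟩) rfl with h | h <;>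
        exact (congrArg Complex.im h).trans (by simp)
  | algebraMap y =>
    have : φ (algebraMap ℚ (biquadraticField m m') y) = (y : ℂ) := by
      rw [eq_ratCast, map_ratCast]
    exact (congrArg Complex.im this).trans (Complex.ratCast_im y)
  | add x y hx hy h1 h2 =>
    have : φ (⟨x, hx⟩ + ⟨y, hy⟩ : biquadraticField m m') = φ ⟨x, hx⟩ + φ ⟨y, hy⟩ := map_add φ _ _
    exact (congrArg Complex.im this).trans (by rw [Complex.add_im, h1, h2, add_zero])
  | inv x hx h1 =>
    have : φ ((⟨x, hx⟩ : biquadraticField m m')⁻¹) = (φ ⟨x, hx⟩)⁻¹ := map_inv₀ φ _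
    exact (congrArg Complex.im this).trans (by rw [Complex.inv_im, h1]; simp)
  | mul x y hx hy h1 h2 =>
    have : φ (⟨x, hx⟩ * ⟨y, hy⟩ : biquadraticField m m') = φ ⟨x, hx⟩ * φ ⟨y, hy⟩ := map_mul φ _ _
    exact (congrArg Complex.im this).trans (by rw [Complex.mul_im, h1, h2]; simp)

lemma norm_map_le {K : IntermediateField ℚ ℝ} (hK : √(m : ℝ) ∈ K) (φ : K →+* ℂ) {ξ : ℝ}
    (hξ : IsNormOne m ξ) {x : K} (hx : (x : ℝ) = ξ) : ‖φ x‖ ≤ exp |Real.log ξ| := by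
  obtain ⟨h0, r, t, h1, h2⟩ := hξ
  have h3 : x = (r : K) + (t : K) * ⟨_, hK⟩ := by
    apply Subtype.ext
    push_cast
    rw [hx, h1]
  have h4 : φ x = (ξ : ℂ) ∨ φ x = ((ξ⁻¹ : ℝ) : ℂ) := by
    rw [IsNormOne.inv_eq h1 h2, h1, h3, map_add, map_mul, map_ratCast, map_ratCast]
    rcases map_sqrt (m := m) φ (s := ⟨_, hK⟩) rfl with h | h
    · left; rw [h]; push_cast; ring
    · right; rw [h]; push_cast; ring
  rcases h4 with h | h
  · rw [h, Complex.norm_real, Real.norm_of_nonneg h0.le]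
    calc ξ = exp (Real.log ξ) := (Real.exp_log h0).symm
      _ ≤ _ := Real.exp_le_exp.2 (le_abs_self _)
  · rw [h, Complex.norm_real, Real.norm_of_nonneg (inv_pos.2 h0).le]
    calc ξ⁻¹ = exp (-Real.log ξ) := by rw [Real.exp_neg, Real.exp_log h0]
      _ ≤ _ := Real.exp_le_exp.2 (neg_le_abs _)

end biquadraticField

lemma IsNormOne.mem {m : ℕ} {ξ : ℝ} (h : IsNormOne m ξ) {K : IntermediateField ℚ ℝ}
    (hK : √(m : ℝ) ∈ K) : ξ ∈ K := by
  obtain ⟨-, r, t, rfl, -⟩ := h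
  have hr : ∀ r : ℚ, (r : ℝ) ∈ K := fun r => K.algebraMap_mem r
  exact add_mem (hr r) (mul_mem (hr t) hK)

lemma isIntegral_natCast_mul_map {K : IntermediateField ℚ ℝ} (φ : K →+* ℂ) {D : ℕ} {x : K}
    (h : IsIntegral ℤ ((D : ℝ) * (x : ℝ))) : IsIntegral ℤ ((D : ℂ) * φ x) := by
  have h1 : IsIntegral ℤ ((D : K) * x) := by
    have h2 : (D : ℝ) * (x : ℝ) = K.val.toRingHom.toIntAlgHom ((D : K) * x) := by
      simp
    rw [h2] at h
    exact (isIntegral_algHom_iff K.val.toRingHom.toIntAlgHom K.val.injective).1 h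
  have h2 := h1.map φ.toIntAlgHom
  simpa using h2

lemma exp_abs_log_ratCast {q : ℚ} (hq : 0 < q) : (q : ℝ) ≤ exp |Real.log (q : ℝ)| := by
  have h0 : (0 : ℝ) < q := by exact_mod_cast hq
  calc (q : ℝ) = exp (Real.log (q : ℝ)) := (Real.exp_log h0).symm
    _ ≤ _ := Real.exp_le_exp.2 (le_abs_self _)

/-- Lower bounds for simultaneous linear forms in logarithms in real biquadratic fields. -/
theorem exists_exp_neg_lt_abs_log_sub_biquadratic : ∃ C : ℝ, 0 < C ∧ ∀ m m' : ℕ,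
    ¬ IsSquare m → ¬ IsSquare m' → ¬ IsSquare (m * m') →
    ∀ (q : Fin 3 → ℚ) (ξ ζ h : Fin 3 → ℝ) (D : Fin 3 → ℕ), (∀ i, 0 < q i) →
    (∀ i, IsNormOne m (ξ i)) → (∀ i, IsNormOne m' (ζ i)) → (∀ i, 1 ≤ h i) →
    (∀ i, |Real.log (q i : ℝ)| + |Real.log (ξ i)| + |Real.log (ζ i)| ≤ h i) → (∀ i, 0 < D i) →
    (∀ i, (D i : ℝ) ≤ exp (h i)) → (∀ i, IsIntegral ℤ ((D i : ℝ) * (q i * ξ i * ζ i))) →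
    (∀ i, IsIntegral ℤ ((D i : ℝ) * (q i * ξ i * ζ i)⁻¹)) →
    (∀ n : Fin 3 → ℤ, ∏ i, (q i) ^ n i = 1 → ∏ i, (ξ i) ^ n i = 1 → ∏ i, (ζ i) ^ n i = 1 → n = 0) →
    ∀ (u v : Fin 3 → ℤ) (t t' : ℝ) (s₀ : ℕ), 0 < s₀ →
    ∑ i, |(u i : ℝ)| / h i + 1 ≤ exp s₀ → ∑ i, |(v i : ℝ)| / h i + 1 ≤ exp s₀ →
    ∃ i, exp (-(C * (h 0 * h 1 * h 2) * s₀ ^ 2)) <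
      |Real.log (q i * ξ i * ζ i) - (u i * t + v i * t')| := by
  obtain ⟨C, hC, H⟩ := PositiveTriple.exists_exp_neg_lt_abs_log_sub
  refine ⟨C, hC, ?_⟩
  intro m m' hm hm' hmm' q ξ ζ h D hq hξ hζ h1 hle hD hDle hint hint' hind u v t t' s₀ hs hu hv
  set K := biquadraticField m m' with hK
  have hmK : √(m : ℝ) ∈ K := biquadraticField.sqrt_left_mem m m'
  have hmK' : √(m' : ℝ) ∈ K := biquadraticField.sqrt_right_mem m m'
  let x : Fin 3 → K := fun i => ⟨ξ i, (hξ i).mem hmK⟩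
  let z : Fin 3 → K := fun i => ⟨ζ i, (hζ i).mem hmK'⟩
  let A : Fin 3 → K := fun i => (q i : K) * x i * z i
  have hA : ∀ i, (A i : ℝ) = q i * ξ i * ζ i := fun i => by simp [A, x, z]
  have hA' : ∀ i, ((A i)⁻¹ : K) = ((q i)⁻¹ : ℚ) * (x i)⁻¹ * (z i)⁻¹ := fun i => by
    simp only [A, mul_inv, Rat.cast_inv]
  have hnorm : ∀ (φ : K →+* ℂ) (q : ℚ) (ξ ζ : ℝ) (x z : K), 0 < q → IsNormOne m ξ → IsNormOne m' ζ →
      (x : ℝ) = ξ → (z : ℝ) = ζ →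
      ‖φ ((q : K) * x * z)‖ ≤ exp (|Real.log (q : ℝ)| + |Real.log ξ| + |Real.log ζ|) := by
    intro φ q ξ ζ x z hq hξ hζ hx hz
    rw [map_mul, map_mul, map_ratCast, norm_mul, norm_mul, Real.exp_add, Real.exp_add]
    have e1 : ‖(q : ℂ)‖ ≤ exp |Real.log (q : ℝ)| := by
      rw [Complex.norm_ratCast, abs_of_pos (by exact_mod_cast hq)]
      exact exp_abs_log_ratCast hq
    have e2 := biquadraticField.norm_map_le hmK φ hξ hx
    have e3 := biquadraticField.norm_map_le hmK' φ hζ hz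
    gcongr
  let S : PositiveTriple K :=
    { α := A
      pos := fun i => by
        rw [hA]
        have : (0 : ℝ) < q i := by exact_mod_cast hq i
        exact mul_pos (mul_pos this (hξ i).1) (hζ i).1
      h := h
      one_le_h := h1
      conj_le := fun φ i => (hnorm φ (q i) (ξ i) (ζ i) (x i) (z i) (hq i) (hξ i) (hζ i) rfl rfl).trans
        (Real.exp_le_exp.2 (hle i))
      conj_inv_le := fun φ i => by
        rw [hA']
        refine (hnorm φ (q i)⁻¹ (ξ i)⁻¹ (ζ i)⁻¹ (x i)⁻¹ (z i)⁻¹ (inv_pos.2 (hq i)) (hξ i).inv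
          (hζ i).inv (by simp [x]) (by simp [z])).trans (Real.exp_le_exp.2 ?_)
        rw [Rat.cast_inv, Real.log_inv, Real.log_inv, Real.log_inv, abs_neg, abs_neg, abs_neg]
        exact hle i
      D := D
      D_pos := hD
      D_le := hDle
      isIntegral := fun φ i => isIntegral_natCast_mul_map φ (by rw [hA]; exact hint i)
      isIntegral_inv := fun φ i => isIntegral_natCast_mul_map φ (by
        have : (((A i)⁻¹ : K) : ℝ) = (q i * ξ i * ζ i)⁻¹ := by rw [← hA]; simp
        rw [this]; exact hint' i) }
  have hSα : ∀ i, (S.α i : ℝ) = q i * ξ i * ζ i := hA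
  have hSind : ∀ n, S.mon n = 1 → n = 0 := by
    intro n hn
    have h2 : (S.mon n : ℝ) = 1 := by rw [hn]; simp
    rw [S.coe_mon] at h2
    have h3 : ((∏ i, (q i) ^ n i : ℚ) : ℝ) * (∏ i, (ξ i) ^ n i) * ∏ i, (ζ i) ^ n i = 1 := by
      rw [← h2]
      push_cast
      rw [← Finset.prod_mul_distrib, ← Finset.prod_mul_distrib]
      exact Finset.prod_congr rfl fun i _ => by rw [hSα, mul_zpow, mul_zpow]
    obtain ⟨e1, e2, e3⟩ := IsNormOne.eq_one_of_mul_eq_one hm hm' hmm'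
      (Finset.prod_pos fun i _ => zpow_pos (hq i) _)
      (IsNormOne.prod fun i _ => (hξ i).zpow (n i)) (IsNormOne.prod fun i _ => (hζ i).zpow (n i)) h3
    exact hind n e1 e2 e3
  obtain ⟨i, hi⟩ := H K (biquadraticField.finrank_le m m') (biquadraticField.map_im) S hSind u v t t'
    s₀ hs hu hv
  refine ⟨i, ?_⟩
  rw [hSα] at hi
  exact hi

lemma le_of_le_mul_log_sq {T B : ℝ} (hT : 0 ≤ T) (hB : 1 ≤ B)
    (h : T ≤ B * (2 + Real.log (2 + 24 * T)) ^ 2) : T ≤ 256 * B * (1 + Real.log B) ^ 2 := by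
  have hlB : 0 ≤ Real.log B := Real.log_nonneg hB
  rcases le_total T 1 with hT1 | hT1
  · refine hT1.trans ?_
    nlinarith [mul_nonneg (sub_nonneg.2 hB) (sq_nonneg (Real.log B)),
      mul_nonneg (sub_nonneg.2 hB) hlB, sq_nonneg (Real.log B)]
  have hT0 : 0 < T := by linarith
  have he := Real.exp_one_gt_d9
  have h26 : Real.log (2 + 24 * T) ≤ 4 + Real.log T := by
    have h1 : (26 : ℝ) ≤ exp 4 := by
      have : exp 4 = exp 1 ^ 4 := by rw [← Real.exp_nat_mul]; norm_num
      rw [this]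
      calc (26 : ℝ) ≤ 2.7 ^ 4 := by norm_num
        _ ≤ _ := by gcongr; linarith
    rw [← Real.log_exp 4, ← Real.log_mul (Real.exp_pos 4).ne' hT0.ne']
    exact Real.log_le_log (by linarith) (by nlinarith)
  have hl0 : 0 ≤ Real.log (2 + 24 * T) := Real.log_nonneg (by linarith)
  set w := √(√T) with hw
  have hw1 : 1 ≤ w := Real.one_le_sqrt.2 (Real.one_le_sqrt.2 hT1)
  have hw2 : w ^ 2 = √T := Real.sq_sqrt (Real.sqrt_nonneg T)
  have hw4 : w ^ 4 = T := by
    rw [show w ^ 4 = (w ^ 2) ^ 2 by ring, hw2, Real.sq_sqrt hT]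
  have hlogT : Real.log T ≤ 4 * w := by
    rw [← hw4, Real.log_pow]
    have := Real.log_le_sub_one_of_pos (by linarith : 0 < w)
    push_cast
    linarith
  have h3 : T ≤ 100 * B * w ^ 2 := by
    refine h.trans ?_
    have : (2 + Real.log (2 + 24 * T)) ^ 2 ≤ (10 * w) ^ 2 := by
      gcongr; linarith
    nlinarith
  have h4 : w ^ 2 ≤ 100 * B := by
    rw [← hw4] at h3
    have h5 : w ^ 2 * w ^ 2 ≤ 100 * B * w ^ 2 := by nlinarith
    exact le_of_mul_le_mul_right h5 (by positivity)
  have h5 : T ≤ (100 * B) ^ 2 := by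
    rw [← hw4, show w ^ 4 = (w ^ 2) ^ 2 by ring]
    gcongr
  have h100 : Real.log 100 ≤ 5 := by
    rw [Real.log_le_iff_le_exp (by norm_num)]
    have : exp 5 = exp 1 ^ 5 := by rw [← Real.exp_nat_mul]; norm_num
    rw [this]
    calc (100 : ℝ) ≤ 2.7 ^ 5 := by norm_num
      _ ≤ _ := by gcongr; linarith
  have h6 : Real.log T ≤ 10 + 2 * Real.log B := by
    calc Real.log T ≤ Real.log ((100 * B) ^ 2) := Real.log_le_log hT0 h5
      _ = 2 * (Real.log 100 + Real.log B) := by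
        rw [Real.log_pow, Real.log_mul (by norm_num) (by linarith)]; norm_num
      _ ≤ _ := by linarith
  calc T ≤ B * (2 + Real.log (2 + 24 * T)) ^ 2 := h
    _ ≤ B * (16 * (1 + Real.log B)) ^ 2 := by
      gcongr; linarith
    _ = _ := by ring

lemma abs_log_one_add_le {t : ℝ} (ht : |t| ≤ 1 / 2) : |Real.log (1 + t)| ≤ 2 * |t| := by
  obtain ⟨h1, h2⟩ := abs_le.1 ht
  have hpos : 0 < 1 + t := by linarith
  have h3 := Real.log_le_sub_one_of_pos hpos
  have h4 := Real.one_sub_inv_le_log_of_pos hpos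
  have h5 : 1 - (1 + t)⁻¹ = t * (1 + t)⁻¹ := by field_simp; ring
  have h6 : (1 + t)⁻¹ ≤ 2 := by
    rw [inv_le_comm₀ hpos (by norm_num)]; linarith
  have h7 : |t * (1 + t)⁻¹| ≤ |t| * 2 := by
    rw [abs_mul, abs_of_pos (inv_pos.2 hpos)]
    gcongr
  rw [abs_le]
  constructor
  · have := neg_abs_le (t * (1 + t)⁻¹)
    linarith
  · have := le_abs_self t
    have := abs_nonneg t
    linarith

lemma pell_ne_zero {a b : ℕ} (hab : ¬ IsSquare (a * b)) {e : ℤ} {x y : ℕ} (hx : 0 < x)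
    (h : (a : ℤ) * (x : ℤ) ^ 2 - (b : ℤ) * (y : ℤ) ^ 2 = e) : e ≠ 0 := by
  rintro rfl
  have h1 : a * x ^ 2 = b * y ^ 2 := by
    have : (a : ℤ) * (x : ℤ) ^ 2 = (b : ℤ) * (y : ℤ) ^ 2 := by linarith
    exact_mod_cast this
  apply irrational_sqrt_natCast_iff.2 hab
  refine ⟨(b * y : ℚ) / x, ?_⟩
  have hxR : (0 : ℝ) < x := by exact_mod_cast hx
  push_cast
  rw [eq_comm, Real.sqrt_eq_iff_mul_self_eq (by positivity) (by positivity)]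
  have h2 : (a : ℝ) * x ^ 2 = b * y ^ 2 := by exact_mod_cast h1
  field_simp
  linear_combination (b : ℝ) * h2

/-- The element of norm one attached to a solution of a Pell equation. -/
lemma exists_pell_element {a b : ℕ} (ha : 0 < a) (hb : 0 < b) {e : ℤ} (he : e ≠ 0) {x y : ℕ}
    (hx : 0 < x) (hy : 0 < y) (h : (a : ℤ) * (x : ℤ) ^ 2 - (b : ℤ) * (y : ℤ) ^ 2 = e) :
    ∃ U σ : ℝ, IsNormOne (a * b) U ∧ IsIntegral ℤ ((e.natAbs : ℝ) * U) ∧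
      IsIntegral ℤ ((e.natAbs : ℝ) * U⁻¹) ∧ (x : ℝ) ^ 2 ≤ e.natAbs * U ∧ |σ| = 1 ∧
      4 * a * (x : ℝ) ^ 2 = e.natAbs * U * (1 + σ / U) ^ 2 := by
  have haR : (1 : ℝ) ≤ a := by exact_mod_cast ha
  have hbR : (0 : ℝ) < b := by exact_mod_cast hb
  have hxR : (0 : ℝ) < x := by exact_mod_cast hx
  have hyR : (0 : ℝ) < y := by exact_mod_cast hy
  have hE0 : e.natAbs ≠ 0 := Int.natAbs_ne_zero.2 he
  have hE : (0 : ℝ) < e.natAbs := by exact_mod_cast Nat.pos_of_ne_zero hE0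
  have hEQ : (e.natAbs : ℚ) ≠ 0 := by exact_mod_cast hE0
  have hEeR : (e.natAbs : ℝ) ^ 2 = (e : ℝ) ^ 2 := by
    rw [Nat.cast_natAbs, Int.cast_abs, sq_abs]
  have hEeQ : (e.natAbs : ℚ) ^ 2 = (e : ℚ) ^ 2 := by
    rw [Nat.cast_natAbs, Int.cast_abs, sq_abs]
  have hR : (a : ℝ) * (x : ℝ) ^ 2 - b * (y : ℝ) ^ 2 = e := by exact_mod_cast h
  have hQ : (a : ℚ) * (x : ℚ) ^ 2 - b * (y : ℚ) ^ 2 = e := by exact_mod_cast h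
  set E := e.natAbs with hEdef
  set s := √((a * b : ℕ) : ℝ) with hs
  have hs2 : s ^ 2 = a * b := by rw [hs, Real.sq_sqrt (by positivity)]; push_cast; rfl
  have hs0 : 0 ≤ s := Real.sqrt_nonneg _
  have hsint : IsIntegral ℤ s := biquadraticField.isIntegral_sqrt (a * b) ℤ
  set r : ℚ := (a * x ^ 2 + b * y ^ 2) / E with hr
  set t : ℚ := 2 * x * y / E with ht
  set U : ℝ := r + t * s with hU
  have hnorm : r ^ 2 - (a * b : ℕ) * t ^ 2 = 1 := by
    rw [hr, ht]; push_cast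
    field_simp
    linear_combination (a * x ^ 2 - b * y ^ 2 + e : ℚ) * hQ - hEeQ
  have hEU : E * U = a * x ^ 2 + b * y ^ 2 + 2 * x * y * s := by
    rw [hU, hr, ht]; push_cast; field_simp
  have hEU0 : 0 < E * U := by rw [hEU]; positivity
  have hU0 : 0 < U := pos_of_mul_pos_right hEU0 hE.le
  have hint : ∀ n : ℕ, IsIntegral ℤ (n : ℝ) := fun n =>
    isIntegral_algebraMap (R := ℤ) (A := ℝ) (x := (n : ℤ))
  have hE1 : E * U = ((a * x ^ 2 + b * y ^ 2 : ℕ) : ℝ) + ((2 * x * y : ℕ) : ℝ) * s := by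
    rw [hEU]; push_cast; ring
  have hE2 : E * U⁻¹ = ((a * x ^ 2 + b * y ^ 2 : ℕ) : ℝ) - ((2 * x * y : ℕ) : ℝ) * s := by
    rw [IsNormOne.inv_eq hU hnorm, hr, ht, ← hs]; push_cast; field_simp
  refine ⟨U, e / E, ⟨hU0, r, t, rfl, hnorm⟩, ?_, ?_, ?_, ?_, ?_⟩
  · rw [hE1]; exact (hint _).add ((hint _).mul hsint)
  · rw [hE2]; exact (hint _).sub ((hint _).mul hsint)
  · rw [hEU]
    have : (x : ℝ) ^ 2 ≤ a * x ^ 2 := le_mul_of_one_le_left (by positivity) haR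
    have : 0 ≤ (b : ℝ) * y ^ 2 + 2 * x * y * s := by positivity
    linarith
  · rw [abs_div, abs_of_pos hE, div_eq_one_iff_eq hE.ne', hEdef, Nat.cast_natAbs, Int.cast_abs]
  · have h1 : (E * U + e) ^ 2 = 4 * a * (x : ℝ) ^ 2 * (E * U) := by
      rw [hEU, ← hR]
      linear_combination (4 * (x : ℝ) ^ 2 * y ^ 2) * hs2
    have h2 : E * U * (1 + e / E / U) ^ 2 = (E * U + e) ^ 2 / (E * U) := by
      field_simp
    rw [h2, h1]
    field_simp

/-- Reduction of an element of norm one modulo the fundamental unit. -/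
lemma exists_reduction {m : ℕ} {ε U : ℝ} (hε : IsNormOneUnit m ε) (hε2 : 2 ≤ ε)
    (hU : IsNormOne m U) (hU1 : 1 ≤ U) {E : ℕ} (h1 : IsIntegral ℤ ((E : ℝ) * U))
    (h2 : IsIntegral ℤ ((E : ℝ) * U⁻¹)) :
    ∃ (n : ℕ) (μ : ℝ), U = ε ^ n * μ ∧ 1 ≤ μ ∧ μ < ε ∧ IsNormOne m μ ∧
      IsIntegral ℤ ((E : ℝ) * μ) ∧ IsIntegral ℤ ((E : ℝ) * μ⁻¹) ∧ (n : ℝ) ≤ 2 * Real.log U := by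
  obtain ⟨n, hn1, hn2⟩ := exists_nat_pow_near hU1 (by linarith : 1 < ε)
  have hε0 : 0 < ε := by linarith
  have hp : 0 < ε ^ n := pow_pos hε0 n
  refine ⟨n, U * (ε ^ n)⁻¹, ?_, ?_, ?_, ?_, ?_, ?_, ?_⟩
  · field_simp
  · rw [← div_eq_mul_inv, one_le_div hp]; exact hn1
  · rw [← div_eq_mul_inv, div_lt_iff₀ hp, ← pow_succ']; exact hn2
  · exact hU.mul (hε.pow n).1.inv
  · rw [← mul_assoc]; exact h1.mul (hε.pow n).2.2
  · rw [mul_inv, inv_inv, ← mul_assoc]; exact h2.mul (hε.pow n).2.1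
  · have h3 : n * Real.log ε ≤ Real.log U := by
      rw [← Real.log_pow]; exact Real.log_le_log hp hn1
    have h4 : Real.log 2 ≤ Real.log ε := Real.log_le_log (by norm_num) hε2
    have := Real.log_two_gt_d9
    have h5 : (0 : ℝ) ≤ n := Nat.cast_nonneg n
    nlinarith

lemma abs_linear_form_le {a c E F x U V σ τ : ℝ} (ha : 0 < a) (hc : 0 < c) (hE : 0 < E) (hF : 0 < F)
    (hU : 2 ≤ U) (hV : 2 ≤ V) (hσ : |σ| = 1) (hτ : |τ| = 1)
    (h1 : 4 * a * x ^ 2 = E * U * (1 + σ / U) ^ 2) (h2 : 4 * c * x ^ 2 = F * V * (1 + τ / V) ^ 2) :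
    |Real.log (c * E / (a * F)) + Real.log U - Real.log V| ≤ 4 / U + 4 / V := by
  have key : ∀ {σ U : ℝ}, 2 ≤ U → |σ| = 1 → |σ / U| ≤ 1 / 2 ∧ |Real.log (1 + σ / U)| ≤ 2 / U ∧
      0 < 1 + σ / U := by
    intro σ U hU hσ
    have hU0 : 0 < U := by linarith
    have h3 : |σ / U| = 1 / U := by rw [abs_div, hσ, abs_of_pos hU0]
    have h4 : |σ / U| ≤ 1 / 2 := by
      rw [h3]; exact one_div_le_one_div_of_le (by norm_num) hU
    refine ⟨h4, ?_, by linarith [(abs_le.1 h4).1]⟩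
    refine (abs_log_one_add_le h4).trans ?_
    rw [h3, mul_one_div]
  obtain ⟨-, hs1, hs2⟩ := key hU hσ
  obtain ⟨-, ht1, ht2⟩ := key hV hτ
  have hU0 : 0 < U := by linarith
  have hV0 : 0 < V := by linarith
  have h3 : a * (F * V * (1 + τ / V) ^ 2) = c * (E * U * (1 + σ / U) ^ 2) := by
    rw [← h1, ← h2]; ring
  have h4 := congrArg Real.log h3
  rw [Real.log_mul ha.ne' (by positivity), Real.log_mul (by positivity) (by positivity),
    Real.log_mul hF.ne' hV0.ne', Real.log_pow, Real.log_mul hc.ne' (by positivity),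
    Real.log_mul (by positivity) (by positivity), Real.log_mul hE.ne' hU0.ne', Real.log_pow] at h4
  push_cast at h4
  have h5 : Real.log (c * E / (a * F)) + Real.log U - Real.log V =
      2 * Real.log (1 + τ / V) - 2 * Real.log (1 + σ / U) := by
    rw [Real.log_div (by positivity) (by positivity), Real.log_mul hc.ne' hE.ne',
      Real.log_mul ha.ne' hF.ne']
    linarith
  rw [h5]
  refine (abs_sub _ _).trans ?_
  rw [abs_mul, abs_mul, abs_two]
  have : 4 / U + 4 / V = 2 * (2 / V) + 2 * (2 / U) := by ring
  rw [this]
  gcongr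

lemma exists_log_le_of_le_mul_ceil_sq {C₀ : ℝ} (hC₀ : 0 < C₀) : ∃ C : ℝ, 0 < C ∧
    ∀ α γ H L : ℝ, 2 ≤ α → 0 < H → H ≤ 1202 * γ → 0 ≤ L →
      L ≤ C₀ * (600 * (α * Real.log α) * (600 * (α * Real.log α)) * H) *
        (⌈Real.log (2 + 24 * (L / H))⌉₊ : ℝ) ^ 2 →
      L ≤ C * α ^ 2 * Real.log α ^ 4 * γ := by
  set C₁ := C₀ + 1 with hC₁
  have hC₁0 : 0 ≤ Real.log C₁ := Real.log_nonneg (by linarith)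
  set M := 30 + 2 * Real.log C₁ with hM
  refine ⟨1202 * 256 * C₁ * 600 ^ 2 * M ^ 2, by positivity, ?_⟩
  intro α γ H L hα hH hHγ hL h
  have hl2 := Real.log_two_gt_d9
  have hlα : Real.log 2 ≤ Real.log α := Real.log_le_log (by norm_num) hα
  have hla0 : 0 < Real.log α := by linarith
  set A := 600 * (α * Real.log α) with hA
  have hA1 : 1 ≤ A := by nlinarith
  set T := L / H with hT
  have hT0 : 0 ≤ T := by positivity
  have hlT : 0 ≤ Real.log (2 + 24 * T) := Real.log_nonneg (by linarith)
  have hceil : (⌈Real.log (2 + 24 * T)⌉₊ : ℝ) ≤ 2 + Real.log (2 + 24 * T) := by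
    linarith [Nat.ceil_lt_add_one hlT]
  have h1 : T ≤ C₁ * A ^ 2 * (2 + Real.log (2 + 24 * T)) ^ 2 := by
    rw [hT, div_le_iff₀ hH]
    refine h.trans ?_
    calc C₀ * (A * A * H) * (⌈Real.log (2 + 24 * T)⌉₊ : ℝ) ^ 2
        ≤ C₁ * (A * A * H) * (2 + Real.log (2 + 24 * T)) ^ 2 := by
          gcongr; linarith
      _ = _ := by ring
  have hB : 1 ≤ C₁ * A ^ 2 := by
    have h2 : 1 ≤ A ^ 2 := one_le_pow₀ hA1
    nlinarith
  have h2 := le_of_le_mul_log_sq hT0 hB h1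
  have hlogA : Real.log A ≤ 7 + 2 * Real.log α := by
    have h600 : Real.log 600 ≤ 7 := by
      rw [Real.log_le_iff_le_exp (by norm_num)]
      have : exp 7 = exp 1 ^ 7 := by rw [← Real.exp_nat_mul]; norm_num
      rw [this]
      have he := Real.exp_one_gt_d9
      calc (600 : ℝ) ≤ 2.7 ^ 7 := by norm_num
        _ ≤ _ := by gcongr; linarith
    have hll : Real.log (Real.log α) ≤ Real.log α := Real.log_le_self hla0.le
    rw [hA, Real.log_mul (by norm_num) (by positivity), Real.log_mul (by positivity) hla0.ne']
    linarith
  have hlogB : 1 + Real.log (C₁ * A ^ 2) ≤ M * Real.log α := by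
    rw [Real.log_mul (by positivity) (by positivity), Real.log_pow, hM]
    push_cast
    nlinarith
  have hlB : 0 ≤ Real.log (C₁ * A ^ 2) := Real.log_nonneg hB
  have h3 : L = H * T := by rw [hT]; field_simp
  have hγ : 0 ≤ γ := by linarith
  calc L = H * T := h3
    _ ≤ 1202 * γ * (256 * (C₁ * A ^ 2) * (M * Real.log α) ^ 2) := by
      gcongr
      refine h2.trans ?_
      gcongr
    _ = _ := by rw [hA]; ring

/-- The linear form attached to two fundamental units and a further, nontrivial number. -/
lemma exists_exp_neg_lt_abs_log_sub : ∃ C : ℝ, 0 < C ∧ ∀ m m' : ℕ, ¬ IsSquare m → ¬ IsSquare m' →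
    ¬ IsSquare (m * m') → ∀ (ε η μ ν : ℝ) (q : ℚ) (A H : ℝ) (D : ℕ),
    IsNormOneUnit m ε → IsNormOneUnit m' η → 1 < ε → 1 < η → Real.log ε ≤ A → Real.log η ≤ A →
    1 ≤ A → 1 ≤ H → 0 < q → IsNormOne m μ → IsNormOne m' ν →
    |Real.log (q : ℝ)| + |Real.log μ| + |Real.log ν| ≤ H → 0 < D → (D : ℝ) ≤ exp H →
    IsIntegral ℤ ((D : ℝ) * (q * μ * ν)) → IsIntegral ℤ ((D : ℝ) * (q * μ * ν)⁻¹) →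
    (IsNormOneUnit m μ → μ = 1) → (IsNormOneUnit m' ν → ν = 1) → ¬ (q = 1 ∧ μ = 1 ∧ ν = 1) →
    ∀ (j k : ℤ) (s : ℕ), 0 < s → |(j : ℝ)| / H + 2 ≤ exp s → |(k : ℝ)| / H + 2 ≤ exp s →
      exp (-(C * (A * A * H) * s ^ 2)) <
        |Real.log (q * μ * ν) - (j * Real.log ε + k * Real.log η)| := by
  obtain ⟨C, hC, h⟩ := exists_exp_neg_lt_abs_log_sub_biquadratic
  refine ⟨C, hC, ?_⟩
  intro m m' hm hm' hmm' ε η μ ν q A H D hε hη hε1 hη1 hεA hηA hA hH hq hμ hν hlog hD hDH hI hI'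
    hμ1 hν1 hne j k s hs hj hk
  have hε0 : 0 < ε := by linarith
  have hη0 : 0 < η := by linarith
  have hA1 : 1 / A ≤ 1 := (div_le_one (by linarith)).2 hA
  have := h m m' hm hm' hmm' ![1, 1, q] ![ε, 1, μ] ![1, η, ν] ![A, A, H] ![1, 1, D]
    (by simp [Fin.forall_fin_succ, hq]) (by simp [Fin.forall_fin_succ, hε.1, hμ, IsNormOne.one])
    (by simp [Fin.forall_fin_succ, hη.1, hν, IsNormOne.one])
    (by simp [Fin.forall_fin_succ, hA, hH])
    (by
      simp only [Fin.forall_fin_succ]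
      simpa [abs_of_pos (Real.log_pos hε1), abs_of_pos (Real.log_pos hη1), hεA, hηA] using hlog)
    (by simp [Fin.forall_fin_succ, hD])
    (by
      simp [Fin.forall_fin_succ, hDH]
      linarith)
    (by simpa [Fin.forall_fin_succ, hε.2.1, hη.2.1] using hI)
    (by simpa [Fin.forall_fin_succ, hε.2.2, hη.2.2] using hI')
    (by
      intro n h1 h2 h3
      simp [Fin.prod_univ_three] at h1 h2 h3
      have hzpow : ∀ {ξ : ℝ} {i : ℤ}, 1 < ξ → ξ ^ i = 1 → i = 0 := by
        intro ξ i hξ hi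
        rcases (zpow_eq_one_iff_cases₀ (a := ξ) (n := i)).1 hi with h | h | h
        · exact h
        · linarith
        · linarith [h.1]
      have hn2 : n 2 = 0 := by
        by_contra hn2
        refine hne ⟨?_, ?_, ?_⟩
        · rcases (zpow_eq_one_iff_cases₀ (a := q) (n := n 2)).1 h1 with h | h | h
          · exact absurd h hn2
          · exact h
          · linarith [h.1]
        · apply hμ1
          apply IsNormOneUnit.of_zpow hμ hn2
          rw [eq_inv_of_mul_eq_one_right h2]
          exact (hε.zpow _).inv
        · apply hν1
          apply IsNormOneUnit.of_zpow hν hn2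
          rw [eq_inv_of_mul_eq_one_right h3]
          exact (hη.zpow _).inv
      rw [hn2, zpow_zero, mul_one] at h2 h3
      funext i
      fin_cases i
      · exact hzpow hε1 h2
      · exact hzpow hη1 h3
      · exact hn2)
    ![1, 0, j] ![0, 1, k] (Real.log ε) (Real.log η) s hs
    (by
      simp [Fin.sum_univ_three]
      rw [← one_div]
      linarith)
    (by
      simp [Fin.sum_univ_three]
      rw [← one_div]
      linarith)
  simpa [Fin.exists_fin_succ, (exp_pos _).not_gt] using this

/-- The linear form attached to two fundamental units. -/
lemma exists_exp_neg_lt_abs_mul_log_sub_mul_log : ∃ C : ℝ, 0 < C ∧ ∀ m m' : ℕ, ¬ IsSquare m →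
    ¬ IsSquare m' → ¬ IsSquare (m * m') → ∀ (ε η A : ℝ),
    IsNormOneUnit m ε → IsNormOneUnit m' η → 1 < ε → 1 < η → Real.log ε ≤ A → Real.log η ≤ A →
    1 ≤ A → ∀ (j k s : ℕ), 0 < s → 0 < k → (j : ℝ) / A + k / A + 2 ≤ exp s →
      exp (-(C * (A * A * A) * s ^ 2)) < |j * Real.log ε - k * Real.log η| := by
  obtain ⟨C, hC, h⟩ := exists_exp_neg_lt_abs_log_sub_biquadratic
  refine ⟨C, hC, ?_⟩
  intro m m' hm hm' hmm' ε η A hε hη hε1 hη1 hεA hηA hA j k s hs hk hjk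
  have hε0 : 0 < ε := by linarith
  have hη0 : 0 < η := by linarith
  have hkR : (1 : ℝ) ≤ k := by exact_mod_cast hk
  have hA1 : 1 / A ≤ 1 := (div_le_one (by linarith)).2 hA
  have hl2 := Real.log_two_lt_d9
  have hl2' : 0 < Real.log 2 := Real.log_pos (by norm_num)
  have hint2 : IsIntegral ℤ (2 : ℝ) :=
    isIntegral_algebraMap (R := ℤ) (A := ℝ) (x := 2)
  have hjA : 0 ≤ (j : ℝ) / A := by positivity
  have hkA : 0 ≤ (k : ℝ) / A := by positivity
  have := h m m' hm hm' hmm' ![1, 1, 2] ![ε, 1, 1] ![1, η, 1] ![A, A, A] ![1, 1, 2]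
    (by simp [Fin.forall_fin_succ]) (by simp [Fin.forall_fin_succ, hε.1, IsNormOne.one])
    (by simp [Fin.forall_fin_succ, hη.1, IsNormOne.one])
    (by simp [Fin.forall_fin_succ, hA])
    (by
      simp [Fin.forall_fin_succ, abs_of_pos (Real.log_pos hε1), abs_of_pos (Real.log_pos hη1),
        hεA, hηA, abs_of_pos hl2']
      linarith)
    (by simp [Fin.forall_fin_succ])
    (by
      simp [Fin.forall_fin_succ]
      have := Real.add_one_le_exp A
      constructor <;> linarith)
    (by simpa [Fin.forall_fin_succ, hε.2.1, hη.2.1, isIntegral_one] using hint2.mul hint2)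
    (by simp [Fin.forall_fin_succ, hε.2.2, hη.2.2, isIntegral_one])
    (by
      intro n h1 h2 h3
      simp [Fin.prod_univ_three] at h1 h2 h3
      funext i
      have hzpow : ∀ {ξ : ℝ} {i : ℤ}, 1 < ξ → ξ ^ i = 1 → i = 0 := by
        intro ξ i hξ hi
        rcases (zpow_eq_one_iff_cases₀ (a := ξ) (n := i)).1 hi with h | h | h
        · exact h
        · linarith
        · linarith [h.1]
      fin_cases i
      · exact hzpow hε1 h2
      · exact hzpow hη1 h3
      · rcases (zpow_eq_one_iff_cases₀ (a := (2 : ℚ)) (n := n 2)).1 h1 with h | h | h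
        · exact h
        · norm_num at h
        · norm_num at h)
    ![k, j, 0] ![0, 0, 1] (Real.log ε / k) (Real.log 2) s hs
    (by
      simp [Fin.sum_univ_three]
      linarith)
    (by
      simp [Fin.sum_univ_three]
      rw [← one_div]
      linarith)
  have hk0 : (k : ℝ) ≠ 0 := by positivity
  have h4 : exp (-(C * (A * A * A) * s ^ 2)) < |Real.log η - j * (Real.log ε / k)| := by
    simpa [Fin.exists_fin_succ, (exp_pos _).not_gt, mul_div_cancel₀ _ hk0] using this
  refine h4.trans_le ?_
  have h5 : Real.log η - j * (Real.log ε / k) = -(j * Real.log ε - k * Real.log η) / k := by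
    field_simp; ring
  rw [h5, abs_div, abs_neg, abs_of_pos (by linarith : (0 : ℝ) < k)]
  exact div_le_self (abs_nonneg _) hkR

lemma pell_element_bounds {a α β E U σ x : ℝ} (haα : a ≤ α) (hα : 2 ≤ α) (hE : 1 ≤ E)
    (hEβ : E ≤ β) (hx : 16 * α * β ≤ x) (h1 : x ^ 2 ≤ E * U) (hσ : |σ| = 1)
    (h2 : 4 * a * x ^ 2 = E * U * (1 + σ / U) ^ 2) :
    32 * x ≤ U ∧ Real.log U ≤ 3 * Real.log x := by
  have hβ : 1 ≤ β := hE.trans hEβ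
  have h16 : 16 * α ≤ x := le_trans (le_mul_of_one_le_right (by linarith) hβ) hx
  have h32 : 32 * β ≤ x := by nlinarith
  have hx0 : 0 < x := by linarith
  have hU0 : 0 < U := by
    by_contra! h
    nlinarith [pow_pos hx0 2]
  have h3 : 32 * x ≤ U := by
    have : β * (32 * x) ≤ β * U := by nlinarith
    exact le_of_mul_le_mul_left this (by linarith)
  refine ⟨h3, ?_⟩
  have h4 : |σ / U| ≤ 1 / 2 := by
    rw [abs_div, hσ, abs_of_pos hU0]
    exact one_div_le_one_div_of_le (by norm_num) (by linarith)
  have h5 : 1 / 4 ≤ (1 + σ / U) ^ 2 := by nlinarith [(abs_le.1 h4).1]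
  have h6 : U ≤ x ^ 3 := by
    have h7 : U * (1 / 4) ≤ E * U * (1 + σ / U) ^ 2 := by
      calc U * (1 / 4) ≤ (E * U) * (1 / 4) := by nlinarith
        _ ≤ _ := by gcongr
    rw [← h2] at h7
    calc U ≤ 16 * a * x ^ 2 := by linarith
      _ ≤ 16 * α * x ^ 2 := by gcongr
      _ ≤ x * x ^ 2 := by gcongr
      _ = _ := by ring
  calc Real.log U ≤ Real.log (x ^ 3) := Real.log_le_log hU0 h6
    _ = _ := by rw [Real.log_pow]; norm_num

lemma log_fundamental_unit_le {a b : ℕ} {ε α : ℝ} (ha : 0 < a) (hb : 0 < b) (haα : (a : ℝ) ≤ α)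
    (hbα : (b : ℝ) ≤ α)
    (h : Real.log ε ≤ 300 * (√((a * b : ℕ) : ℝ) * Real.log (a * b : ℕ))) :
    Real.log ε ≤ 600 * (α * Real.log α) := by
  have haR : (1 : ℝ) ≤ a := by exact_mod_cast ha
  have hbR : (1 : ℝ) ≤ b := by exact_mod_cast hb
  have hab : ((a * b : ℕ) : ℝ) ≤ α ^ 2 := by
    push_cast; rw [sq]; gcongr; linarith
  have hab1 : (1 : ℝ) ≤ ((a * b : ℕ) : ℝ) := by
    exact_mod_cast Nat.mul_pos ha hb
  have h1 : √((a * b : ℕ) : ℝ) ≤ α := Real.sqrt_le_iff.2 ⟨by linarith, hab⟩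
  have h2 : Real.log (a * b : ℕ) ≤ 2 * Real.log α := by
    calc Real.log (a * b : ℕ) ≤ Real.log (α ^ 2) := Real.log_le_log (by linarith) hab
      _ = _ := by rw [Real.log_pow]; norm_num
  refine h.trans ?_
  calc 300 * (√((a * b : ℕ) : ℝ) * Real.log (a * b : ℕ))
      ≤ 300 * (α * (2 * Real.log α)) := by
        gcongr
        linarith
    _ = _ := by ring

lemma abs_log_ratio_le {a c E F α β : ℝ} (ha : 1 ≤ a) (hc : 1 ≤ c) (hE : 1 ≤ E) (hF : 1 ≤ F)
    (haα : a ≤ α) (hcα : c ≤ α) (hEβ : E ≤ β) (hFβ : F ≤ β) :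
    |Real.log (c * E / (a * F))| ≤ Real.log α + Real.log β := by
  rw [Real.log_div (by positivity) (by positivity), Real.log_mul (by positivity) (by positivity),
    Real.log_mul (by positivity) (by positivity)]
  have h1 := Real.log_le_log (by linarith) haα
  have h2 := Real.log_le_log (by linarith) hcα
  have h3 := Real.log_le_log (by linarith) hEβ
  have h4 := Real.log_le_log (by linarith) hFβ
  have h5 := Real.log_nonneg ha
  have h6 := Real.log_nonneg hc
  have h7 := Real.log_nonneg hE
  have h8 := Real.log_nonneg hF
  rw [abs_le]
  constructor <;> linarith

set_option maxHeartbeats 800000 in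
/-- The bound in the generic case of independent quadratic fields. -/
lemma exists_log_le_of_not_isSquare : ∃ C : ℝ, 0 < C ∧ ∀ (a b c d : ℕ) (e f : ℤ), 0 < a → 0 < b →
    0 < c → 0 < d → ¬ IsSquare (a * b) → ¬ IsSquare (c * d) → ¬ IsSquare (a * b * (c * d)) →
    ∀ x y z : ℕ, 0 < x → 0 < y → 0 < z → (a : ℤ) * (x : ℤ) ^ 2 - (b : ℤ) * (y : ℤ) ^ 2 = e →
    (c : ℤ) * (x : ℤ) ^ 2 - (d : ℤ) * (z : ℤ) ^ 2 = f → ∀ α β γ : ℝ, (a : ℝ) ≤ α → (b : ℝ) ≤ α →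
    (c : ℝ) ≤ α → (d : ℝ) ≤ α → 2 ≤ α → |(e : ℝ)| ≤ β → |(f : ℝ)| ≤ β → α * Real.log α ≤ γ →
    Real.log β ≤ γ → 1 ≤ γ → 16 * α * β ≤ x → Real.log x ≤ C * α ^ 2 * Real.log α ^ 4 * γ := by
  obtain ⟨C₁, hC₁, hA⟩ := exists_exp_neg_lt_abs_log_sub
  obtain ⟨C₂, hC₂, hB⟩ := exists_exp_neg_lt_abs_mul_log_sub_mul_log
  obtain ⟨C, hC, hfin⟩ := exists_log_le_of_le_mul_ceil_sq (C₀ := C₁ + C₂) (by linarith)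
  refine ⟨C, hC, ?_⟩
  intro a b c d e f ha hb hc hd hab hcd habcd x y z hx hy hz hxy hxz α β γ haα hbα hcα hdα hα
    heβ hfβ hγα hγβ hγ hxαβ
  have he := pell_ne_zero hab hx hxy
  have hf := pell_ne_zero hcd hx hxz
  obtain ⟨U, σ, hU, hEU, hEU', hxU, hσ, hUσ⟩ := exists_pell_element ha hb he hx hy hxy
  obtain ⟨V, τ, hV, hFV, hFV', hxV, hτ, hVτ⟩ := exists_pell_element hc hd hf hx hz hxz
  have hE1 : 0 < e.natAbs := Int.natAbs_pos.2 he
  have hF1 : 0 < f.natAbs := Int.natAbs_pos.2 hf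
  have hEβ : (e.natAbs : ℝ) ≤ β := by rwa [Nat.cast_natAbs, Int.cast_abs]
  have hFβ : (f.natAbs : ℝ) ≤ β := by rwa [Nat.cast_natAbs, Int.cast_abs]
  generalize e.natAbs = E at *
  generalize f.natAbs = F at *
  have hE1R : (1 : ℝ) ≤ E := by exact_mod_cast hE1
  have hF1R : (1 : ℝ) ≤ F := by exact_mod_cast hF1
  have ha1R : (1 : ℝ) ≤ a := by exact_mod_cast ha
  have hc1R : (1 : ℝ) ≤ c := by exact_mod_cast hc
  obtain ⟨hU32, hlogU⟩ := pell_element_bounds haα hα hE1R hEβ hxαβ hxU hσ hUσ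
  obtain ⟨hV32, hlogV⟩ := pell_element_bounds hcα hα hF1R hFβ hxαβ hxV hτ hVτ
  have hx1R : (1 : ℝ) ≤ x := by exact_mod_cast hx
  have hlog := abs_linear_form_le (by linarith) (by linarith) (by linarith) (by linarith)
    (by linarith) (by linarith) hσ hτ hUσ hVτ
  obtain ⟨ε, hε, hε2, hεlog, hεmin⟩ := exists_fundamental_unit hab
  obtain ⟨η, hη, hη2, hηlog, hηmin⟩ := exists_fundamental_unit hcd
  obtain ⟨m, μ, hUμ, hμ1, hμε, hμ, hEμ, hEμ', hm⟩ :=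
    exists_reduction hε hε2 hU (by linarith) hEU hEU'
  obtain ⟨n, ν, hVν, hν1, hνη, hν, hFν, hFν', hn⟩ :=
    exists_reduction hη hη2 hV (by linarith) hFV hFV'
  replace hεlog := log_fundamental_unit_le ha hb haα hbα hεlog
  replace hηlog := log_fundamental_unit_le hc hd hcα hdα hηlog
  have hl2 := Real.log_two_gt_d9
  have hlα : Real.log 2 ≤ Real.log α := Real.log_le_log (by norm_num) hα
  set A := 600 * (α * Real.log α) with hAdef
  have hA1 : 1 ≤ A := by nlinarith
  have hsmall : |Real.log (c * E / (a * F)) + Real.log U - Real.log V| ≤ exp (-Real.log x) := by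
    refine hlog.trans ?_
    rw [Real.exp_neg, Real.exp_log (by linarith)]
    have h1 : 4 / U ≤ 4 / (32 * x) := by gcongr
    have h2 : 4 / V ≤ 4 / (32 * x) := by gcongr
    have h3 : 4 / (32 * (x : ℝ)) = (x : ℝ)⁻¹ * (1 / 8) := by field_simp; norm_num
    have h4 : (0 : ℝ) < (x : ℝ)⁻¹ := by positivity
    linarith
  have hlogU' : Real.log U = m * Real.log ε + Real.log μ := by
    rw [hUμ, Real.log_mul (by positivity) (by linarith), Real.log_pow]
  have hlogV' : Real.log V = n * Real.log η + Real.log ν := by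
    rw [hVν, Real.log_mul (by positivity) (by linarith), Real.log_pow]
  rw [hlogU', hlogV'] at hsmall
  have hL : 0 ≤ Real.log x := Real.log_nonneg hx1R
  have hs : ∀ H : ℝ, 0 < H → 0 < ⌈Real.log (2 + 24 * (Real.log x / H))⌉₊ ∧
      2 + 24 * (Real.log x / H) ≤ exp (⌈Real.log (2 + 24 * (Real.log x / H))⌉₊ : ℝ) := by
    intro H hH
    have h0 : 0 ≤ Real.log x / H := by positivity
    refine ⟨Nat.ceil_pos.2 (Real.log_pos (by linarith)), ?_⟩
    rw [← Real.log_le_iff_le_exp (by linarith)]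
    exact Nat.le_ceil _
  have hm6 : (m : ℝ) ≤ 6 * Real.log x := by linarith
  have hn6 : (n : ℝ) ≤ 6 * Real.log x := by linarith
  have hμ0 : 0 < μ := by linarith
  have hν0 : 0 < ν := by linarith
  have hqR : ((c * E / (a * F) : ℚ) : ℝ) = c * E / (a * F) := by push_cast; rfl
  by_cases hne : (c * E / (a * F) : ℚ) = 1 ∧ μ = 1 ∧ ν⁻¹ = 1
  · obtain ⟨hq, hμ', hν'⟩ := hne
    rw [inv_eq_one] at hν'
    have hq' : (c * E / (a * F) : ℝ) = 1 := by rw [← hqR, hq, Rat.cast_one]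
    rw [hq', hμ', hν', Real.log_one, add_zero, add_zero, zero_add] at hsmall
    have hn0 : 0 < n := by
      rcases Nat.eq_zero_or_pos n with h | h
      · rw [h, hν'] at hVν; norm_num at hVν; linarith
      · exact h
    obtain ⟨hs1, hs2⟩ := hs A (by linarith)
    have h1 := hB (a * b) (c * d) hab hcd habcd ε η A hε hη (by linarith) (by linarith) hεlog hηlog
      hA1 m n _ hs1 hn0 (by
        refine le_trans ?_ hs2
        have h3 : (m : ℝ) / A ≤ 6 * Real.log x / A := by gcongr
        have h4 : (n : ℝ) / A ≤ 6 * Real.log x / A := by gcongr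
        have h5 : 0 ≤ Real.log x / A := by positivity
        rw [mul_div_assoc] at h3 h4
        linarith)
    have h2 := Real.exp_lt_exp.1 (h1.trans_le hsmall)
    refine hfin α γ A _ hα (by linarith) (by linarith) hL ?_
    refine (neg_lt_neg_iff.1 h2).le.trans ?_
    gcongr
    linarith
  · obtain ⟨hs1, hs2⟩ := hs (1202 * γ) (by linarith)
    have hlμ : |Real.log μ| ≤ A := by
      rw [abs_of_nonneg (Real.log_nonneg hμ1)]
      exact (Real.log_le_log hμ0 hμε.le).trans hεlog
    have hlν : |Real.log ν⁻¹| ≤ A := by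
      rw [Real.log_inv, abs_neg, abs_of_nonneg (Real.log_nonneg hν1)]
      exact (Real.log_le_log hν0 hνη.le).trans hηlog
    have hlq := abs_log_ratio_le ha1R hc1R hE1R hF1R haα hcα hEβ hFβ
    have h2α : 2 * Real.log α ≤ γ := le_trans (by gcongr; linarith) hγα
    have hβ1 : 1 ≤ β := hE1R.trans hEβ
    have hβ0 : 0 ≤ Real.log β := Real.log_nonneg hβ1
    have hint : ∀ n : ℕ, IsIntegral ℤ (n : ℝ) := fun n =>
      isIntegral_algebraMap (R := ℤ) (A := ℝ) (x := (n : ℤ))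
    have h1 := hA (a * b) (c * d) hab hcd habcd ε η μ ν⁻¹ (c * E / (a * F)) A (1202 * γ)
      (a * c * E ^ 2 * F ^ 2) hε hη (by linarith) (by linarith) hεlog hηlog hA1 (by linarith)
      (by positivity) hμ hν.inv
      (by rw [hqR]; linarith)
      (by positivity)
      (by
        have h3 : ((a * c * E ^ 2 * F ^ 2 : ℕ) : ℝ) ≤ α * α * β ^ 2 * β ^ 2 := by
          push_cast; gcongr
        refine h3.trans ?_
        rw [← Real.log_le_iff_le_exp (by positivity), Real.log_mul (by positivity) (by positivity),
          Real.log_mul (by positivity) (by positivity), Real.log_mul (by positivity) (by positivity),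
          Real.log_pow]
        push_cast
        linarith)
      (by
        have h3 : ((a * c * E ^ 2 * F ^ 2 : ℕ) : ℝ) * ((c * E / (a * F) : ℚ) * μ * ν⁻¹) =
            ((c ^ 2 * E ^ 2 : ℕ) : ℝ) * ((E * μ) * (F * ν⁻¹)) := by
          push_cast; field_simp
        rw [h3]
        exact (hint _).mul (hEμ.mul hFν'))
      (by
        have h3 : ((a * c * E ^ 2 * F ^ 2 : ℕ) : ℝ) * ((c * E / (a * F) : ℚ) * μ * ν⁻¹)⁻¹ =
            ((a ^ 2 * F ^ 2 : ℕ) : ℝ) * ((E * μ⁻¹) * (F * ν)) := by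
          push_cast; field_simp
        rw [h3]
        exact (hint _).mul (hEμ'.mul hFν))
      (fun h => hεmin μ h hμ1 hμε)
      (fun h => by
        have h3 := h.inv
        rw [inv_inv] at h3
        rw [hηmin ν h3 hν1 hνη, inv_one])
      hne (-m) n _ hs1
      (by
        refine le_trans ?_ hs2
        have h3 : |((-m : ℤ) : ℝ)| / (1202 * γ) ≤ 6 * Real.log x / (1202 * γ) := by
          push_cast; rw [abs_neg, Nat.abs_cast]; gcongr
        have h5 : 0 ≤ Real.log x / (1202 * γ) := by positivity
        rw [mul_div_assoc] at h3
        linarith)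
      (by
        refine le_trans ?_ hs2
        have h3 : |((n : ℤ) : ℝ)| / (1202 * γ) ≤ 6 * Real.log x / (1202 * γ) := by
          push_cast; rw [Nat.abs_cast]; gcongr
        have h5 : 0 ≤ Real.log x / (1202 * γ) := by positivity
        rw [mul_div_assoc] at h3
        linarith)
    have h4 : Real.log ((c * E / (a * F) : ℚ) * μ * ν⁻¹) -
        (((-m : ℤ) : ℝ) * Real.log ε + ((n : ℤ) : ℝ) * Real.log η) =
        Real.log (c * E / (a * F)) + (m * Real.log ε + Real.log μ) -
          (n * Real.log η + Real.log ν) := by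
      rw [hqR, Real.log_mul (by positivity) (by positivity),
        Real.log_mul (by positivity) (by positivity), Real.log_inv]
      push_cast
      ring
    rw [h4] at h1
    have h2 := Real.exp_lt_exp.1 (h1.trans_le hsmall)
    refine hfin α γ (1202 * γ) _ hα (by linarith) le_rfl hL ?_
    refine (neg_lt_neg_iff.1 h2).le.trans ?_
    gcongr
    linarith

/-- When the two quadratic fields coincide, the system has only small solutions. -/
lemma mul_sq_le_of_isSquare {a b c d e f x y z : ℤ} (h : IsSquare (a * b * c * d))
    (hne : a * f ≠ c * e) (h1 : a * x ^ 2 - b * y ^ 2 = e) (h2 : c * x ^ 2 - d * z ^ 2 = f) :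
    2 * a * c * x ^ 2 ≤ (a * f - c * e) ^ 2 + |a * f + c * e| := by
  obtain ⟨w, hw⟩ := h
  set X := 2 * a * c * x ^ 2 - (a * f + c * e) with hX
  set Y := 2 * w * y * z with hY
  have hXY : X ^ 2 - Y ^ 2 = (a * f - c * e) ^ 2 := by
    rw [hX, hY, ← h1, ← h2]
    linear_combination (4 * y ^ 2 * z ^ 2) * hw
  have hD : 0 < (a * f - c * e) ^ 2 := by
    have : a * f - c * e ≠ 0 := sub_ne_zero.2 hne
    positivity
  have h3 : |Y| < |X| := by rw [← sq_lt_sq]; linarith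
  have h4 : |X| ≤ (a * f - c * e) ^ 2 := by
    rw [← hXY, ← sq_abs X, ← sq_abs Y]
    nlinarith [abs_nonneg Y]
  have h5 := le_abs_self X
  have h6 := le_abs_self (a * f + c * e)
  linarith

lemma lt_of_isSquare {a b c d : ℕ} {e f : ℤ} {x y z : ℕ} (ha : 0 < a) (hc : 0 < c)
    (h : IsSquare (a * b * c * d)) (hne : (a : ℤ) * f ≠ c * e)
    (h1 : (a : ℤ) * (x : ℤ) ^ 2 - (b : ℤ) * (y : ℤ) ^ 2 = e)
    (h2 : (c : ℤ) * (x : ℤ) ^ 2 - (d : ℤ) * (z : ℤ) ^ 2 = f) {α β : ℝ} (haα : (a : ℝ) ≤ α)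
    (hcα : (c : ℝ) ≤ α) (hβ : 1 ≤ β) (heβ : |(e : ℝ)| ≤ β) (hfβ : |(f : ℝ)| ≤ β) :
    (x : ℝ) < 16 * α * β := by
  have h3 := mul_sq_le_of_isSquare (by simpa using h.map (Nat.castRingHom ℤ)) hne h1 h2
  have h4 : 2 * (a : ℝ) * c * (x : ℝ) ^ 2 ≤ (a * f - c * e) ^ 2 + |(a : ℝ) * f + c * e| := by
    exact_mod_cast h3
  have haR : (1 : ℝ) ≤ a := by exact_mod_cast ha
  have hcR : (1 : ℝ) ≤ c := by exact_mod_cast hc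
  have hα0 : 0 ≤ α := by linarith
  have haf : |(a : ℝ) * f| ≤ α * β := by
    rw [abs_mul, Nat.abs_cast]; gcongr
  have hce : |(c : ℝ) * e| ≤ α * β := by
    rw [abs_mul, Nat.abs_cast]; gcongr
  have h5 : |(a : ℝ) * f + c * e| ≤ 2 * (α * β) := (abs_add_le _ _).trans (by linarith)
  have h6 : ((a : ℝ) * f - c * e) ^ 2 ≤ (2 * (α * β)) ^ 2 := by
    rw [← sq_abs]
    have := abs_sub (a * f : ℝ) (c * e)
    gcongr
    linarith
  have hαβ : 1 ≤ α * β := one_le_mul_of_one_le_of_one_le (haR.trans haα) hβ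
  have hac : 1 ≤ (a : ℝ) * c := one_le_mul_of_one_le_of_one_le haR hcR
  have h7 : (x : ℝ) ^ 2 ≤ a * c * (x : ℝ) ^ 2 := le_mul_of_one_le_left (by positivity) hac
  have h8 : (x : ℝ) ^ 2 < (16 * α * β) ^ 2 := by nlinarith
  exact lt_of_pow_lt_pow_left₀ 2 (by linarith) h8

lemma pell_le {a b : ℕ} {e : ℤ} {x y : ℕ} (hb : 0 < b)
    (h : (a : ℤ) * (x : ℤ) ^ 2 - (b : ℤ) * (y : ℤ) ^ 2 = e) {α β : ℝ} (haα : (a : ℝ) ≤ α)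
    (hα : 1 ≤ α) (hβ : 1 ≤ β) (heβ : |(e : ℝ)| ≤ β) : (y : ℝ) ≤ α * x + β := by
  have h1 : (a : ℝ) * (x : ℝ) ^ 2 - b * (y : ℝ) ^ 2 = e := by exact_mod_cast h
  have hbR : (1 : ℝ) ≤ b := by exact_mod_cast hb
  have h2 : (y : ℝ) ^ 2 ≤ b * (y : ℝ) ^ 2 := le_mul_of_one_le_left (by positivity) hbR
  have h3 : (a : ℝ) * (x : ℝ) ^ 2 ≤ α ^ 2 * (x : ℝ) ^ 2 := by gcongr; nlinarith
  have h4 := (abs_le.1 heβ).1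
  have h5 : 0 ≤ α * x * β := by positivity
  have h6 : (y : ℝ) ^ 2 ≤ (α * x + β) ^ 2 := by nlinarith
  exact le_of_sq_le_sq h6 (by positivity)

/-- Comparison of the intermediate bounds with the final one. -/
lemma lt_exp_of_log_le {C α β γ x M : ℝ} (hC : 0 < C) (hα : 2 ≤ α) (hβ : 3 ≤ β) (hx : 1 ≤ x)
    (hγα : α * Real.log α ≤ γ) (hγβ : Real.log β ≤ γ) (hM : M ≤ α * x + β)
    (h : 16 * α * β ≤ x → Real.log x ≤ C * α ^ 2 * Real.log α ^ 4 * γ) :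
    M < exp ((25 + 16 * C) * α ^ 2 * Real.log α ^ 3 * γ * Real.log γ) := by
  have hl2 := Real.log_two_gt_d9
  have hlα : Real.log 2 ≤ Real.log α := Real.log_le_log (by norm_num) hα
  set l := Real.log α with hl
  have hγ : 1.38 ≤ γ := by nlinarith
  have hlγ : 1 / 4 ≤ Real.log γ := by
    have h1 := Real.one_sub_inv_le_log_of_pos (by linarith : 0 < γ)
    have h2 : γ⁻¹ ≤ (1.38 : ℝ)⁻¹ := by gcongr
    norm_num at h2 ⊢
    linarith
  have hlγ8 : l ≤ 8 * Real.log γ := by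
    have hl3 : Real.log 3 ≤ 3 - 1 := Real.log_le_sub_one_of_pos (by norm_num)
    rcases le_total α 3 with h3 | h3
    · have : l ≤ Real.log 3 := Real.log_le_log (by linarith) h3
      linarith
    · have h4 : 1 ≤ l := by
        rw [hl, Real.le_log_iff_exp_le (by linarith)]
        linarith [Real.exp_one_lt_three]
      have h5 : α ≤ γ := by nlinarith
      have : l ≤ Real.log γ := Real.log_le_log (by linarith) h5
      linarith
  have hαl : 1 ≤ α ^ 2 * l ^ 3 := by
    have h1 : (0.69 : ℝ) ^ 3 ≤ l ^ 3 := by gcongr; linarith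
    have h2 : (2 : ℝ) ^ 2 ≤ α ^ 2 := by gcongr
    nlinarith
  have h2l : 2 * l ≤ γ := le_trans (by gcongr; linarith) hγα
  have hαβ : 0 < α * β := by positivity
  have hγ0 : 0 < γ := by linarith
  have hl0 : 0 < l := by linarith
  set P := α ^ 2 * l ^ 3 * γ with hP
  have hP0 : 0 < P := by positivity
  have hP1 : γ ≤ P := le_mul_of_one_le_left hγ0.le hαl
  have hmain : M ≤ exp (6 * γ + 2 * (C * α ^ 2 * l ^ 4 * γ)) := by
    have he := Real.exp_one_gt_d9
    have hQ : 0 ≤ C * α ^ 2 * l ^ 4 * γ := by positivity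
    rcases lt_or_ge x (16 * α * β) with hlt | hge
    · have h17 : (17 : ℝ) ≤ exp 3 := by
        have : exp 3 = exp 1 ^ 3 := by rw [← Real.exp_nat_mul]; norm_num
        rw [this]
        calc (17 : ℝ) ≤ 2.7 ^ 3 := by norm_num
          _ ≤ _ := by gcongr; linarith
      have h1 : M ≤ 17 * α ^ 2 * β := by nlinarith
      have h2 : 17 * α ^ 2 * β ≤ exp (3 + 2 * l + Real.log β) := by
        rw [Real.exp_add, Real.exp_add, Real.exp_log (by linarith), two_mul, Real.exp_add,
          Real.exp_log (by linarith), ← sq]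
        gcongr
      refine (h1.trans h2).trans (Real.exp_le_exp.2 ?_)
      linarith
    · have h1 : 16 * α ≤ x := le_trans (le_mul_of_one_le_right (by linarith) (by linarith)) hge
      have h2 : β ≤ x := by nlinarith
      have h3 : M ≤ 2 * x ^ 2 := by nlinarith
      have h4 : 2 * x ^ 2 ≤ exp (1 + 2 * Real.log x) := by
        rw [Real.exp_add, two_mul (Real.log x), Real.exp_add, Real.exp_log (by linarith), ← sq]
        gcongr
        linarith
      refine (h3.trans h4).trans (Real.exp_le_exp.2 ?_)
      linarith [h hge]
  refine hmain.trans_lt (Real.exp_lt_exp.2 ?_)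
  have h1 : C * α ^ 2 * l ^ 4 * γ ≤ C * P * (8 * Real.log γ) := by
    calc C * α ^ 2 * l ^ 4 * γ = C * P * l := by rw [hP]; ring
      _ ≤ _ := by gcongr
  have h2 : γ * (1 / 4) ≤ P * Real.log γ := by gcongr
  have h3 : 0 < P * Real.log γ := by positivity
  have h4 : (25 + 16 * C) * α ^ 2 * l ^ 3 * γ * Real.log γ =
      25 * (P * Real.log γ) + 2 * (C * P * (8 * Real.log γ)) := by rw [hP]; ring
  rw [h4]
  linarith

/-- Turk's theorem on the size of solutions to simultaneous Pell equations. -/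
theorem turk_simultaneous_pell :
    ∃ C : ℝ, 0 < C ∧
      ∀ (a b c d : ℕ) (e f : ℤ),
        0 < a → 0 < b → 0 < c → 0 < d →
        Squarefree a → Squarefree b → Squarefree c → Squarefree d →
        a ≠ b → c ≠ d →
        ((a : ℤ) * f = (c : ℤ) * e → ¬ IsSquare (a * b * c * d)) →
        ∀ x y z : ℕ, 0 < x → 0 < y → 0 < z →
          (a : ℤ) * (x : ℤ) ^ 2 - (b : ℤ) * (y : ℤ) ^ 2 = e →
          (c : ℤ) * (x : ℤ) ^ 2 - (d : ℤ) * (z : ℤ) ^ 2 = f →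
          let α : ℝ := max (max (a : ℝ) (b : ℝ)) (max (c : ℝ) (d : ℝ))
          let β : ℝ := max (max (|e| : ℝ) (|f| : ℝ)) 3
          let γ : ℝ := max (α * Real.log α) (Real.log β)
          (max (max (x : ℝ) (y : ℝ)) (z : ℝ)) <
            Real.exp (C * α ^ 2 * (Real.log α) ^ 3 * γ * Real.log γ) := by
  obtain ⟨C, hC, hlog⟩ := exists_log_le_of_not_isSquare
  refine ⟨25 + 16 * C, by linarith, ?_⟩
  intro a b c d e f ha hb hc hd hsa hsb hsc hsd hab hcd hsq x y z hx hy hz h1 h2 α β γ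
  have haα : (a : ℝ) ≤ α := (le_max_left _ _).trans (le_max_left _ _)
  have hbα : (b : ℝ) ≤ α := (le_max_right _ _).trans (le_max_left _ _)
  have hcα : (c : ℝ) ≤ α := (le_max_left _ _).trans (le_max_right _ _)
  have hdα : (d : ℝ) ≤ α := (le_max_right _ _).trans (le_max_right _ _)
  have heβ : |(e : ℝ)| ≤ β := (le_max_left _ _).trans (le_max_left _ _)
  have hfβ : |(f : ℝ)| ≤ β := (le_max_right _ _).trans (le_max_left _ _)
  have hβ : 3 ≤ β := le_max_right _ _
  have hγα : α * Real.log α ≤ γ := le_max_left _ _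
  have hγβ : Real.log β ≤ γ := le_max_right _ _
  clear_value α β γ
  have hα : 2 ≤ α := by
    rcases (by omega : 2 ≤ a ∨ 2 ≤ b) with h | h
    · exact le_trans (by exact_mod_cast h) haα
    · exact le_trans (by exact_mod_cast h) hbα
  have hγ : 1 ≤ γ := by
    refine le_trans ?_ hγβ
    rw [Real.le_log_iff_exp_le (by linarith)]
    linarith [Real.exp_one_lt_three]
  have hx1 : (1 : ℝ) ≤ x := by exact_mod_cast hx
  refine lt_exp_of_log_le hC hα hβ hx1 hγα hγβ (max_le (max_le ?_ ?_) ?_) fun hge => ?_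
  · nlinarith
  · exact pell_le hb h1 haα (by linarith) (by linarith) heβ
  · exact pell_le hd h2 hcα (by linarith) (by linarith) hfβ
  · refine hlog a b c d e f ha hb hc hd (fun h => hab (hsa.eq_of_isSquare_mul hsb h))
      (fun h => hcd (hsc.eq_of_isSquare_mul hsd h)) (fun h => ?_) x y z hx hy hz h1 h2 α β γ
      haα hbα hcα hdα hα heβ hfβ hγα hγβ hγ hge
    rw [← mul_assoc] at h
    have hlt := lt_of_isSquare ha hc h (fun h' => hsq h' h) h1 h2 haα hcα (by linarith) heβ hfβ
    exact absurd hge hlt.not_ge
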